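/- Let k ⊂ ℂ be an imaginary quadratic field, let n ≥ 1, let L₁, …, Lₙ ⊂ ℂ be quadratic extensions of k, and let L₁′, …, Lₙ′ be their images under complex conjugation. Assume the compositum L of L₁, …, Lₙ, L₁′, …, Lₙ′ satisfies [L : k] = 2^{2n}. Let 𝒫 be the set of rational primes p such that p splits in k (i.e., pO_k is a product of two distinct prime ideals of O_k) and such that every prime ideal of O_k lying above p is nonsplit in every extension L_i/k (1 ≤ i ≤ n). Then #{p ≤ X : p ∈ 𝒫} = (1/2^{2n+1})·X/log X + O(X/(log X)²) as X → ∞, where the implied constant may depend on k and the L_i. -/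

import Mathlib

open NumberField Filter

/-- The image of an intermediate field of `ℂ/ℚ` under complex conjugation. -/
noncomputable def conjField (L : IntermediateField ℚ ℂ) : IntermediateField ℚ ℂ :=
  L.map (RingHom.toRatAlgHom (starRingEnd ℂ))

/-- A nonzero prime ideal `𝔭` of `O_k` *splits* in an extension `L/k`
(given by `h : k ≤ L`) if `𝔭 O_L` is a product of two distinct prime ideals of `O_L`. -/
def SplitsIn (k L : IntermediateField ℚ ℂ) (h : k ≤ L) (𝔭 : Ideal (𝓞 ↥k)) : Prop :=
  ∃ P Q : Ideal (𝓞 ↥L), P ≠ Q ∧ P.IsPrime ∧ Q.IsPrime ∧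
    Ideal.map (RingOfIntegers.mapRingHom (IntermediateField.inclusion h)) 𝔭 = P * Q

/-- A rational prime `p` *splits* in the number field `k` if `p O_k` is a product of
two distinct prime ideals of `O_k`. -/
def RatPrimeSplitsIn (k : IntermediateField ℚ ℂ) (p : ℕ) : Prop :=
  ∃ P Q : Ideal (𝓞 ↥k), P ≠ Q ∧ P.IsPrime ∧ Q.IsPrime ∧
    Ideal.span {(p : 𝓞 ↥k)} = P * Q

open Complex MeasureTheory Set in
theorem hasMellin_one_sub_Ioc {s : ℂ} (hs : 0 < s.re) :
    HasMellin (indicator (Ioc 0 1) (fun t : ℝ => (1 - t : ℂ))) s (1 / (s * (s + 1))) := by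
  have h1 := hasMellin_one_Ioc hs
  have h2 := hasMellin_cpow_Ioc (1 : ℂ) (s := s) (by simp; linarith)
  have h3 := hasMellin_sub h1.1 h2.1
  rw [h1.2, h2.2] at h3
  have e : (indicator (Ioc 0 1) (fun t : ℝ => (1 - t : ℂ))) =
      fun t : ℝ => indicator (Ioc 0 1) (fun _ => (1 : ℂ)) t -
        indicator (Ioc 0 1) (fun t : ℝ => (t : ℂ) ^ (1 : ℂ)) t := by
    ext t
    by_cases h : t ∈ Ioc (0 : ℝ) 1 <;> simp [h]
  rw [e]
  have hs0 : s ≠ 0 := by rintro rfl; simp at hs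
  have hs1 : s + 1 ≠ 0 := by
    intro h
    have := congrArg Complex.re h
    simp at this; linarith
  have h4 : 1 / (s * (s + 1)) = 1 / s - 1 / (s + 1) := by
    field_simp
    ring
  rw [h4]
  exact h3

open Complex MeasureTheory Set in
theorem norm_one_div_mul_add_one_le {σ : ℝ} (hσ : 1 ≤ σ) (t : ℝ) :
    ‖(1 : ℂ) / ((σ + t * I) * (σ + t * I + 1))‖ ≤ (1 + t ^ 2)⁻¹ := by
  rw [norm_div, norm_one, norm_mul, one_div]
  have h1 : ‖(σ + t * I : ℂ)‖ ^ 2 = σ ^ 2 + t ^ 2 := by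
    rw [← Complex.normSq_eq_norm_sq]; simp [Complex.normSq_apply]; ring
  have h2 : ‖(σ + t * I + 1: ℂ)‖ ^ 2 = (σ + 1) ^ 2 + t ^ 2 := by
    rw [← Complex.normSq_eq_norm_sq]; simp [Complex.normSq_apply]; ring
  apply inv_anti₀ (by positivity)
  apply le_of_sq_le_sq _ (by positivity)
  rw [mul_pow, h1, h2, sq]
  gcongr <;> nlinarith

open Complex MeasureTheory Set in
theorem perron_kernel {σ : ℝ} (hσ : 1 ≤ σ) {y : ℝ} (hy : 0 < y) :
    ((max (1 - y) 0 : ℝ) : ℂ) = (1 / (2 * Real.pi) : ℂ) *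
      ∫ t : ℝ, (y : ℂ) ^ (-(σ + t * I)) * (1 / ((σ + t * I) * (σ + t * I + 1))) := by
  set f : ℝ → ℂ := indicator (Ioc 0 1) (fun t : ℝ => (1 - t : ℂ))
  have hf : ∀ s : ℂ, 0 < s.re → mellin f s = 1 / (s * (s + 1)) := fun s hs =>
    (hasMellin_one_sub_Ioc hs).2
  have hre : ∀ t : ℝ, (0 : ℝ) < (σ + t * I : ℂ).re := by intro t; simp; linarith
  have hfy : f =ᶠ[nhds y] fun t : ℝ => ((max (1 - t) 0 : ℝ) : ℂ) := by
    filter_upwards [lt_mem_nhds hy] with t ht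
    by_cases h : t ≤ 1
    · simp [f, ht, h]
    · simp [f, h, max_eq_right (sub_nonpos.2 (le_of_not_ge h))]
  have := mellinInv_mellin_eq σ f hy (hasMellin_one_sub_Ioc (by simp; linarith)).1 ?_ ?_
  · rw [hfy.eq_of_nhds] at this
    rw [← this, mellinInv, Complex.real_smul]
    congr 1
    · simp
    · apply integral_congr_ae
      filter_upwards with t
      rw [hf _ (hre t), smul_eq_mul]
  · unfold VerticalIntegrable
    apply Integrable.mono' integrable_inv_one_add_sq
    · apply Continuous.aestronglyMeasurable
      have : (fun t : ℝ => mellin f (σ + t * I)) =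
          fun t : ℝ => (1 : ℂ) / ((σ + t * I) * (σ + t * I + 1)) := by
        ext t; exact hf _ (hre t)
      rw [this]
      apply Continuous.div (by fun_prop) (by fun_prop)
      intro t h
      rcases mul_eq_zero.1 h with h | h <;>
      · have := congrArg Complex.re h
        simp at this; linarith
    · filter_upwards with t
      rw [hf _ (hre t)]
      exact norm_one_div_mul_add_one_le hσ t
  · exact ContinuousAt.congr (by fun_prop) hfy.symm

open Complex MeasureTheory Set in
/-- Smoothed Perron formula for a measure on the positive half-line. -/
theorem perron_measure (μ : Measure ℝ) [SFinite μ] {σ : ℝ} (hσ : 1 ≤ σ)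
    (hμ : ∀ᵐ u ∂μ, 0 < u) (hi : Integrable (fun u : ℝ => u ^ (-σ)) μ) {x : ℝ} (hx : 0 < x) :
    ((∫ u, max (1 - u / x) 0 ∂μ : ℝ) : ℂ) = (1 / (2 * Real.pi) : ℂ) *
      ∫ t : ℝ, (x : ℂ) ^ (σ + t * I) * (1 / ((σ + t * I) * (σ + t * I + 1))) *
        ∫ u, (u : ℂ) ^ (-(σ + t * I)) ∂μ := by
  have hne : ∀ t : ℝ, ((σ + t * I) * (σ + t * I + 1) : ℂ) ≠ 0 := by
    intro t h
    rcases mul_eq_zero.1 h with h | h <;>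
    · have := congrArg Complex.re h
      simp at this; linarith
  have h1 : ((∫ u, max (1 - u / x) 0 ∂μ : ℝ) : ℂ) = ∫ u : ℝ, (1 / (2 * Real.pi) : ℂ) *
      (∫ t : ℝ, (x : ℂ) ^ (σ + t * I) * (1 / ((σ + t * I) * (σ + t * I + 1))) *
         (u : ℂ) ^ (-(σ + t * I))) ∂μ := by
    rw [← integral_complex_ofReal]
    apply integral_congr_ae
    filter_upwards [hμ] with u hu
    rw [perron_kernel hσ (div_pos hu hx)]
    congr 1
    apply integral_congr_ae
    filter_upwards with t
    have : ((u / x : ℝ) : ℂ) ^ (-(σ + t * I)) = (x : ℂ) ^ (σ + t * I) * (u : ℂ) ^ (-(σ + t * I)) := by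
      rw [div_eq_mul_inv, ofReal_mul, mul_cpow_ofReal_nonneg hu.le (by positivity), ofReal_inv,
        inv_cpow _ _ (by rw [arg_ofReal_of_nonneg hx.le]; exact Real.pi_pos.ne), cpow_neg, cpow_neg,
        inv_inv, mul_comm]
    rw [this]; ring
  rw [h1, integral_const_mul]
  congr 1
  rw [integral_integral_swap]
  · apply integral_congr_ae
    filter_upwards with t
    rw [← integral_const_mul]
  · have hb : Integrable (fun p : ℝ × ℝ => (p.1 ^ (-σ)) * (x ^ σ * (1 + p.2 ^ 2)⁻¹))
        (μ.prod volume) := hi.mul_prod (integrable_inv_one_add_sq.const_mul _)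
    apply hb.mono'
    · apply AEStronglyMeasurable.mul
      · apply Continuous.aestronglyMeasurable
        apply Continuous.mul
        · apply Continuous.const_cpow (by fun_prop)
          left; exact_mod_cast hx.ne'
        · exact Continuous.div (by fun_prop) (by fun_prop) (fun p => hne p.2)
      · apply Measurable.aestronglyMeasurable
        fun_prop
    · have hm : ∀ᵐ p ∂(μ.prod (volume : Measure ℝ)), 0 < p.1 :=
        Measure.quasiMeasurePreserving_fst.ae hμ
      filter_upwards [hm] with p hp
      simp only [Function.uncurry]
      rw [norm_mul, norm_mul, norm_cpow_eq_rpow_re_of_pos hx, norm_cpow_eq_rpow_re_of_pos hp,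
        mul_comm (p.1 ^ (-σ))]
      have := norm_one_div_mul_add_one_le hσ p.2
      simp only [add_re, ofReal_re, mul_re, I_re, mul_zero, ofReal_im, I_im, mul_one, sub_self, add_zero, neg_re]
      gcongr

section PowerSaving
open MeasureTheory Set Asymptotics Topology

/-- The error term `∑_{n ≤ t} a n - ρ t`, cut off to `t > 1`. -/
noncomputable def countingRemainder (a : ℕ → ℝ) (ρ : ℝ) : ℝ → ℂ :=
  (Ioi (1 : ℝ)).indicator fun t => ((∑ k ∈ Finset.Icc 1 ⌊t⌋₊, a k - ρ * t : ℝ) : ℂ)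

/-- The continuation of `(s - 1) * LSeries a s` past the line `re s = 1`. -/
noncomputable def regularizedLSeries (a : ℕ → ℝ) (ρ : ℝ) (s : ℂ) : ℂ :=
  ρ * s + (s - 1) * s * mellin (countingRemainder a ρ) (-s)

variable {a : ℕ → ℝ} {ρ δ C : ℝ}

theorem locallyIntegrableOn_sum_sub (a : ℕ → ℝ) (ρ : ℝ) :
    LocallyIntegrableOn (fun t : ℝ => ((∑ k ∈ Finset.Icc 1 ⌊t⌋₊, a k - ρ * t : ℝ) : ℂ))
      (Ici 0) := by
  have h1 : LocallyIntegrableOn (fun t : ℝ => (1 : ℝ) * ∑ k ∈ Finset.Icc 1 ⌊t⌋₊, a k) (Ici 0) :=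
    locallyIntegrableOn_mul_sum_Icc (c := a) (m := 1) le_rfl
      ((continuous_const (y := (1 : ℝ))).locallyIntegrable.locallyIntegrableOn _)
  have h2 : LocallyIntegrableOn (fun t : ℝ => ρ * t) (Ici 0) :=
    (by fun_prop : Continuous fun t : ℝ => ρ * t).locallyIntegrable.locallyIntegrableOn _
  have h3 := h1.sub h2
  intro x hx
  obtain ⟨u, hu, hi⟩ := h3 x hx
  refine ⟨u, hu, ?_⟩
  have := hi.ofReal (𝕜 := ℂ)
  simpa [IntegrableOn] using this

theorem locallyIntegrableOn_countingRemainder (a : ℕ → ℝ) (ρ : ℝ) :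
    LocallyIntegrableOn (countingRemainder a ρ) (Ioi 0) := by
  intro x hx
  obtain ⟨u, hu, hi⟩ := (locallyIntegrableOn_sum_sub a ρ).mono_set Ioi_subset_Ici_self x hx
  exact ⟨u, hu, hi.indicator measurableSet_Ioi⟩

theorem norm_countingRemainder_le (hC : ∀ t : ℝ, 1 ≤ t →
    |∑ k ∈ Finset.Icc 1 ⌊t⌋₊, a k - ρ * t| ≤ C * t ^ (1 - δ)) {t : ℝ} (ht : 1 < t) :
    ‖countingRemainder a ρ t‖ ≤ C * t ^ (1 - δ) := by
  rw [countingRemainder, indicator_of_mem (by simpa using ht), Complex.norm_real]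
  exact hC t ht.le

theorem isBigO_countingRemainder_atTop (hC : ∀ t : ℝ, 1 ≤ t →
    |∑ k ∈ Finset.Icc 1 ⌊t⌋₊, a k - ρ * t| ≤ C * t ^ (1 - δ)) :
    countingRemainder a ρ =O[atTop] fun t : ℝ => t ^ (-(δ - 1)) := by
  refine IsBigO.of_bound C ?_
  filter_upwards [eventually_gt_atTop 1] with t ht
  have h0 : (0 : ℝ) ≤ t ^ (1 - δ) := Real.rpow_nonneg (by linarith) _
  simpa [abs_of_nonneg h0, neg_sub] using norm_countingRemainder_le hC ht

theorem isBigO_countingRemainder_zero (b : ℝ) :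
    countingRemainder a ρ =O[𝓝[>] 0] fun t : ℝ => t ^ (-b) := by
  refine IsBigO.of_bound 1 ?_
  filter_upwards [mem_nhdsWithin_of_mem_nhds (Iio_mem_nhds one_pos)] with t ht
  rw [countingRemainder, indicator_of_notMem (by simpa using le_of_lt ht)]
  simp

theorem differentiableAt_regularizedLSeries (hC : ∀ t : ℝ, 1 ≤ t →
    |∑ k ∈ Finset.Icc 1 ⌊t⌋₊, a k - ρ * t| ≤ C * t ^ (1 - δ)) {s : ℂ} (hs : 1 - δ < s.re) :
    DifferentiableAt ℂ (regularizedLSeries a ρ) s := by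
  have h : DifferentiableAt ℂ (mellin (countingRemainder a ρ)) (-s) :=
    mellin_differentiableAt_of_isBigO_rpow (locallyIntegrableOn_countingRemainder a ρ)
      (isBigO_countingRemainder_atTop hC) (by simp; linarith)
      (isBigO_countingRemainder_zero (-s.re - 1)) (by simp)
  unfold regularizedLSeries
  have h2 : DifferentiableAt ℂ (fun s => mellin (countingRemainder a ρ) (-s)) s :=
    DifferentiableAt.fun_comp' s h (by fun_prop)
  fun_prop

theorem mellinConvergent_countingRemainder (hC : ∀ t : ℝ, 1 ≤ t →
    |∑ k ∈ Finset.Icc 1 ⌊t⌋₊, a k - ρ * t| ≤ C * t ^ (1 - δ)) {s : ℂ} (hs : 1 - δ < s.re) :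
    MellinConvergent (countingRemainder a ρ) (-s) :=
  mellinConvergent_of_isBigO_rpow (locallyIntegrableOn_countingRemainder a ρ)
    (isBigO_countingRemainder_atTop hC) (by simp; linarith)
    (isBigO_countingRemainder_zero (-s.re - 1)) (by simp)

theorem regularizedLSeries_one (a : ℕ → ℝ) (ρ : ℝ) : regularizedLSeries a ρ 1 = ρ := by
  simp [regularizedLSeries]

/-- Truncated formula for the continuation, with an arbitrary cut-off `N`. -/
theorem regularizedLSeries_eq (hC : ∀ t : ℝ, 1 ≤ t →
    |∑ k ∈ Finset.Icc 1 ⌊t⌋₊, a k - ρ * t| ≤ C * t ^ (1 - δ)) (ha0 : a 0 = 0) (hδ : δ ≤ 1)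
    {s : ℂ} (hs : 1 - δ < s.re) {N : ℝ} (hN : 1 ≤ N) :
    regularizedLSeries a ρ s =
      (s - 1) * (∑ k ∈ Finset.Icc 1 ⌊N⌋₊, (k : ℂ) ^ (-s) * a k
        - (N : ℂ) ^ (-s) * ∑ k ∈ Finset.Icc 1 ⌊N⌋₊, (a k : ℂ)) + ρ * s * (N : ℂ) ^ (1 - s)
      + (s - 1) * s * ∫ t in Ioi N, (t : ℂ) ^ (-s - 1) * countingRemainder a ρ t := by
  by_cases hs1 : s = 1
  · subst hs1
    simp [regularizedLSeries]
  have hs0 : s ≠ 0 := by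
    rintro rfl
    simp at hs
    linarith
  have hcont : ContinuousOn (fun t : ℝ => (t : ℂ) ^ (-s - 1)) (Icc 1 N) := by
    intro t ht
    refine ContinuousAt.continuousWithinAt ?_
    exact Complex.continuousAt_ofReal_cpow_const _ _ (Or.inr (by linarith [ht.1]))
  have hIcc : ∀ (M : ℕ) (f : ℕ → ℂ), ∑ k ∈ Finset.Icc 0 M, f k * (a k : ℂ)
      = ∑ k ∈ Finset.Icc 1 M, f k * (a k : ℂ) := by
    intro M f
    rw [← Finset.Ico_succ_right_eq_Icc, ← Finset.Ico_succ_right_eq_Icc,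
      Finset.sum_eq_sum_Ico_succ_bot (by simp)]
    simp [ha0]
  have hconv := mellinConvergent_countingRemainder hC hs
  have hsplit : mellin (countingRemainder a ρ) (-s)
      = (∫ t in Ioc 1 N, (t : ℂ) ^ (-s - 1) * countingRemainder a ρ t)
        + ∫ t in Ioi N, (t : ℂ) ^ (-s - 1) * countingRemainder a ρ t := by
    have h1 := setIntegral_union (Ioc_disjoint_Ioi le_rfl) measurableSet_Ioi
      (hconv.mono_set (s := Ioc 1 N) fun t ht => by simp at ht ⊢; linarith)
      (hconv.mono_set (s := Ioi N) fun t ht => by simp at ht ⊢; linarith)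
    rw [Ioc_union_Ioi_eq_Ioi hN] at h1
    simp only [smul_eq_mul] at h1
    rw [← h1, mellin]
    simp only [smul_eq_mul]
    rw [← integral_indicator measurableSet_Ioi, ← integral_indicator measurableSet_Ioi]
    congr 1
    ext t
    by_cases ht : 1 < t
    · have : 0 < t := by linarith
      simp [indicator, ht, this]
    · simp [indicator, ht, countingRemainder]
  have habel : ∑ k ∈ Finset.Icc 1 ⌊N⌋₊, (k : ℂ) ^ (-s) * a k
        - (N : ℂ) ^ (-s) * ∑ k ∈ Finset.Icc 1 ⌊N⌋₊, (a k : ℂ)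
      = s * ∫ t in Ioc 1 N, (t : ℂ) ^ (-s - 1) * ∑ k ∈ Finset.Icc 1 ⌊t⌋₊, (a k : ℂ) := by
    have hder : ∀ t ∈ Icc (1 : ℝ) N,
        deriv (fun x : ℝ => (x : ℂ) ^ (-s)) t = -s * (t : ℂ) ^ (-s - 1) := fun t ht =>
      Complex.deriv_ofReal_cpow_const (by linarith [ht.1]) (neg_ne_zero.mpr hs0)
    have := sum_mul_eq_sub_integral_mul₀ (fun k => (a k : ℂ)) (f := fun x : ℝ => (x : ℂ) ^ (-s))
      (by simp [ha0]) N (fun t ht => differentiableAt_id.ofReal_cpow_const (by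
        simp only [id]; linarith [ht.1]) (neg_ne_zero.mpr hs0))
      (((continuousOn_const.mul hcont).congr hder).integrableOn_Icc)
    simp only [Complex.ofReal_natCast] at this
    have h1 := fun M => hIcc M 1
    simp only [Pi.one_apply, one_mul] at h1
    rw [hIcc, h1] at this
    rw [this, ← integral_const_mul]
    simp only [h1]
    rw [sub_sub_cancel_left, ← integral_neg]
    refine setIntegral_congr_fun measurableSet_Ioc fun t ht => ?_
    rw [hder t ⟨ht.1.le, ht.2⟩]
    ring
  have hpow : (s - 1) * ∫ t in Ioc 1 N, (t : ℂ) ^ (-s - 1) * (ρ * t) = ρ * (1 - (N : ℂ) ^ (1 - s)) := by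
    have h1 : ∫ t in Ioc 1 N, (t : ℂ) ^ (-s - 1) * (ρ * t)
        = ρ * ∫ t in (1 : ℝ)..N, (t : ℂ) ^ (-s) := by
      rw [← intervalIntegral.integral_const_mul, intervalIntegral.integral_of_le hN]
      refine setIntegral_congr_fun measurableSet_Ioc fun t ht => ?_
      have ht0 : (t : ℂ) ≠ 0 := by
        have := ht.1
        exact_mod_cast (by linarith : t ≠ 0)
      rw [Complex.cpow_sub _ _ ht0, Complex.cpow_one]
      field_simp
    rw [h1, integral_cpow (Or.inr ⟨by simpa using hs1, by
      rw [uIcc_of_le hN]; simp⟩)]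
    have h2 : -s + 1 ≠ 0 := by
      intro h
      apply hs1
      linear_combination -h
    have h3 : (1 : ℂ) - s = -s + 1 := by ring
    rw [h3]
    field_simp
    simp
    ring
  have hR : ∫ t in Ioc 1 N, (t : ℂ) ^ (-s - 1) * countingRemainder a ρ t
      = (∫ t in Ioc 1 N, (t : ℂ) ^ (-s - 1) * ∑ k ∈ Finset.Icc 1 ⌊t⌋₊, (a k : ℂ))
        - ∫ t in Ioc 1 N, (t : ℂ) ^ (-s - 1) * (ρ * t) := by
    rw [← integral_sub]
    · refine setIntegral_congr_fun measurableSet_Ioc fun t ht => ?_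
      rw [countingRemainder, indicator_of_mem (by simpa using ht.1)]
      push_cast
      ring
    · exact (integrableOn_mul_sum_Icc _ zero_le_one hcont.integrableOn_Icc).mono_set
        Ioc_subset_Icc_self
    · exact ((hcont.mul (by fun_prop)).integrableOn_Icc).mono_set Ioc_subset_Icc_self
  rw [regularizedLSeries, hsplit, hR, habel]
  linear_combination (-s) * hpow

end PowerSaving

section PowerSavingBounds
open MeasureTheory Set Asymptotics Topology

/-- Nonnegative coefficients whose summatory function is `ρ t + O(t ^ (1 - δ))`. -/
structure HasPowerSaving (a : ℕ → ℝ) (ρ δ C : ℝ) : Prop where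
  map_zero : a 0 = 0
  nonneg : ∀ n, 0 ≤ a n
  residue_pos : 0 < ρ
  exponent_pos : 0 < δ
  exponent_le_one : δ ≤ 1
  bound : ∀ t : ℝ, 1 ≤ t → |∑ k ∈ Finset.Icc 1 ⌊t⌋₊, a k - ρ * t| ≤ C * t ^ (1 - δ)

variable {a : ℕ → ℝ} {ρ δ C : ℝ}

namespace HasPowerSaving

theorem const_nonneg (h : HasPowerSaving a ρ δ C) : 0 ≤ C := by
  have := (abs_nonneg _).trans (h.bound 1 le_rfl)
  simpa using this

theorem sum_isBigO (h : HasPowerSaving a ρ δ C) :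
    (fun n : ℕ => ∑ k ∈ Finset.Icc 1 n, a k) =O[atTop] fun n : ℕ => (n : ℝ) ^ (1 : ℝ) := by
  refine IsBigO.of_bound (C + ρ) ?_
  filter_upwards [eventually_ge_atTop 1] with n hn
  have hn' : (1 : ℝ) ≤ n := by exact_mod_cast hn
  have h1 := h.bound n hn'
  rw [Nat.floor_natCast] at h1
  have h2 : (n : ℝ) ^ (1 - δ) ≤ n := by
    conv_rhs => rw [← Real.rpow_one (n : ℝ)]
    exact Real.rpow_le_rpow_of_exponent_le hn' (by linarith [h.exponent_pos])
  have h3 := abs_le.mp h1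
  have h4 : 0 ≤ ∑ k ∈ Finset.Icc 1 n, a k := Finset.sum_nonneg fun k _ => h.nonneg k
  rw [Real.rpow_one, Real.norm_of_nonneg h4, Real.norm_of_nonneg (by linarith)]
  nlinarith [mul_le_mul_of_nonneg_left h2 h.const_nonneg]

theorem lseriesSummable (h : HasPowerSaving a ρ δ C) {s : ℂ} (hs : 1 < s.re) :
    LSeriesSummable (fun n => (a n : ℂ)) s :=
  LSeriesSummable_of_sum_norm_bigO_and_nonneg h.sum_isBigO h.nonneg zero_le_one hs

theorem sub_one_mul_lseries (h : HasPowerSaving a ρ δ C) {s : ℂ} (hs : 1 < s.re) :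
    (s - 1) * LSeries (fun n => (a n : ℂ)) s = regularizedLSeries a ρ s := by
  have hs1 : s ≠ 1 := by
    rintro rfl
    simp at hs
  have hδ : 1 - δ < s.re := by linarith [h.exponent_pos]
  have hconv := mellinConvergent_countingRemainder h.bound hδ
  rw [LSeries_eq_mul_integral_of_nonneg a zero_le_one hs h.sum_isBigO h.nonneg,
    regularizedLSeries]
  have hI : IntegrableOn (fun t : ℝ => (t : ℂ) ^ (-s)) (Ioi 1) :=
    integrableOn_Ioi_cpow_of_lt (by simpa using hs) one_pos
  have h1 : ∫ t in Ioi (1 : ℝ), (∑ k ∈ Finset.Icc 1 ⌊t⌋₊, (a k : ℂ)) * (t : ℂ) ^ (-(s + 1))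
      = mellin (countingRemainder a ρ) (-s) + ρ * ∫ t in Ioi (1 : ℝ), (t : ℂ) ^ (-s) := by
    have hz : ∫ t in Ioc (0 : ℝ) 1, (t : ℂ) ^ (-s - 1) • countingRemainder a ρ t = 0 :=
      setIntegral_eq_zero_of_forall_eq_zero fun t ht => by
        rw [countingRemainder, indicator_of_notMem (by simpa using ht.2), smul_zero]
    have hm : mellin (countingRemainder a ρ) (-s)
        = ∫ t in Ioi (1 : ℝ), (t : ℂ) ^ (-s - 1) • countingRemainder a ρ t := by
      rw [mellin, ← Ioc_union_Ioi_eq_Ioi zero_le_one,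
        setIntegral_union (Ioc_disjoint_Ioi le_rfl) measurableSet_Ioi
        (hconv.mono_set Ioc_subset_Ioi_self) (hconv.mono_set (Ioi_subset_Ioi zero_le_one)),
        hz, zero_add]
    rw [hm, ← integral_const_mul,
      ← integral_add (hconv.mono_set (Ioi_subset_Ioi zero_le_one)) (hI.const_mul _)]
    refine setIntegral_congr_fun measurableSet_Ioi fun t ht => ?_
    have ht1 : (1 : ℝ) < t := ht
    have ht0 : (t : ℂ) ≠ 0 := by exact_mod_cast (by linarith : t ≠ 0)
    rw [countingRemainder, indicator_of_mem ht, smul_eq_mul,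
      show -(s + 1) = -s - 1 by ring, Complex.cpow_sub _ _ ht0, Complex.cpow_one]
    push_cast
    field_simp
    ring
  rw [h1, integral_Ioi_cpow_of_lt (by simpa using hs) one_pos]
  have h2 : -s + 1 ≠ 0 := by
    intro h
    apply hs1
    linear_combination -h
  simp only [Complex.ofReal_one, Complex.one_cpow]
  field_simp
  ring

/-- Almost linear growth of the continuation in a strip slightly wider than `1 ≤ re s`. -/
theorem exists_norm_regularizedLSeries_le (h : HasPowerSaving a ρ δ C) {ε : ℝ} (hε : 0 < ε) :
    ∃ η K : ℝ, 0 < η ∧ η < δ ∧ 0 ≤ K ∧ ∀ s : ℂ, 1 - η ≤ s.re → s.re ≤ 3 →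
      ‖regularizedLSeries a ρ s‖ ≤ K * (1 + |s.im|) ^ (1 + ε) := by
  have hδ := h.exponent_pos
  have hδ1 := h.exponent_le_one
  have hρ := h.residue_pos
  have hC := h.const_nonneg
  obtain ⟨η, hη, hη1, hη2⟩ : ∃ η : ℝ, 0 < η ∧ η ≤ δ / 2 ∧ 4 * η / δ ≤ ε :=
    ⟨min (δ / 2) (ε * δ / 4), by positivity, min_le_left _ _, by
      rw [div_le_iff₀ hδ]
      linarith [min_le_right (δ / 2) (ε * δ / 4)]⟩
  have hsum := h.lseriesSummable (s := ((1 + η : ℝ) : ℂ)) (by simpa using hη)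
  set S : ℝ := ∑' n, ‖LSeries.term (fun n => (a n : ℂ)) ((1 + η : ℝ) : ℂ) n‖ with hS
  have hS0 : 0 ≤ S := tsum_nonneg fun _ => norm_nonneg _
  refine ⟨η, 4 * S + 3 * ρ + 12 * C / δ, hη, by linarith, by positivity, fun s hs1 hs3 => ?_⟩
  set τ : ℝ := 1 + |s.im| with hτ
  have hτ1 : 1 ≤ τ := by rw [hτ]; linarith [abs_nonneg s.im]
  have hτ0 : 0 < τ := by linarith
  set N : ℝ := τ ^ (2 / δ) with hN
  have hN1 : 1 ≤ N := Real.one_le_rpow hτ1 (by positivity)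
  have hN0 : 0 < N := by linarith
  have hNη : N ^ (2 * η) ≤ τ ^ ε := by
    rw [hN, ← Real.rpow_mul hτ0.le]
    refine Real.rpow_le_rpow_of_exponent_le hτ1 (le_trans (le_of_eq ?_) hη2)
    field_simp
    ring
  have hτpow : τ ^ (1 + ε) = τ * τ ^ ε := by rw [Real.rpow_add hτ0, Real.rpow_one]
  have hτε : 1 ≤ τ ^ ε := Real.one_le_rpow hτ1 hε.le
  have hsn : ‖s‖ ≤ 3 * τ := by
    have := Complex.norm_le_abs_re_add_abs_im s
    have h4 : |s.re| ≤ 3 := abs_le.mpr ⟨by linarith, hs3⟩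
    linarith [abs_nonneg s.im]
  have hsn1 : ‖s - 1‖ ≤ 2 * τ := by
    have := Complex.norm_le_abs_re_add_abs_im (s - 1)
    have h4 : |(s - 1).re| ≤ 2 := by
      simp only [Complex.sub_re, Complex.one_re]
      exact abs_le.mpr ⟨by linarith, by linarith⟩
    simp only [Complex.sub_im, Complex.one_im, sub_zero] at this
    linarith [abs_nonneg s.im]
  have hσ : 1 - δ < s.re := by linarith
  have hσ0 : 0 ≤ s.re := by linarith
  rw [regularizedLSeries_eq h.bound h.map_zero hδ1 hσ hN1]
  have hhead : ∑ k ∈ Finset.Icc 1 ⌊N⌋₊, (k : ℝ) ^ (-s.re) * a k ≤ S * τ ^ ε := by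
    have hk : ∀ k ∈ Finset.Icc 1 ⌊N⌋₊, (k : ℝ) ^ (-s.re) * a k ≤
        ‖LSeries.term (fun n => (a n : ℂ)) ((1 + η : ℝ) : ℂ) k‖ * τ ^ ε := by
      intro k hk
      have hk1 : 1 ≤ k := (Finset.mem_Icc.mp hk).1
      have hk0 : (0 : ℝ) < k := by exact_mod_cast hk1
      have hkN : (k : ℝ) ≤ N := (Nat.le_floor_iff hN0.le).mp (Finset.mem_Icc.mp hk).2
      rw [LSeries.term_of_ne_zero (by omega), norm_div, Complex.norm_real,
        Real.norm_of_nonneg (h.nonneg k), ← Complex.ofReal_natCast,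
        Complex.norm_cpow_eq_rpow_re_of_pos hk0, Complex.ofReal_re, div_eq_mul_inv,
        ← Real.rpow_neg hk0.le, mul_assoc, mul_comm]
      refine mul_le_mul_of_nonneg_left ?_ (h.nonneg k)
      calc (k : ℝ) ^ (-s.re) ≤ (k : ℝ) ^ (-(1 + η) + 2 * η) :=
            Real.rpow_le_rpow_of_exponent_le (by exact_mod_cast hk1) (by linarith)
        _ = (k : ℝ) ^ (-(1 + η)) * (k : ℝ) ^ (2 * η) := Real.rpow_add hk0 _ _
        _ ≤ _ := by
          gcongr
          exact (Real.rpow_le_rpow hk0.le hkN (by linarith)).trans hNη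
    refine (Finset.sum_le_sum hk).trans ?_
    rw [← Finset.sum_mul]
    gcongr
    exact hsum.norm.sum_le_tsum _ fun _ _ => norm_nonneg _
  have h1 : ‖∑ k ∈ Finset.Icc 1 ⌊N⌋₊, (k : ℂ) ^ (-s) * a k‖ ≤ S * τ ^ ε := by
    refine (norm_sum_le _ _).trans ((Finset.sum_le_sum fun k hk => ?_).trans hhead)
    have hk0 : (0 : ℝ) < k := by exact_mod_cast (Finset.mem_Icc.mp hk).1
    rw [norm_mul, Complex.norm_real, Real.norm_of_nonneg (h.nonneg k), ← Complex.ofReal_natCast,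
      Complex.norm_cpow_eq_rpow_re_of_pos hk0, Complex.neg_re]
  have h2 : ‖(N : ℂ) ^ (-s) * ∑ k ∈ Finset.Icc 1 ⌊N⌋₊, (a k : ℂ)‖ ≤ S * τ ^ ε := by
    refine le_trans ?_ hhead
    rw [norm_mul, Complex.norm_cpow_eq_rpow_re_of_pos hN0, ← Complex.ofReal_sum,
      Complex.norm_real, Real.norm_of_nonneg (Finset.sum_nonneg fun k _ => h.nonneg k),
      Finset.mul_sum]
    refine Finset.sum_le_sum fun k hk => mul_le_mul_of_nonneg_right ?_ (h.nonneg k)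
    have hk0 : (0 : ℝ) < k := by exact_mod_cast (Finset.mem_Icc.mp hk).1
    have hkN : (k : ℝ) ≤ N := (Nat.le_floor_iff hN0.le).mp (Finset.mem_Icc.mp hk).2
    exact Real.rpow_le_rpow_of_nonpos hk0 hkN (by simpa using hσ0)
  have h3 : ‖(N : ℂ) ^ (1 - s)‖ ≤ τ ^ ε := by
    rw [Complex.norm_cpow_eq_rpow_re_of_pos hN0]
    refine le_trans (Real.rpow_le_rpow_of_exponent_le hN1 ?_) hNη
    simp only [Complex.sub_re, Complex.one_re]
    linarith
  have h4 : ‖∫ t in Ioi N, (t : ℂ) ^ (-s - 1) * countingRemainder a ρ t‖ ≤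
      C * (2 / δ) * τ⁻¹ := by
    have hlt : -s.re - δ < -1 := by linarith
    have hintegr : IntegrableOn (fun t : ℝ => C * t ^ (-s.re - δ)) (Ioi N) :=
      (integrableOn_Ioi_rpow_of_lt hlt hN0).const_mul C
    calc _ ≤ ∫ t in Ioi N, C * t ^ (-s.re - δ) := by
          refine norm_integral_le_of_norm_le hintegr ?_
          refine (ae_restrict_iff' measurableSet_Ioi).mpr (ae_of_all _ fun t ht => ?_)
          have htN : N < t := ht
          have ht0 : 0 < t := by linarith
          rw [norm_mul, Complex.norm_cpow_eq_rpow_re_of_pos ht0]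
          refine (mul_le_mul_of_nonneg_left
            (norm_countingRemainder_le h.bound (by linarith)) (Real.rpow_nonneg ht0.le _)).trans ?_
          rw [mul_left_comm, ← Real.rpow_add ht0]
          simp only [Complex.sub_re, Complex.neg_re, Complex.one_re]
          apply le_of_eq
          ring_nf
      _ = C * (N ^ (1 - s.re - δ) / (s.re + δ - 1)) := by
          rw [integral_const_mul, integral_Ioi_rpow_of_lt hlt hN0]
          congr 1
          rw [show -s.re - δ + 1 = 1 - s.re - δ by ring, neg_div, ← div_neg]
          congr 1
          ring
      _ ≤ C * (τ⁻¹ / (δ / 2)) := by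
          gcongr
          · rw [hN, ← Real.rpow_mul hτ0.le, ← Real.rpow_neg_one]
            refine Real.rpow_le_rpow_of_exponent_le hτ1 ?_
            rw [div_mul_eq_mul_div, div_le_iff₀ hδ]
            linarith
          · linarith
      _ = C * (2 / δ) * τ⁻¹ := by
          field_simp
  have hfin : ∀ A B D E F : ℂ, ‖(s - 1) * (A - B) + D * s * E + (s - 1) * s * F‖ ≤
      2 * τ * (‖A‖ + ‖B‖) + ‖D‖ * (3 * τ) * ‖E‖ + 2 * τ * (3 * τ) * ‖F‖ := by
    intro A B D E F
    refine (norm_add₃_le).trans ?_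
    simp only [norm_mul]
    gcongr
    exact norm_sub_le _ _
  refine (hfin _ _ _ _ _).trans ?_
  rw [Complex.norm_real, Real.norm_of_nonneg hρ.le, hτpow]
  calc _ ≤ 2 * τ * (S * τ ^ ε + S * τ ^ ε) + ρ * (3 * τ) * τ ^ ε
        + 2 * τ * (3 * τ) * (C * (2 / δ) * τ⁻¹) := by gcongr
    _ = (4 * S + 3 * ρ) * (τ * τ ^ ε) + 12 * C / δ * (τ * 1) := by
        field_simp
        ring
    _ ≤ (4 * S + 3 * ρ) * (τ * τ ^ ε) + 12 * C / δ * (τ * τ ^ ε) := by gcongr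
    _ = _ := by ring

theorem exists_norm_iteratedDeriv_le (h : HasPowerSaving a ρ δ C) {ε : ℝ} (hε : 0 < ε) :
    ∃ η K : ℝ, 0 < η ∧ 0 < K ∧ ∀ j ≤ 3, ∀ s : ℂ, 1 - η ≤ s.re → s.re ≤ 2 →
      ‖iteratedDeriv j (regularizedLSeries a ρ) s‖ ≤ K * (1 + |s.im|) ^ (1 + ε) := by
  obtain ⟨η, K, hη, hηδ, hK, hb⟩ := h.exists_norm_regularizedLSeries_le hε
  have hδ1 := h.exponent_le_one
  set r := η / 2 with hr
  have hr0 : 0 < r := by positivity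
  have hr1 : r ≤ 1 := by linarith
  refine ⟨r, 6 * ((K + 1) * 2 ^ (1 + ε)) / r ^ 3, hr0, by positivity, fun j hj s hs1 hs2 => ?_⟩
  have hre : ∀ z ∈ Metric.closedBall s r, |z.re - s.re| ≤ r ∧ |z.im - s.im| ≤ r := by
    intro z hz
    rw [mem_closedBall_iff_norm] at hz
    exact ⟨(Complex.abs_re_le_norm (z - s)).trans hz, (Complex.abs_im_le_norm (z - s)).trans hz⟩
  have hd : DiffContOnCl ℂ (regularizedLSeries a ρ) (Metric.ball s r) := by
    refine DifferentiableOn.diffContOnCl fun z hz => ?_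
    rw [closure_ball s hr0.ne'] at hz
    refine (differentiableAt_regularizedLSeries h.bound ?_).differentiableWithinAt
    have := (abs_le.mp (hre z hz).1).1
    linarith
  refine (Complex.norm_iteratedDeriv_le_of_forall_mem_sphere_norm_le j hr0 hd
    (C := (K + 1) * 2 ^ (1 + ε) * (1 + |s.im|) ^ (1 + ε)) fun z hz => ?_).trans ?_
  · obtain ⟨h1, h2⟩ := hre z (Metric.sphere_subset_closedBall hz)
    have h3 := abs_le.mp h1
    refine (hb z (by linarith) (by linarith)).trans ?_
    rw [mul_assoc, ← Real.mul_rpow (by norm_num) (by positivity)]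
    have h4 : |z.im| ≤ |s.im| + 1 := by
      have := abs_add_le (z.im - s.im) s.im
      rw [sub_add_cancel] at this
      linarith
    gcongr
    · linarith
    · linarith [abs_nonneg s.im]
  · have hj6 : (j.factorial : ℝ) ≤ 6 := by
      have := Nat.factorial_le hj
      exact_mod_cast this
    have hrj : r ^ 3 ≤ r ^ j := pow_le_pow_of_le_one hr0.le hr1 hj
    rw [div_mul_eq_mul_div, mul_assoc 6]
    gcongr

end HasPowerSaving
end PowerSavingBounds

section LogDerivative
open MeasureTheory Set Asymptotics Topology LSeries

/-- Nonnegative coefficients `Λ`, dominated by the von Mangoldt function, such that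
`-Z' / Z` has coefficients `Λ` where `Z` is the `L`-series of `a`. -/
structure HasLogDeriv (a Λ : ℕ → ℝ) (D : ℝ) : Prop where
  map_one : a 1 = 1
  nonneg : ∀ n, 0 ≤ Λ n
  le_vonMangoldt : ∀ n, Λ n ≤ D * ArithmeticFunction.vonMangoldt n
  mul_log : ∀ n, a n * Real.log n = ∑ x ∈ n.divisorsAntidiagonal, Λ x.1 * a x.2

variable {a Λ : ℕ → ℝ} {ρ δ C D : ℝ}

theorem isOpen_one_lt_re : IsOpen {s : ℂ | 1 < s.re} :=
  isOpen_lt continuous_const Complex.continuous_re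

namespace HasLogDeriv

theorem lseriesSummable (h : HasLogDeriv a Λ D) {s : ℂ} (hs : 1 < s.re) :
    LSeriesSummable (fun n => (Λ n : ℂ)) s := by
  have h1 := (ArithmeticFunction.LSeriesSummable_vonMangoldt hs).smul (D : ℂ)
  refine Summable.of_norm_bounded h1.norm fun n => norm_term_le s ?_
  have h2 := h.le_vonMangoldt n
  simp only [Pi.smul_apply, smul_eq_mul, ← Complex.ofReal_mul, Complex.norm_real]
  exact (Real.norm_of_nonneg (h.nonneg n)).le.trans (h2.trans (le_abs_self _))

theorem map_zero_eq (h : HasLogDeriv a Λ D) : Λ 0 = 0 :=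
  le_antisymm (by simpa using h.le_vonMangoldt 0) (h.nonneg 0)

theorem map_one_eq (h : HasLogDeriv a Λ D) : Λ 1 = 0 :=
  le_antisymm (by simpa using h.le_vonMangoldt 1) (h.nonneg 1)

theorem logMul_div_log (h : HasLogDeriv a Λ D) :
    logMul (fun n => ((Λ n / Real.log n : ℝ) : ℂ)) = fun n => (Λ n : ℂ) := by
  ext n
  rcases n with _ | _ | n
  · simp [logMul, h.map_zero_eq]
  · simp [logMul, h.map_one_eq]
  · have h1 : Real.log ((n + 1 + 1 : ℕ) : ℝ) ≠ 0 :=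
      (Real.log_pos (by exact_mod_cast (by omega : 1 < n + 1 + 1))).ne'
    rw [logMul, ← Complex.natCast_log, ← Complex.ofReal_mul]
    congr 1
    field_simp

theorem abscissaOfAbsConv_le (h : HasLogDeriv a Λ D) :
    abscissaOfAbsConv (fun n => (Λ n : ℂ)) ≤ 1 :=
  abscissaOfAbsConv_le_of_forall_lt_LSeriesSummable' fun y hy =>
    h.lseriesSummable (by simpa using EReal.coe_lt_coe_iff.mp hy)

theorem abscissaOfAbsConv_div_log_le (h : HasLogDeriv a Λ D) :
    abscissaOfAbsConv (fun n => ((Λ n / Real.log n : ℝ) : ℂ)) ≤ 1 := by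
  rw [← abscissaOfAbsConv_logMul, h.logMul_div_log]
  exact h.abscissaOfAbsConv_le

theorem _root_.HasPowerSaving.abscissaOfAbsConv_le (ha : HasPowerSaving a ρ δ C) :
    abscissaOfAbsConv (fun n => (a n : ℂ)) ≤ 1 :=
  abscissaOfAbsConv_le_of_forall_lt_LSeriesSummable' fun y hy =>
    ha.lseriesSummable (by simpa using EReal.coe_lt_coe_iff.mp hy)

theorem _root_.one_lt_ereal_of_re {s : ℂ} (hs : 1 < s.re) : (1 : EReal) < s.re := by
  exact_mod_cast hs

theorem hasDerivAt_lseries (h : HasLogDeriv a Λ D) (ha : HasPowerSaving a ρ δ C) {s : ℂ}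
    (hs : 1 < s.re) : HasDerivAt (LSeries fun n => (a n : ℂ))
      (-(LSeries (fun n => (Λ n : ℂ)) s * LSeries (fun n => (a n : ℂ)) s)) s := by
  have h1 := LSeries_hasDerivAt (ha.abscissaOfAbsConv_le.trans_lt (one_lt_ereal_of_re hs))
  rw [← LSeries_convolution' (h.lseriesSummable hs) (ha.lseriesSummable hs)]
  convert! h1 using 3
  ext n
  rw [LSeries.convolution_def, logMul, ← Complex.natCast_log, ← Complex.ofReal_mul, mul_comm, h.mul_log]
  push_cast
  rfl

theorem hasDerivAt_lseries_div_log (h : HasLogDeriv a Λ D) {s : ℂ}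
    (hs : 1 < s.re) : HasDerivAt (LSeries fun n => ((Λ n / Real.log n : ℝ) : ℂ))
      (-LSeries (fun n => (Λ n : ℂ)) s) s := by
  have h1 := LSeries_hasDerivAt (h.abscissaOfAbsConv_div_log_le.trans_lt (one_lt_ereal_of_re hs))
  rwa [h.logMul_div_log] at h1

theorem lseries_eq_exp (h : HasLogDeriv a Λ D) (ha : HasPowerSaving a ρ δ C) {s : ℂ}
    (hs : 1 < s.re) : LSeries (fun n => (a n : ℂ)) s =
      Complex.exp (LSeries (fun n => ((Λ n / Real.log n : ℝ) : ℂ)) s) := by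
  set G : ℂ → ℂ := fun s => LSeries (fun n => (a n : ℂ)) s *
    Complex.exp (-LSeries (fun n => ((Λ n / Real.log n : ℝ) : ℂ)) s) with hG
  have hd : ∀ s : ℂ, 1 < s.re → HasDerivAt G 0 s := by
    intro s hs
    convert! (h.hasDerivAt_lseries ha hs).mul (h.hasDerivAt_lseries_div_log hs).neg.cexp using 1
    ring
  have hconst : ∀ z w : ℂ, 1 < z.re → 1 < w.re → G z = G w := by
    intro z w hz hw
    refine isOpen_one_lt_re.is_const_of_deriv_eq_zero
      (convex_halfSpace_re_gt 1).isPreconnected (fun x hx => ?_) (fun x hx => ?_) hz hw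
    · exact (hd x hx).differentiableAt.differentiableWithinAt
    · exact (hd x hx).deriv
  have hlim : Tendsto (fun x : ℝ => G x) atTop (𝓝 (1 * Complex.exp (-0))) := by
    have h1 := LSeries.tendsto_atTop (f := fun n => (a n : ℂ))
      (ha.abscissaOfAbsConv_le.trans_lt (by exact_mod_cast EReal.coe_lt_top 1))
    have h2 := LSeries.tendsto_atTop (f := fun n => ((Λ n / Real.log n : ℝ) : ℂ))
      (h.abscissaOfAbsConv_div_log_le.trans_lt (by exact_mod_cast EReal.coe_lt_top 1))
    simp only [h.map_one, h.map_one_eq, zero_div, Complex.ofReal_zero, Complex.ofReal_one] at h1 h2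
    exact h1.mul h2.neg.cexp
  have hG1 : G s = 1 := by
    have h3 : Tendsto (fun x : ℝ => G x) atTop (𝓝 (G s)) := by
      refine tendsto_const_nhds.congr' ?_
      filter_upwards [eventually_gt_atTop 1] with x hx
      exact hconst _ _ hs (by simpa using hx)
    simpa using tendsto_nhds_unique h3 hlim
  rw [hG] at hG1
  simp only [Complex.exp_neg] at hG1
  field_simp at hG1
  exact hG1

theorem _root_.term_ofReal_add_mul_I {f : ℕ → ℝ} {σ t : ℝ} {n : ℕ} (hn : n ≠ 0) :
    term (fun n => (f n : ℂ)) (σ + t * Complex.I) n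
      = ((f n * (n : ℝ) ^ (-σ) : ℝ) : ℂ) * ((n : ℂ) ^ (-(t * Complex.I))) := by
  have hn0 : (n : ℂ) ≠ 0 := by exact_mod_cast hn
  rw [term_of_ne_zero hn, div_eq_mul_inv, ← Complex.cpow_neg, neg_add, Complex.cpow_add _ _ hn0,
    Complex.ofReal_mul, Complex.ofReal_cpow (Nat.cast_nonneg n)]
  push_cast
  ring

theorem one_le_norm_lseries_mul (h : HasLogDeriv a Λ D) (ha : HasPowerSaving a ρ δ C) {σ : ℝ}
    (hσ : 1 < σ) (t : ℝ) :
    1 ≤ ‖LSeries (fun n => (a n : ℂ)) σ‖ ^ 3 *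
      ‖LSeries (fun n => (a n : ℂ)) (σ + t * Complex.I)‖ ^ 4 *
      ‖LSeries (fun n => (a n : ℂ)) (σ + (2 * t : ℝ) * Complex.I)‖ := by
  set f : ℕ → ℝ := fun n => Λ n / Real.log n with hf
  have hf0 : ∀ n, 0 ≤ f n := fun n => div_nonneg (h.nonneg n) (Real.log_natCast_nonneg n)
  have hsum : ∀ s : ℂ, 1 < s.re → Summable (term (fun n => (f n : ℂ)) s) := fun s hs =>
    LSeriesSummable_of_abscissaOfAbsConv_lt_re
      (h.abscissaOfAbsConv_div_log_le.trans_lt (one_lt_ereal_of_re hs))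
  have hr : ∀ u : ℝ, 1 < ((σ : ℂ) + u * Complex.I).re := fun u => by simpa using hσ
  have hr0 : 1 < (σ : ℂ).re := by simpa using hσ
  rw [h.lseries_eq_exp ha (hr t), h.lseries_eq_exp ha (hr (2 * t)), h.lseries_eq_exp ha hr0]
  simp only [Complex.norm_exp, ← Real.exp_nat_mul, ← Real.exp_add]
  rw [Real.one_le_exp_iff, LSeries, LSeries, LSeries, Complex.re_tsum (hsum _ hr0),
    Complex.re_tsum (hsum _ (hr t)), Complex.re_tsum (hsum _ (hr (2 * t)))]
  have s0 := (Complex.hasSum_re (hsum _ hr0).hasSum).summable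
  have s1 := (Complex.hasSum_re (hsum _ (hr t)).hasSum).summable
  have s2 := (Complex.hasSum_re (hsum _ (hr (2 * t))).hasSum).summable
  push_cast
  rw [← tsum_mul_left, ← tsum_mul_left, ← (s0.mul_left 3).tsum_add (s1.mul_left 4),
    ← ((s0.mul_left 3).add (s1.mul_left 4)).tsum_add (by simpa using s2)]
  refine tsum_nonneg fun n => ?_
  rcases eq_or_ne n 0 with rfl | hn
  · simp
  have e0 := term_ofReal_add_mul_I (f := f) (σ := σ) (t := 0) hn
  have e1 := term_ofReal_add_mul_I (f := f) (σ := σ) (t := t) hn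
  have e2 := term_ofReal_add_mul_I (f := f) (σ := σ) (t := 2 * t) hn
  have hn0 : (n : ℂ) ≠ 0 := by exact_mod_cast hn
  simp only [Complex.ofReal_zero, zero_mul, add_zero, neg_zero, Complex.cpow_zero, mul_one] at e0
  set z : ℂ := (n : ℂ) ^ (-(t * Complex.I)) with hz
  have hz2 : (n : ℂ) ^ (-(((2 * t : ℝ) : ℂ) * Complex.I)) = z * z := by
    rw [hz, ← Complex.cpow_add _ _ hn0]
    congr 1
    push_cast
    ring
  have hz1 : z.re * z.re + z.im * z.im = 1 := by
    have h1 : ‖z‖ = 1 := by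
      rw [hz, Complex.norm_natCast_cpow_of_pos (Nat.pos_of_ne_zero hn)]
      simp
    rw [← Complex.normSq_apply, Complex.normSq_eq_norm_sq, h1, one_pow]
  rw [hz2] at e2
  push_cast at e2
  simp only [Complex.ofReal_mul] at e0 e1
  rw [e0, e1, e2]
  simp only [← Complex.ofReal_mul, Complex.ofReal_im, Complex.ofReal_re, Complex.mul_re, zero_mul, sub_zero]
  have hc : 0 ≤ f n * (n : ℝ) ^ (-σ) := mul_nonneg (hf0 n) (Real.rpow_nonneg (Nat.cast_nonneg n) _)
  have : 0 ≤ f n * (n : ℝ) ^ (-σ) * (2 * (1 + z.re) ^ 2) := by positivity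
  linear_combination this + f n * (n : ℝ) ^ (-σ) * hz1

end HasLogDeriv
end LogDerivative

section LowerBound
open MeasureTheory Set Asymptotics Topology LSeries

variable {a Λ : ℕ → ℝ} {ρ δ C D : ℝ}

namespace HasLogDeriv

theorem sub_one_pow_le_norm_regularizedLSeries_mul (h : HasLogDeriv a Λ D)
    (ha : HasPowerSaving a ρ δ C) {σ : ℝ} (hσ : 1 < σ) (t : ℝ) :
    (σ - 1) ^ 3 * (2 * |t| ^ 5) ≤ ‖regularizedLSeries a ρ σ‖ ^ 3 *
      ‖regularizedLSeries a ρ (σ + t * Complex.I)‖ ^ 4 *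
      ‖regularizedLSeries a ρ (σ + (2 * t : ℝ) * Complex.I)‖ := by
  have hr : ∀ u : ℝ, 1 < ((σ : ℂ) + u * Complex.I).re := fun u => by simpa using hσ
  have hr0 : 1 < (σ : ℂ).re := by simpa using hσ
  rw [← ha.sub_one_mul_lseries hr0, ← ha.sub_one_mul_lseries (hr t),
    ← ha.sub_one_mul_lseries (hr (2 * t))]
  have him : ∀ u : ℝ, |u| ≤ ‖(σ : ℂ) + u * Complex.I - 1‖ := fun u => by
    simpa using Complex.abs_im_le_norm ((σ : ℂ) + u * Complex.I - 1)
  have h0 : ‖(σ : ℂ) - 1‖ = σ - 1 := by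
    rw [← Complex.ofReal_one, ← Complex.ofReal_sub, Complex.norm_real, Real.norm_of_nonneg]
    linarith
  have h2 := him (2 * t)
  rw [abs_mul, abs_two] at h2
  have h1 := h.one_le_norm_lseries_mul ha hσ t
  have hσ0 : 0 ≤ σ - 1 := by linarith
  simp only [norm_mul, h0]
  calc (σ - 1) ^ 3 * (2 * |t| ^ 5) = (σ - 1) ^ 3 * |t| ^ 4 * (2 * |t|) * 1 := by ring
    _ ≤ (σ - 1) ^ 3 * ‖(σ : ℂ) + t * Complex.I - 1‖ ^ 4 *
        ‖(σ : ℂ) + (2 * t : ℝ) * Complex.I - 1‖ *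
        (‖LSeries (fun n => (a n : ℂ)) σ‖ ^ 3 *
        ‖LSeries (fun n => (a n : ℂ)) (σ + t * Complex.I)‖ ^ 4 *
        ‖LSeries (fun n => (a n : ℂ)) (σ + (2 * t : ℝ) * Complex.I)‖) := by
      gcongr
      exact him t
    _ = _ := by ring

theorem exists_le_norm_regularizedLSeries (h : HasLogDeriv a Λ D)
    (ha : HasPowerSaving a ρ δ C) {ε : ℝ} (hε : 0 < ε) (hε1 : ε ≤ 1) :
    ∃ c > 0, ∀ s : ℂ, 1 < s.re → s.re ≤ 2 →
      c * (1 + |s.im|) ^ (1 - 4 * ε) ≤ ‖regularizedLSeries a ρ s‖ := by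
  obtain ⟨η, K, hη, hK, hb⟩ := ha.exists_norm_iteratedDeriv_le hε
  have hb0 : ∀ s : ℂ, 1 < s.re → s.re ≤ 2 →
      ‖regularizedLSeries a ρ s‖ ≤ K * (1 + |s.im|) ^ (1 + ε) := fun s h1 h2 => by
    simpa using hb 0 (by norm_num) s (by linarith) h2
  have hre : ∀ (σ u : ℝ), ((σ : ℂ) + u * Complex.I).re = σ := fun σ u => by simp
  have him : ∀ (σ u : ℝ), ((σ : ℂ) + u * Complex.I).im = u := fun σ u => by simp
  have hWσ : ∀ σ : ℝ, 1 < σ → σ ≤ 2 → ‖regularizedLSeries a ρ σ‖ ≤ K := fun σ h1 h2 => by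
    simpa using hb0 σ (by simpa using h1) (by simpa using h2)
  -- behaviour near `s = 1`
  obtain ⟨t₀, ht₀, ht₁, hnear⟩ : ∃ t₀ : ℝ, 0 < t₀ ∧ t₀ ≤ 1 ∧ ∀ s : ℂ, 1 < s.re → s.re ≤ 2 →
      |s.im| ≤ t₀ → min (ρ / 2) (t₀ ^ 2 / K) ≤ ‖regularizedLSeries a ρ s‖ := by
    have hc : ContinuousAt (regularizedLSeries a ρ) 1 :=
      (differentiableAt_regularizedLSeries ha.bound
        (by simpa using ha.exponent_pos)).continuousAt
    obtain ⟨r, hr, hr2⟩ := Metric.continuousAt_iff.mp hc (ρ / 2) (by linarith [ha.residue_pos])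
    refine ⟨min 1 (r / 3), by positivity, min_le_left _ _, fun s hs1 hs2 hs3 => ?_⟩
    set t₀ := min 1 (r / 3)
    have ht0 : 0 < t₀ := by positivity
    by_cases hσ : s.re - 1 < t₀
    · refine (min_le_left _ _).trans ?_
      have h1 : dist s 1 < r := by
        rw [dist_eq_norm]
        refine (Complex.norm_le_abs_re_add_abs_im _).trans_lt ?_
        simp only [Complex.sub_re, Complex.one_re, Complex.sub_im, Complex.one_im, sub_zero]
        rw [abs_of_pos (by linarith)]
        linarith [min_le_right 1 (r / 3)]
      have h2 := hr2 h1
      rw [regularizedLSeries_one, dist_comm, dist_eq_norm] at h2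
      have h3 := norm_sub_norm_le (ρ : ℂ) (regularizedLSeries a ρ s)
      rw [Complex.norm_real, Real.norm_of_nonneg ha.residue_pos.le] at h3
      linarith
    · refine (min_le_right _ _).trans ?_
      have hs0 : 1 < (s.re : ℂ).re := by simpa using hs1
      have h1 : ‖LSeries (fun n => (a n : ℂ)) s.re‖ * (s.re - 1) ≤ K := by
        have := hWσ s.re hs1 hs2
        rw [← ha.sub_one_mul_lseries hs0, norm_mul, mul_comm] at this
        rwa [← Complex.ofReal_one, ← Complex.ofReal_sub, Complex.norm_real,
          Real.norm_of_nonneg (by linarith)] at this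
      have h2 : 1 ≤ ‖LSeries (fun n => (a n : ℂ)) s.re‖ * ‖LSeries (fun n => (a n : ℂ)) s‖ := by
        rw [h.lseries_eq_exp ha hs0, h.lseries_eq_exp ha hs1, Complex.norm_exp, Complex.norm_exp,
          ← Real.exp_add, Real.one_le_exp_iff]
        have hsum : ∀ s : ℂ, 1 < s.re →
            Summable (term (fun n => ((Λ n / Real.log n : ℝ) : ℂ)) s) := fun s hs =>
          LSeriesSummable_of_abscissaOfAbsConv_lt_re
            (h.abscissaOfAbsConv_div_log_le.trans_lt (one_lt_ereal_of_re hs))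
        rw [LSeries, LSeries, Complex.re_tsum (hsum _ hs0), Complex.re_tsum (hsum _ hs1),
          ← ((Complex.hasSum_re (hsum _ hs0).hasSum).summable).tsum_add
            (Complex.hasSum_re (hsum _ hs1).hasSum).summable]
        refine tsum_nonneg fun n => ?_
        rcases eq_or_ne n 0 with rfl | hn
        · simp
        have e0 := term_ofReal_add_mul_I (f := fun n => Λ n / Real.log n) (σ := s.re) (t := 0) hn
        have hcc : 0 ≤ Λ n / Real.log n * (n : ℝ) ^ (-s.re) :=
          mul_nonneg (div_nonneg (h.nonneg n) (Real.log_natCast_nonneg n))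
            (Real.rpow_nonneg (Nat.cast_nonneg n) _)
        have e1 : ‖term (fun n => ((Λ n / Real.log n : ℝ) : ℂ)) s n‖ =
            Λ n / Real.log n * (n : ℝ) ^ (-s.re) := by
          rw [norm_term_eq, if_neg hn, Complex.norm_real, Real.norm_of_nonneg
            (div_nonneg (h.nonneg n) (Real.log_natCast_nonneg n)), div_eq_mul_inv,
            ← Real.rpow_neg (Nat.cast_nonneg n)]
        have e2 := (abs_le.mp (Complex.abs_re_le_norm
          (term (fun n => ((Λ n / Real.log n : ℝ) : ℂ)) s n))).1
        simp only [Complex.ofReal_zero, zero_mul, add_zero, neg_zero, Complex.cpow_zero,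
          mul_one] at e0
        rw [e0, Complex.ofReal_re]
        linarith
      rw [← ha.sub_one_mul_lseries hs1, norm_mul]
      have h3 : s.re - 1 ≤ ‖s - 1‖ := by
        have := Complex.re_le_norm (s - 1)
        simpa using this
      rw [div_le_iff₀ hK]
      have hσ' : t₀ ≤ s.re - 1 := not_lt.mp hσ
      calc t₀ ^ 2 ≤ t₀ * t₀ * (‖LSeries (fun n => (a n : ℂ)) s.re‖ *
            ‖LSeries (fun n => (a n : ℂ)) s‖) := by nlinarith [mul_pos ht0 ht0]
        _ ≤ (s.re - 1) * ‖s - 1‖ * (‖LSeries (fun n => (a n : ℂ)) s.re‖ *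
            ‖LSeries (fun n => (a n : ℂ)) s‖) := by
          gcongr
          linarith
        _ = ‖s - 1‖ * ‖LSeries (fun n => (a n : ℂ)) s‖ *
            (‖LSeries (fun n => (a n : ℂ)) s.re‖ * (s.re - 1)) := by ring
        _ ≤ _ := by gcongr
  -- the 3-4-1 bound
  obtain ⟨c₁, hc₁, h341⟩ : ∃ c₁ > 0, ∀ σ t : ℝ, 1 < σ → σ ≤ 2 → t₀ ≤ |t| →
      c₁ ^ 4 * (σ - 1) ^ 3 * (1 + |t|) ^ (4 - ε) ≤
        ‖regularizedLSeries a ρ (σ + t * Complex.I)‖ ^ 4 := by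
    set b : ℝ := 2 * (t₀ / 2) ^ 5 / (K ^ 4 * 4) with hbdef
    have hb0' : 0 < b := by positivity
    refine ⟨min b 1, by positivity, fun σ t h1 h2 ht => ?_⟩
    set τ := 1 + |t| with hτ
    have hτ1 : 1 ≤ τ := by rw [hτ]; linarith [abs_nonneg t]
    have hτt : t₀ / 2 * τ ≤ |t| := by
      rw [hτ]
      nlinarith [abs_nonneg t]
    have hmin : min b 1 ^ 4 ≤ b := by
      calc min b 1 ^ 4 ≤ min b 1 ^ 1 :=
            pow_le_pow_of_le_one (by positivity) (min_le_right _ _) (by norm_num)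
        _ ≤ b := by simp
    have hW2 : ‖regularizedLSeries a ρ (σ + (2 * t : ℝ) * Complex.I)‖ ≤ K * 4 * τ ^ (1 + ε) := by
      refine (hb0 _ (by rwa [hre]) (by rwa [hre])).trans ?_
      rw [him, mul_assoc]
      gcongr
      calc (1 + |2 * t|) ^ (1 + ε) ≤ (2 * τ) ^ (1 + ε) := by
            gcongr
            rw [abs_mul, abs_two]
            linarith
        _ = 2 ^ (1 + ε) * τ ^ (1 + ε) := Real.mul_rpow (by norm_num) (by positivity)
        _ ≤ 4 * τ ^ (1 + ε) := by
          gcongr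
          calc (2 : ℝ) ^ (1 + ε) ≤ 2 ^ (2 : ℝ) :=
                Real.rpow_le_rpow_of_exponent_le (by norm_num) (by linarith)
            _ = 4 := by norm_num
    have hmain := h.sub_one_pow_le_norm_regularizedLSeries_mul ha h1 t
    have hσ0 : 0 < σ - 1 := by linarith
    set X := ‖regularizedLSeries a ρ (σ + t * Complex.I)‖ ^ 4 with hX
    have hX0 : 0 ≤ X := by positivity
    have hK4 : (σ - 1) ^ 3 * (2 * (t₀ / 2 * τ) ^ 5) ≤ K ^ 3 * X * (K * 4 * τ ^ (1 + ε)) := by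
      calc _ ≤ (σ - 1) ^ 3 * (2 * |t| ^ 5) := by gcongr
        _ ≤ _ := hmain
        _ ≤ _ := by
          gcongr
          exact hWσ σ h1 h2
    have hτ5 : τ ^ 5 = τ ^ (1 + ε) * τ ^ (4 - ε) := by
      rw [← Real.rpow_add (by positivity), ← Real.rpow_natCast]
      norm_num
    have hpos : 0 < K ^ 4 * 4 * τ ^ (1 + ε) := by positivity
    calc min b 1 ^ 4 * (σ - 1) ^ 3 * τ ^ (4 - ε) ≤ b * (σ - 1) ^ 3 * τ ^ (4 - ε) := by gcongr
      _ = (σ - 1) ^ 3 * (2 * (t₀ / 2 * τ) ^ 5) / (K ^ 4 * 4 * τ ^ (1 + ε)) := by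
        rw [mul_pow (t₀ / 2), hτ5, hbdef]
        field_simp
      _ ≤ X := by
        rw [div_le_iff₀ hpos]
        linarith
  -- transfer to the line `re s = 1`
  obtain ⟨u, hu, hu1, huc⟩ : ∃ u : ℝ, 0 < u ∧ u ≤ 1 ∧ 2 * K * u ≤ c₁ :=
    ⟨min 1 (c₁ / (2 * K)), by positivity, min_le_left _ _, by
      have := min_le_right 1 (c₁ / (2 * K))
      rwa [le_div_iff₀ (by positivity), mul_comm] at this⟩
  have hfar : ∀ s : ℂ, 1 < s.re → s.re ≤ 2 → t₀ ≤ |s.im| →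
      c₁ * u ^ 3 / 2 * (1 + |s.im|) ^ (1 - 4 * ε) ≤ ‖regularizedLSeries a ρ s‖ := by
    intro s hs1 hs2 ht
    set τ := 1 + |s.im| with hτ
    have hτ1 : 1 ≤ τ := by rw [hτ]; linarith [abs_nonneg s.im]
    have hτ0 : 0 < τ := by linarith
    set κ : ℝ := u ^ 4 * τ ^ (-(5 * ε)) with hκ
    have hκ0 : 0 < κ := by positivity
    have hκ1 : κ ≤ 1 := by
      rw [hκ]
      exact mul_le_one₀ (pow_le_one₀ hu.le hu1) (by positivity)
        (Real.rpow_le_one_of_one_le_of_nonpos hτ1 (by linarith))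
    have hlow : ∀ σ : ℝ, 1 + κ ≤ σ → σ ≤ 2 →
        c₁ * u ^ 3 * τ ^ (1 - 4 * ε) ≤ ‖regularizedLSeries a ρ (σ + s.im * Complex.I)‖ := by
      intro σ h1 h2
      refine le_of_pow_le_pow_left₀ (n := 4) (by norm_num) (norm_nonneg _)
        (le_trans ?_ (h341 σ s.im (by linarith) h2 ht))
      have e1 : κ ^ 3 ≤ (σ - 1) ^ 3 := by
        gcongr
        linarith
      have e2 : κ ^ 3 * τ ^ (4 - ε) = (u ^ 3 * τ ^ (1 - 4 * ε)) ^ 4 := by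
        rw [hκ, mul_pow, mul_pow, ← Real.rpow_mul_natCast hτ0.le, ← Real.rpow_mul_natCast hτ0.le,
          mul_assoc, ← Real.rpow_add hτ0]
        congr 1
        · ring
        · congr 1
          push_cast
          ring
      calc (c₁ * u ^ 3 * τ ^ (1 - 4 * ε)) ^ 4 = c₁ ^ 4 * (κ ^ 3 * τ ^ (4 - ε)) := by
            rw [e2]
            ring
        _ ≤ c₁ ^ 4 * ((σ - 1) ^ 3 * τ ^ (4 - ε)) := by gcongr
        _ = _ := by ring
    by_cases hσ : 1 + κ ≤ s.re
    · refine le_trans ?_ (le_of_le_of_eq (hlow s.re hσ hs2) ?_)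
      · gcongr
        exact half_le_self (by positivity)
      · rw [Complex.re_add_im]
    · push Not at hσ
      have h1 := hlow (1 + κ) le_rfl (by linarith)
      set s' : ℂ := ((1 + κ : ℝ) : ℂ) + s.im * Complex.I with hs'
      have hs'im : s'.im = s.im := by rw [hs']; simp
      have hs're : s'.re = 1 + κ := by rw [hs']; simp
      have hdist : ‖regularizedLSeries a ρ s' - regularizedLSeries a ρ s‖ ≤
          K * τ ^ (1 + ε) * ‖s' - s‖ := by
        have hconv : Convex ℝ ({z : ℂ | 1 ≤ z.re} ∩ {z : ℂ | z.re ≤ 2} ∩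
            {z : ℂ | s.im ≤ z.im} ∩ {z : ℂ | z.im ≤ s.im}) :=
          (((convex_halfSpace_re_ge 1).inter (convex_halfSpace_re_le 2)).inter
            (convex_halfSpace_im_ge _)).inter (convex_halfSpace_im_le _)
        refine hconv.norm_image_sub_le_of_norm_deriv_le
          (f := regularizedLSeries a ρ) (fun z hz => ?_) (fun z hz => ?_) ?_ ?_
        · refine differentiableAt_regularizedLSeries ha.bound ?_
          have := hz.1.1.1
          simp only [mem_ofPred_eq] at this
          linarith [ha.exponent_pos]
        · have e1 : 1 ≤ z.re := hz.1.1.1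
          have e2 : z.re ≤ 2 := hz.1.1.2
          have e3 : s.im ≤ z.im := hz.1.2
          have e4 : z.im ≤ s.im := hz.2
          have e5 : z.im = s.im := le_antisymm e4 e3
          have := hb 1 (by norm_num) z (by linarith) e2
          rwa [iteratedDeriv_one, e5] at this
        · simp only [mem_inter_iff, mem_ofPred_eq]
          exact ⟨⟨⟨hs1.le, hs2⟩, le_rfl⟩, le_rfl⟩
        · simp only [mem_inter_iff, mem_ofPred_eq, hs're, hs'im]
          exact ⟨⟨⟨by linarith, by linarith⟩, le_rfl⟩, le_rfl⟩
      have hss : ‖s' - s‖ ≤ κ := by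
        refine (Complex.norm_le_abs_re_add_abs_im _).trans ?_
        rw [Complex.sub_re, Complex.sub_im, hs'im, hs're, sub_self, abs_zero, add_zero,
          abs_of_pos (by linarith)]
        linarith
      have h2 : K * τ ^ (1 + ε) * ‖s' - s‖ ≤ c₁ * u ^ 3 / 2 * τ ^ (1 - 4 * ε) := by
        calc K * τ ^ (1 + ε) * ‖s' - s‖ ≤ K * τ ^ (1 + ε) * κ := by gcongr
          _ = K * u * u ^ 3 * τ ^ (1 - 4 * ε) := by
            have e : τ ^ (1 - 4 * ε) = τ ^ (1 + ε) * τ ^ (-(5 * ε)) := by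
              rw [← Real.rpow_add hτ0]
              congr 1
              ring
            rw [hκ, e]
            ring
          _ ≤ c₁ / 2 * u ^ 3 * τ ^ (1 - 4 * ε) := by
            gcongr
            linarith
          _ = _ := by ring
      have h3 := norm_sub_norm_le (regularizedLSeries a ρ s') (regularizedLSeries a ρ s)
      linarith
  have hm : 0 < min (ρ / 2) (t₀ ^ 2 / K) := by
    have := ha.residue_pos
    positivity
  refine ⟨min (c₁ * u ^ 3 / 2) (min (ρ / 2) (t₀ ^ 2 / K) / 2), by positivity,
    fun s hs1 hs2 => ?_⟩
  rcases le_total t₀ |s.im| with ht | ht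
  · refine le_trans ?_ (hfar s hs1 hs2 ht)
    gcongr
    exact min_le_left _ _
  · refine le_trans ?_ (hnear s hs1 hs2 ht)
    have hτ1 : 1 ≤ 1 + |s.im| := by linarith [abs_nonneg s.im]
    have h2 : (1 + |s.im|) ^ (1 - 4 * ε) ≤ 2 := by
      calc (1 + |s.im|) ^ (1 - 4 * ε) ≤ (1 + |s.im|) ^ (1 : ℝ) :=
            Real.rpow_le_rpow_of_exponent_le hτ1 (by linarith)
        _ ≤ 2 := by rw [Real.rpow_one]; linarith
    calc _ ≤ min (ρ / 2) (t₀ ^ 2 / K) / 2 * 2 := by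
          gcongr
          exact min_le_right _ _
      _ = _ := by ring

end HasLogDeriv
end LowerBound

section SecondLogDerivative
open MeasureTheory Set Asymptotics Topology LSeries

variable {a Λ : ℕ → ℝ} {ρ δ C D : ℝ}

namespace HasLogDeriv

theorem regularizedLSeries_ne_zero (h : HasLogDeriv a Λ D) (ha : HasPowerSaving a ρ δ C)
    {s : ℂ} (hs : 1 < s.re) : regularizedLSeries a ρ s ≠ 0 := by
  rw [← ha.sub_one_mul_lseries hs, h.lseries_eq_exp ha hs]
  refine mul_ne_zero (fun h0 => ?_) (Complex.exp_ne_zero _)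
  rw [sub_eq_zero.mp h0] at hs
  simp at hs

theorem analyticAt_regularizedLSeries (ha : HasPowerSaving a ρ δ C) {s : ℂ} (hs : 1 < s.re) :
    AnalyticAt ℂ (regularizedLSeries a ρ) s := by
  refine DifferentiableOn.analyticAt (s := {s : ℂ | 1 < s.re}) (fun z hz => ?_)
    (isOpen_one_lt_re.mem_nhds hs)
  have hz' : 1 < z.re := hz
  exact (differentiableAt_regularizedLSeries ha.bound
    (by linarith [ha.exponent_pos])).differentiableWithinAt

theorem lseries_eq_sub_logDeriv (h : HasLogDeriv a Λ D) (ha : HasPowerSaving a ρ δ C)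
    {s : ℂ} (hs : 1 < s.re) : LSeries (fun n => (Λ n : ℂ)) s =
      (s - 1)⁻¹ - deriv (regularizedLSeries a ρ) s / regularizedLSeries a ρ s := by
  have hev : regularizedLSeries a ρ =ᶠ[𝓝 s] fun s => (s - 1) * LSeries (fun n => (a n : ℂ)) s := by
    filter_upwards [isOpen_one_lt_re.mem_nhds hs] with z hz
    exact (ha.sub_one_mul_lseries hz).symm
  have hd := (((hasDerivAt_id s).sub_const 1).mul (h.hasDerivAt_lseries ha hs)).congr_of_eventuallyEq
    hev
  have h0 := h.regularizedLSeries_ne_zero ha hs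
  rw [hd.deriv]
  rw [← ha.sub_one_mul_lseries hs] at h0 ⊢
  have h1 := left_ne_zero_of_mul h0
  have h2 := right_ne_zero_of_mul h0
  simp only [id]
  field_simp
  ring

theorem lseries_mul_log_sq_sub (h : HasLogDeriv a Λ D) (ha : HasPowerSaving a ρ δ C)
    {s : ℂ} (hs : 1 < s.re) :
    LSeries (fun n => ((Λ n * Real.log n ^ 2 : ℝ) : ℂ)) s - 2 / (s - 1) ^ 3 =
      -(iteratedDeriv 3 (regularizedLSeries a ρ) s / regularizedLSeries a ρ s)
      + 3 * (iteratedDeriv 2 (regularizedLSeries a ρ) s / regularizedLSeries a ρ s *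
          (iteratedDeriv 1 (regularizedLSeries a ρ) s / regularizedLSeries a ρ s))
      - 2 * (iteratedDeriv 1 (regularizedLSeries a ρ) s / regularizedLSeries a ρ s) ^ 3 := by
  set W := regularizedLSeries a ρ with hW
  have hWd : ∀ z : ℂ, 1 < z.re → ∀ j, HasDerivAt (iteratedDeriv j W) (iteratedDeriv (j + 1) W z) z := by
    intro z hz j
    rw [iteratedDeriv_succ]
    have h1 : AnalyticAt ℂ (iteratedDeriv j W) z := by
      have := (analyticAt_regularizedLSeries ha hz).iterated_deriv j
      rwa [← iteratedDeriv_eq_iterate] at this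
    exact h1.differentiableAt.hasDerivAt
  have hne : ∀ z : ℂ, 1 < z.re → W z ≠ 0 := fun z hz => h.regularizedLSeries_ne_zero ha hz
  have hsub : ∀ z : ℂ, 1 < z.re → z - 1 ≠ 0 := by
    intro z hz h0
    rw [sub_eq_zero.mp h0] at hz
    simp at hz
  have hmem := isOpen_one_lt_re.mem_nhds hs
  have hcoef : (logMul^[2] fun n => (Λ n : ℂ)) = fun n => ((Λ n * Real.log n ^ 2 : ℝ) : ℂ) := by
    ext n
    simp only [Function.iterate_succ, Function.iterate_zero, Function.comp_apply, id, logMul,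
      ← Complex.natCast_log]
    push_cast
    ring
  have hL := LSeries_iteratedDeriv 2 (h.abscissaOfAbsConv_le.trans_lt (one_lt_ereal_of_re hs))
  rw [hcoef, neg_one_sq, one_mul] at hL
  have e1 : deriv (LSeries fun n => (Λ n : ℂ)) =ᶠ[𝓝 s] fun z => -((z - 1)⁻¹ ^ 2)
      - (iteratedDeriv 2 W z / W z - (iteratedDeriv 1 W z / W z) ^ 2) := by
    filter_upwards [hmem] with z hz
    have hz' : 1 < z.re := hz
    have hev : (LSeries fun n => (Λ n : ℂ)) =ᶠ[𝓝 z]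
        fun z => (z - 1)⁻¹ - iteratedDeriv 1 W z / iteratedDeriv 0 W z := by
      filter_upwards [isOpen_one_lt_re.mem_nhds hz'] with y hy
      rw [h.lseries_eq_sub_logDeriv ha hy]
      simp [hW, iteratedDeriv_one]
    have hd := ((((hasDerivAt_id z).sub_const 1).inv (hsub z hz')).sub
      ((hWd z hz' 1).div (hWd z hz' 0) (by simpa using hne z hz'))).congr_of_eventuallyEq hev
    rw [hd.deriv]
    have h1 := hsub z hz'
    have h2 := hne z hz'
    simp only [iteratedDeriv_zero, id]
    norm_num
    field_simp
  have e2 : iteratedDeriv 2 (LSeries fun n => (Λ n : ℂ)) s =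
      2 / (s - 1) ^ 3 + (-(iteratedDeriv 3 W s / W s)
      + 3 * (iteratedDeriv 2 W s / W s * (iteratedDeriv 1 W s / W s))
      - 2 * (iteratedDeriv 1 W s / W s) ^ 3) := by
    rw [iteratedDeriv_succ, iteratedDeriv_one, e1.deriv_eq]
    have hd := (((((hasDerivAt_id s).sub_const 1).inv (hsub s hs)).pow 2).neg).sub
      (((hWd s hs 2).div (hWd s hs 0) (by simpa using hne s hs)).sub
        (((hWd s hs 1).div (hWd s hs 0) (by simpa using hne s hs)).pow 2))
    have hd2 := hd.deriv
    have h1 := hsub s hs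
    have h2 := hne s hs
    simp only [iteratedDeriv_zero, id] at hd2
    refine Eq.trans (Eq.trans ?_ hd2) ?_
    · rfl
    simp
    field_simp
    ring
  rw [← hL, e2]
  ring

theorem exists_norm_lseries_mul_log_sq_sub_le (h : HasLogDeriv a Λ D)
    (ha : HasPowerSaving a ρ δ C) : ∃ K > 0, ∀ s : ℂ, 1 < s.re → s.re ≤ 2 →
      ‖LSeries (fun n => ((Λ n * Real.log n ^ 2 : ℝ) : ℂ)) s - 2 / (s - 1) ^ 3‖ ≤
        K * (1 + |s.im|) ^ (1 / 2 : ℝ) := by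
  obtain ⟨η, K, hη, hK, hb⟩ := ha.exists_norm_iteratedDeriv_le (ε := 1 / 30) (by norm_num)
  obtain ⟨c, hc, hl⟩ := h.exists_le_norm_regularizedLSeries ha (ε := 1 / 30) (by norm_num)
    (by norm_num)
  refine ⟨K / c + 3 * (K / c * (K / c)) + 2 * (K / c) ^ 3, by positivity, fun s hs1 hs2 => ?_⟩
  rw [h.lseries_mul_log_sq_sub ha hs1]
  set τ := 1 + |s.im| with hτ
  have hτ1 : 1 ≤ τ := by rw [hτ]; linarith [abs_nonneg s.im]
  have hτ0 : 0 < τ := by linarith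
  set W := regularizedLSeries a ρ
  have hq : ∀ j ≤ 3, ‖iteratedDeriv j W s / W s‖ ≤ K / c * τ ^ (1 / 6 : ℝ) := by
    intro j hj
    have h1 := hl s hs1 hs2
    have h2 : 0 < c * τ ^ (1 - 4 * (1 / 30) : ℝ) := by positivity
    rw [norm_div, div_le_iff₀ (h2.trans_le h1)]
    refine (hb j hj s (by linarith) hs2).trans ?_
    calc K * τ ^ (1 + 1 / 30 : ℝ) = K / c * τ ^ (1 / 6 : ℝ) * (c * τ ^ (1 - 4 * (1 / 30) : ℝ)) := by
          rw [show (1 + 1 / 30 : ℝ) = 1 / 6 + (1 - 4 * (1 / 30)) by norm_num, Real.rpow_add hτ0]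
          field_simp
      _ ≤ _ := by gcongr
  have hp : (τ ^ (1 / 6 : ℝ)) ^ 3 = τ ^ (1 / 2 : ℝ) := by
    rw [← Real.rpow_mul_natCast hτ0.le]
    norm_num
  have h16 : 1 ≤ τ ^ (1 / 6 : ℝ) := Real.one_le_rpow hτ1 (by norm_num)
  set x := τ ^ (1 / 6 : ℝ)
  have hKc : 0 < K / c := by positivity
  have hq1 := hq 1 (by norm_num)
  have hq2 := hq 2 (by norm_num)
  have hq3 := hq 3 (by norm_num)
  rw [← hp]
  have key : ∀ u v w : ℂ, ‖u‖ ≤ K / c * x → ‖v‖ ≤ K / c * x → ‖w‖ ≤ K / c * x →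
      ‖-u + 3 * (v * w) - 2 * w ^ 3‖ ≤
        (K / c + 3 * (K / c * (K / c)) + 2 * (K / c) ^ 3) * x ^ 3 := by
    intro u v w hu hv hw
    calc ‖-u + 3 * (v * w) - 2 * w ^ 3‖ ≤ ‖u‖ + 3 * (‖v‖ * ‖w‖) + 2 * ‖w‖ ^ 3 := by
          refine (norm_sub_le _ _).trans (add_le_add ((norm_add_le _ _).trans ?_) ?_)
          · simp
          · simp
      _ ≤ K / c * x + 3 * (K / c * x * (K / c * x)) + 2 * (K / c * x) ^ 3 := by gcongr
      _ = K / c * (x * 1) + 3 * (K / c * (K / c)) * (x ^ 2 * 1) + 2 * (K / c) ^ 3 * x ^ 3 := by ring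
      _ ≤ K / c * (x * x ^ 2) + 3 * (K / c * (K / c)) * (x ^ 2 * x) + 2 * (K / c) ^ 3 * x ^ 3 := by
        gcongr
        exact one_le_pow₀ h16
      _ = _ := by ring
  exact key _ _ _ hq3 hq2 hq1

end HasLogDeriv
end SecondLogDerivative

section Tauberian
open MeasureTheory Set Topology

/-- The weight in the smoothed Perron formula. -/
theorem integrable_one_add_abs_rpow_mul_inv :
    Integrable fun t : ℝ => (1 + |t|) ^ (1 / 2 : ℝ) * (1 + t ^ 2)⁻¹ := by
  have h := integrable_rpow_neg_one_add_norm_sq (E := ℝ) (μ := volume) (r := 3 / 2) (by simp; norm_num)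
  refine (h.const_mul 2).mono' (Continuous.aestronglyMeasurable ?_) (ae_of_all _ fun t => ?_)
  · refine Continuous.mul ?_ ?_
    · exact Continuous.rpow_const (by fun_prop) fun t => Or.inr (by norm_num)
    · exact Continuous.inv₀ (by fun_prop) fun t => by positivity
  · have h0 : 0 < 1 + t ^ 2 := by positivity
    rw [Real.norm_of_nonneg (by positivity), Real.norm_eq_abs, sq_abs]
    have h1 : (1 + |t|) ^ (1 / 2 : ℝ) ≤ 2 * (1 + t ^ 2) ^ (1 / 4 : ℝ) := by
      have h2 : 1 + |t| ≤ 4 * (1 + t ^ 2) ^ (1 / 2 : ℝ) := by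
        rw [← Real.sqrt_eq_rpow]
        have h3 : 1 ≤ √(1 + t ^ 2) := Real.one_le_sqrt.mpr (by nlinarith)
        have h4 : |t| ≤ √(1 + t ^ 2) := Real.abs_le_sqrt (by linarith)
        linarith
      calc (1 + |t|) ^ (1 / 2 : ℝ) ≤ (4 * (1 + t ^ 2) ^ (1 / 2 : ℝ)) ^ (1 / 2 : ℝ) := by gcongr
        _ = 2 * (1 + t ^ 2) ^ (1 / 4 : ℝ) := by
          rw [Real.mul_rpow (by norm_num) (by positivity), ← Real.rpow_mul h0.le,
            show (4 : ℝ) = 2 ^ (2 : ℝ) by norm_num, ← Real.rpow_mul (by norm_num)]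
          norm_num
    calc _ ≤ 2 * (1 + t ^ 2) ^ (1 / 4 : ℝ) * (1 + t ^ 2)⁻¹ := by gcongr
      _ = 2 * (1 + t ^ 2) ^ (-(3 / 2) / 2 : ℝ) := by
        rw [mul_assoc, ← Real.rpow_neg_one, ← Real.rpow_add h0]
        norm_num

variable {μ ν : Measure ℝ}

theorem integrable_max_one_sub_div (hμ : ∀ᵐ u ∂μ, 0 < u)
    (hi : Integrable (fun u : ℝ => u ^ (-2 : ℝ)) μ) {x : ℝ} (hx : 0 < x) :
    Integrable (fun u => max (1 - u / x) 0) μ := by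
  refine (hi.const_mul (x ^ 2)).mono' (by fun_prop) ?_
  filter_upwards [hμ] with u hu
  rw [Real.norm_of_nonneg (le_max_right _ _), Real.rpow_neg hu.le, Real.rpow_two]
  have h1 : 0 < x ^ 2 * (u ^ 2)⁻¹ := by positivity
  refine max_le ?_ h1.le
  rcases le_total u x with h | h
  · have : 1 ≤ x ^ 2 * (u ^ 2)⁻¹ := by
      rw [← div_eq_mul_inv, one_le_div (by positivity)]
      gcongr
    have : 0 ≤ u / x := by positivity
    linarith
  · have : 1 ≤ u / x := by rwa [one_le_div hx]
    linarith

theorem integrable_indicator_Iic (hμ : ∀ᵐ u ∂μ, 0 < u)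
    (hi : Integrable (fun u : ℝ => u ^ (-2 : ℝ)) μ) (x : ℝ) :
    Integrable ((Iic x).indicator fun _ => (1 : ℝ)) μ := by
  refine (hi.const_mul (x ^ 2)).mono' (aestronglyMeasurable_const.indicator measurableSet_Iic) ?_
  filter_upwards [hμ] with u hu
  have h1 : 0 ≤ x ^ 2 * u ^ (-2 : ℝ) := by positivity
  by_cases h : u ≤ x
  · simp only [indicator, mem_Iic, h, if_true, norm_one]
    rw [Real.rpow_neg hu.le, Real.rpow_two, ← div_eq_mul_inv, one_le_div (by positivity)]
    gcongr
  · simpa [indicator, h] using h1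

theorem mul_measureReal_Iic_le (hμ : ∀ᵐ u ∂μ, 0 < u)
    (hi : Integrable (fun u : ℝ => u ^ (-2 : ℝ)) μ) {x k : ℝ} (hx : 0 < x) (hk : 0 < k) :
    k * μ.real (Iic x) ≤
      (x + k) * (∫ u, max (1 - u / (x + k)) 0 ∂μ) - x * ∫ u, max (1 - u / x) 0 ∂μ ∧
    (x + k) * (∫ u, max (1 - u / (x + k)) 0 ∂μ) - x * ∫ u, max (1 - u / x) 0 ∂μ ≤
      k * μ.real (Iic (x + k)) := by
  have hxk : 0 < x + k := by linarith
  have e : ∀ y : ℝ, μ.real (Iic y) = ∫ u, (Iic y).indicator (fun _ => (1 : ℝ)) u ∂μ := fun y => by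
    rw [integral_indicator_const _ measurableSet_Iic, smul_eq_mul, mul_one]
  have i1 := (integrable_max_one_sub_div hμ hi hxk).const_mul (x + k)
  have i2 := (integrable_max_one_sub_div hμ hi hx).const_mul x
  have hmul : ∀ y : ℝ, 0 < y → ∀ u : ℝ, y * max (1 - u / y) 0 = max (y - u) 0 := by
    intro y hy u
    rw [mul_max_of_nonneg _ _ hy.le, mul_zero, mul_sub, mul_one, mul_div_cancel₀ _ hy.ne']
  rw [e, e, ← integral_const_mul, ← integral_const_mul, ← integral_const_mul, ← integral_const_mul,
    ← integral_sub i1 i2]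
  constructor
  · refine integral_mono ((integrable_indicator_Iic hμ hi _).const_mul k) (i1.sub i2) fun u => ?_
    simp only [hmul _ hx, hmul _ hxk, indicator, mem_Iic]
    split_ifs with h
    · rw [max_eq_left (by linarith), max_eq_left (by linarith)]
      linarith
    · rw [max_eq_right (by linarith : x - u ≤ 0), mul_zero, sub_zero]
      exact le_max_right _ _
  · refine integral_mono (i1.sub i2) ((integrable_indicator_Iic hμ hi _).const_mul k) fun u => ?_
    simp only [hmul _ hx, hmul _ hxk, indicator, mem_Iic]
    split_ifs with h
    · rw [max_eq_left (by linarith)]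
      linarith [le_max_left (x - u) 0]
    · rw [max_eq_right (by linarith), max_eq_right (by linarith)]
      simp

theorem norm_integral_max_sub_le [SFinite μ] [SFinite ν] (hμ : ∀ᵐ u ∂μ, 0 < u)
    (hν : ∀ᵐ u ∂ν, 0 < u) {σ : ℝ} (hσ : 1 ≤ σ)
    (hμi : Integrable (fun u : ℝ => u ^ (-σ)) μ)
    (hνi : Integrable (fun u : ℝ => u ^ (-σ)) ν) {K : ℝ}
    (hK : ∀ t : ℝ, ‖(∫ u, (u : ℂ) ^ (-(σ + t * Complex.I)) ∂μ) -
      ∫ u, (u : ℂ) ^ (-(σ + t * Complex.I)) ∂ν‖ ≤ K * (1 + |t|) ^ (1 / 2 : ℝ)) {x : ℝ}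
    (hx : 0 < x) :
    |(∫ u, max (1 - u / x) 0 ∂μ) - ∫ u, max (1 - u / x) 0 ∂ν| ≤
      K * (∫ t : ℝ, (1 + |t|) ^ (1 / 2 : ℝ) * (1 + t ^ 2)⁻¹) * x ^ σ := by
  have hker : ∀ t : ℝ, ‖(x : ℂ) ^ (σ + t * Complex.I) *
      (1 / ((σ + t * Complex.I) * (σ + t * Complex.I + 1)))‖ ≤ x ^ σ * (1 + t ^ 2)⁻¹ := by
    intro t
    rw [norm_mul, Complex.norm_cpow_eq_rpow_re_of_pos hx]
    simp only [Complex.add_re, Complex.ofReal_re, Complex.mul_re, Complex.I_re, mul_zero,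
      Complex.ofReal_im, Complex.I_im, mul_one, sub_self, add_zero]
    gcongr
    exact norm_one_div_mul_add_one_le hσ t
  have hne : ∀ t : ℝ, ((σ + t * Complex.I) * (σ + t * Complex.I + 1) : ℂ) ≠ 0 := by
    intro t h
    rcases mul_eq_zero.1 h with h | h <;>
    · have := congrArg Complex.re h
      simp at this
      linarith
  have hkc : Continuous fun t : ℝ => (x : ℂ) ^ (σ + t * Complex.I) *
      (1 / ((σ + t * Complex.I) * (σ + t * Complex.I + 1))) := by
    refine Continuous.mul ?_ (Continuous.div (by fun_prop) (by fun_prop) hne)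
    refine Continuous.const_cpow (by fun_prop) (Or.inl ?_)
    exact_mod_cast hx.ne'
  have hintegr : ∀ (κ : Measure ℝ) [SFinite κ], (∀ᵐ u ∂κ, 0 < u) →
      Integrable (fun u : ℝ => u ^ (-σ)) κ →
      Integrable (fun t : ℝ => (x : ℂ) ^ (σ + t * Complex.I) *
        (1 / ((σ + t * Complex.I) * (σ + t * Complex.I + 1))) *
        ∫ u, (u : ℂ) ^ (-(σ + t * Complex.I)) ∂κ) := by
    intro κ _ hκ hκi
    refine ((integrable_inv_one_add_sq.const_mul (x ^ σ)).mul_const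
      (∫ u, u ^ (-σ) ∂κ)).mono' ?_ (ae_of_all _ fun t => ?_)
    · refine hkc.aestronglyMeasurable.mul ?_
      refine StronglyMeasurable.aestronglyMeasurable ?_
      refine StronglyMeasurable.integral_prod_right'
        (f := fun p : ℝ × ℝ => (p.2 : ℂ) ^ (-(σ + p.1 * Complex.I))) ?_
      exact Measurable.stronglyMeasurable (by fun_prop)
    · rw [norm_mul]
      refine mul_le_mul (hker t) ?_ (norm_nonneg _) (by positivity)
      refine norm_integral_le_of_norm_le hκi ?_
      filter_upwards [hκ] with u hu
      rw [Complex.norm_cpow_eq_rpow_re_of_pos hu]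
      simp
  have hI := integrable_one_add_abs_rpow_mul_inv
  have hI0 : 0 ≤ ∫ t : ℝ, (1 + |t|) ^ (1 / 2 : ℝ) * (1 + t ^ 2)⁻¹ :=
    integral_nonneg fun t => by positivity
  have hK0 : 0 ≤ K := by
    have := (norm_nonneg _).trans (hK 0)
    simpa using this
  rw [← Real.norm_eq_abs, ← Complex.norm_real, Complex.ofReal_sub, perron_measure μ hσ hμ hμi hx,
    perron_measure ν hσ hν hνi hx, ← mul_sub, ← integral_sub (hintegr μ hμ hμi) (hintegr ν hν hνi),
    norm_mul]
  have hpi : ‖(1 / (2 * Real.pi) : ℂ)‖ ≤ 1 := by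
    rw [norm_div, norm_mul, Complex.norm_real, Real.norm_of_nonneg Real.pi_pos.le]
    simp only [norm_one, Complex.norm_ofNat]
    rw [div_le_one (by positivity)]
    linarith [Real.pi_gt_three]
  calc _ ≤ 1 * ∫ t : ℝ, x ^ σ * K * ((1 + |t|) ^ (1 / 2 : ℝ) * (1 + t ^ 2)⁻¹) := by
        refine mul_le_mul hpi ?_ (norm_nonneg _) zero_le_one
        refine norm_integral_le_of_norm_le (hI.const_mul _) (ae_of_all _ fun t => ?_)
        rw [← mul_sub, norm_mul]
        refine (mul_le_mul (hker t) (hK t) (norm_nonneg _) (by positivity)).trans (le_of_eq ?_)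
        ring
    _ = _ := by
      rw [integral_const_mul]
      ring

/-- A Tauberian comparison of two measures whose Mellin transforms differ by
`O((1 + |t|) ^ (1 / 2))` up to the line `re s = 1`. -/
theorem exists_measureReal_Iic_le [SFinite μ] [SFinite ν] (hμ : ∀ᵐ u ∂μ, 0 < u)
    (hν : ∀ᵐ u ∂ν, 0 < u)
    (hμi : ∀ σ : ℝ, 1 < σ → Integrable (fun u : ℝ => u ^ (-σ)) μ)
    (hνi : ∀ σ : ℝ, 1 < σ → Integrable (fun u : ℝ => u ^ (-σ)) ν) {K : ℝ}
    (hK : ∀ σ t : ℝ, 1 < σ → σ ≤ 2 → ‖(∫ u, (u : ℂ) ^ (-(σ + t * Complex.I)) ∂μ) -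
      ∫ u, (u : ℂ) ^ (-(σ + t * Complex.I)) ∂ν‖ ≤ K * (1 + |t|) ^ (1 / 2 : ℝ)) :
    ∃ B, 0 ≤ B ∧ ∀ x k : ℝ, 0 < x → 0 < k →
      μ.real (Iic x) ≤ ν.real (Iic (x + k)) + B * (x + k) ^ 2 / k ∧
      ν.real (Iic x) ≤ μ.real (Iic (x + k)) + B * (x + k) ^ 2 / k := by
  set B₀ : ℝ := K * ∫ t : ℝ, (1 + |t|) ^ (1 / 2 : ℝ) * (1 + t ^ 2)⁻¹ with hB₀
  have hB₀' : 0 ≤ B₀ := by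
    refine mul_nonneg ?_ (integral_nonneg fun t => by positivity)
    have := (norm_nonneg _).trans (hK 2 0 (by norm_num) le_rfl)
    simpa using this
  have hmain : ∀ x : ℝ, 0 < x →
      |(∫ u, max (1 - u / x) 0 ∂μ) - ∫ u, max (1 - u / x) 0 ∂ν| ≤ B₀ * x := by
    intro x hx
    have hlim : Tendsto (fun σ : ℝ => B₀ * x ^ σ) (𝓝[>] 1) (𝓝 (B₀ * x ^ (1 : ℝ))) :=
      ((Real.continuousAt_const_rpow hx.ne').tendsto.const_mul B₀).mono_left nhdsWithin_le_nhds
    rw [Real.rpow_one] at hlim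
    refine ge_of_tendsto hlim ?_
    filter_upwards [Ioc_mem_nhdsGT (one_lt_two : (1 : ℝ) < 2)] with σ hσ
    exact norm_integral_max_sub_le hμ hν hσ.1.le (hμi σ hσ.1) (hνi σ hσ.1)
      (fun t => hK σ t hσ.1 hσ.2) hx
  have hμ2 := hμi 2 one_lt_two
  have hν2 := hνi 2 one_lt_two
  refine ⟨2 * B₀, by positivity, fun x k hx hk => ?_⟩
  have hxk : 0 < x + k := by linarith
  have m1 := mul_measureReal_Iic_le hμ hμ2 hx hk
  have m2 := mul_measureReal_Iic_le hν hν2 hx hk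
  have b1 := abs_le.mp (hmain x hx)
  have b2 := abs_le.mp (hmain (x + k) hxk)
  have c1 := mul_le_mul_of_nonneg_left b1.1 hx.le
  have c2 := mul_le_mul_of_nonneg_left b1.2 hx.le
  have c3 := mul_le_mul_of_nonneg_left b2.1 hxk.le
  have c4 := mul_le_mul_of_nonneg_left b2.2 hxk.le
  have hsq : B₀ * x ^ 2 ≤ B₀ * (x + k) ^ 2 := by gcongr; linarith
  constructor
  · rw [← sub_le_iff_le_add', le_div_iff₀ hk]
    nlinarith [m1.1, m2.2]
  · rw [← sub_le_iff_le_add', le_div_iff₀ hk]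
    nlinarith [m1.2, m2.1]

end Tauberian

section SumAsymptotics
open MeasureTheory Set Asymptotics Topology LSeries

/-- The measure on `ℝ` with an atom of mass `c n` at each natural number `n`. -/
noncomputable def weightedCount (c : ℕ → ℝ) : Measure ℝ :=
  (Measure.count.withDensity fun n : ℕ => ((c n).toNNReal : ENNReal)).map fun n : ℕ => (n : ℝ)

instance (c : ℕ → ℝ) : SFinite (weightedCount c) := by
  unfold weightedCount
  infer_instance

theorem integrable_weightedCount_iff {E : Type*} [NormedAddCommGroup E] [NormedSpace ℝ E]
    {c : ℕ → ℝ} (hc : ∀ n, 0 ≤ c n) {f : ℝ → E} (hf : StronglyMeasurable f) :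
    Integrable f (weightedCount c) ↔ Summable fun n : ℕ => ‖c n • f n‖ := by
  rw [weightedCount, integrable_map_measure hf.aestronglyMeasurable
    (measurable_of_countable _).aemeasurable,
    integrable_withDensity_iff_integrable_smul (measurable_of_countable _), ← integrable_norm_iff,
    integrable_count_iff]
  · simp only [Function.comp_def, NNReal.smul_def, Real.coe_toNNReal _ (hc _), norm_norm]
  · exact StronglyMeasurable.of_discrete.aestronglyMeasurable

theorem integral_weightedCount {E : Type*} [NormedAddCommGroup E] [NormedSpace ℝ E]
    [CompleteSpace E]
    {c : ℕ → ℝ} (hc : ∀ n, 0 ≤ c n) {f : ℝ → E} (hf : StronglyMeasurable f)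
    (hi : Integrable f (weightedCount c)) :
    ∫ u, f u ∂(weightedCount c) = ∑' n : ℕ, c n • f n := by
  have hi' := hi
  rw [weightedCount, integrable_map_measure hf.aestronglyMeasurable
    (measurable_of_countable _).aemeasurable,
    integrable_withDensity_iff_integrable_smul (measurable_of_countable _)] at hi'
  rw [weightedCount, integral_map (measurable_of_countable _).aemeasurable
    hf.aestronglyMeasurable, integral_withDensity_eq_integral_smul (measurable_of_countable _),
    integral_countable (by exact hi')]
  simp [NNReal.smul_def, hc, measureReal_def]

theorem measureReal_weightedCount_Iic {c : ℕ → ℝ} (hc : ∀ n, 0 ≤ c n) (h0 : c 0 = 0) (x : ℝ)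
    (hx : 0 ≤ x) :
    (weightedCount c).real (Iic x) = ∑ n ∈ Finset.Icc 1 ⌊x⌋₊, c n := by
  have hmem : ∀ n : ℕ, (n : ℝ) ∈ Iic x ↔ n ∈ Finset.Icc 0 ⌊x⌋₊ := fun n => by
    simp [Nat.le_floor_iff hx]
  have hs : Summable fun n : ℕ => ‖c n • (Iic x).indicator (fun _ => (1 : ℝ)) n‖ := by
    refine summable_of_ne_finset_zero (s := Finset.Icc 0 ⌊x⌋₊) fun n hn => ?_
    rw [← hmem] at hn
    simp [indicator_of_notMem hn]
  have hm : StronglyMeasurable ((Iic x).indicator fun _ => (1 : ℝ)) :=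
    stronglyMeasurable_const.indicator measurableSet_Iic
  have := integral_weightedCount hc hm ((integrable_weightedCount_iff hc hm).2 hs)
  rw [integral_indicator_const _ measurableSet_Iic, smul_eq_mul, mul_one] at this
  rw [this, tsum_eq_sum (s := Finset.Icc 1 ⌊x⌋₊)]
  · refine Finset.sum_congr rfl fun n hn => ?_
    rw [indicator_of_mem ((hmem n).2 (by simp at hn ⊢; exact hn.2))]
    simp
  · intro n hn
    rcases Nat.eq_zero_or_pos n with rfl | hn0
    · simp [h0]
    · rw [indicator_of_notMem]
      · simp
      · rw [hmem]
        simp at hn ⊢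
        exact hn hn0

theorem ae_pos_weightedCount {c : ℕ → ℝ} (h0 : c 0 = 0) :
    ∀ᵐ u ∂(weightedCount c), 0 < u := by
  rw [weightedCount, ae_map_iff (measurable_of_countable _).aemeasurable measurableSet_Ioi,
    ae_withDensity_iff (measurable_of_countable _)]
  refine ae_of_all _ fun n hn => ?_
  rcases Nat.eq_zero_or_pos n with rfl | hn0
  · simp [h0] at hn
  · exact_mod_cast hn0

/-- The measure `(log u)² du` on `(1, ∞)`. -/
noncomputable def logSqMeasure : Measure ℝ :=
  (volume.restrict (Ioi 1)).withDensity fun u => ((Real.log u ^ 2).toNNReal : ENNReal)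

instance : SFinite logSqMeasure := by
  unfold logSqMeasure
  infer_instance

theorem measurable_logSq_toNNReal : Measurable fun u : ℝ => (Real.log u ^ 2).toNNReal := by
  fun_prop

theorem integrable_logSqMeasure_iff {E : Type*} [NormedAddCommGroup E] [NormedSpace ℝ E]
    {f : ℝ → E} : Integrable f logSqMeasure ↔
      IntegrableOn (fun u => Real.log u ^ 2 • f u) (Ioi 1) := by
  rw [logSqMeasure, integrable_withDensity_iff_integrable_smul measurable_logSq_toNNReal]
  simp only [NNReal.smul_def, Real.coe_toNNReal _ (sq_nonneg _), IntegrableOn]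

theorem integral_logSqMeasure {E : Type*} [NormedAddCommGroup E] [NormedSpace ℝ E]
    (f : ℝ → E) : ∫ u, f u ∂logSqMeasure = ∫ u in Ioi 1, Real.log u ^ 2 • f u := by
  rw [logSqMeasure, integral_withDensity_eq_integral_smul measurable_logSq_toNNReal]
  simp only [NNReal.smul_def, Real.coe_toNNReal _ (sq_nonneg _)]

theorem ae_pos_logSqMeasure : ∀ᵐ u ∂logSqMeasure, 0 < u := by
  rw [logSqMeasure, ae_withDensity_iff (by fun_prop)]
  filter_upwards [ae_restrict_mem measurableSet_Ioi] with u hu _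
  exact zero_lt_one.trans hu

theorem integrable_rpow_logSqMeasure {σ : ℝ} (hσ : 1 < σ) :
    Integrable (fun u : ℝ => u ^ (-σ)) logSqMeasure := by
  rw [integrable_logSqMeasure_iff]
  set ε := (σ - 1) / 4 with hε
  have hε0 : 0 < ε := by linarith
  refine ((integrableOn_Ioi_rpow_of_lt (a := 2 * ε - σ) (by linarith) one_pos).const_mul
    (1 / ε ^ 2)).mono' (Measurable.aestronglyMeasurable (by fun_prop)) ?_
  filter_upwards [ae_restrict_mem measurableSet_Ioi] with u hu
  have hu1 : 1 < u := hu
  have hu0 : 0 < u := zero_lt_one.trans hu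
  have h1 := Real.log_le_rpow_div hu0.le hε0
  have h0 : 0 ≤ Real.log u := Real.log_nonneg hu1.le
  rw [norm_smul, Real.norm_of_nonneg (by positivity), Real.norm_of_nonneg (by positivity)]
  calc Real.log u ^ 2 * u ^ (-σ) ≤ (u ^ ε / ε) ^ 2 * u ^ (-σ) := by gcongr
    _ = _ := by
      rw [div_pow, ← Real.rpow_mul_natCast hu0.le, sub_eq_add_neg, Real.rpow_add hu0]
      push_cast
      rw [mul_comm ε 2]
      ring

theorem integral_cpow_logSqMeasure {s : ℂ} (hs : 1 < s.re) :
    ∫ u : ℝ, (u : ℂ) ^ (-s) ∂logSqMeasure = 2 / (s - 1) ^ 3 := by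
  have hs1 : s - 1 ≠ 0 := fun h => by
    rw [sub_eq_zero.mp h] at hs
    simp at hs
  have hintegr : IntegrableOn (fun u : ℝ => Real.log u ^ 2 • (u : ℂ) ^ (-s)) (Ioi 1) := by
    rw [← integrable_logSqMeasure_iff]
    refine (integrable_rpow_logSqMeasure hs).mono'
      (Measurable.aestronglyMeasurable (by fun_prop)) ?_
    filter_upwards [ae_pos_logSqMeasure] with u hu
    rw [Complex.norm_cpow_eq_rpow_re_of_pos hu, Complex.neg_re]
  rw [integral_logSqMeasure]
  set F : ℝ → ℂ := fun u => -((u : ℂ) ^ (1 - s) * ((Real.log u : ℂ) ^ 2 / (s - 1) +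
    2 * (Real.log u : ℂ) / (s - 1) ^ 2 + 2 / (s - 1) ^ 3)) with hF
  have hderiv : ∀ u ∈ Ici (1 : ℝ), HasDerivAt F (Real.log u ^ 2 • (u : ℂ) ^ (-s)) u := by
    intro u hu
    have hu0 : (0 : ℝ) < u := zero_lt_one.trans_le hu
    have hu0' : (u : ℂ) ≠ 0 := by exact_mod_cast hu0.ne'
    have h1 : HasDerivAt (fun u : ℝ => (u : ℂ) ^ (1 - s)) ((1 - s) * (u : ℂ) ^ (-s)) u := by
      have := ((hasDerivAt_id (u : ℂ)).cpow_const (c := 1 - s)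
        (Complex.ofReal_mem_slitPlane.2 hu0)).comp_ofReal
      simpa using this
    have h2 : HasDerivAt (fun u : ℝ => (Real.log u : ℂ)) ((u⁻¹ : ℝ) : ℂ) u :=
      (Real.hasDerivAt_log hu0.ne').ofReal_comp
    have h3 := (h1.mul ((((h2.pow 2).div_const (s - 1)).add
      ((h2.const_mul 2).div_const ((s - 1) ^ 2))).add_const (2 / (s - 1) ^ 3))).neg
    refine h3.congr_deriv ?_
    rw [show 1 - s = -s + 1 by ring, Complex.cpow_add _ _ hu0', Complex.cpow_one]
    simp only [Complex.real_smul, Pi.pow_apply, Pi.add_apply]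
    push_cast
    field_simp
    ring
  have htend : Tendsto F atTop (𝓝 0) := by
    have key : ∀ j : ℕ, Tendsto (fun u : ℝ => (u : ℂ) ^ (1 - s) * (Real.log u : ℂ) ^ j) atTop
        (𝓝 0) := by
      intro j
      rw [tendsto_zero_iff_norm_tendsto_zero]
      have h := (isLittleO_log_rpow_rpow_atTop (j : ℝ) (s := s.re - 1)
        (by linarith)).tendsto_div_nhds_zero
      refine h.congr' ?_
      filter_upwards [eventually_gt_atTop 1] with u hu
      have hu0 : (0 : ℝ) < u := by linarith
      have h0 : 0 ≤ Real.log u := Real.log_nonneg hu.le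
      rw [norm_mul, norm_pow, Complex.norm_cpow_eq_rpow_re_of_pos hu0, Complex.norm_real,
        Real.norm_of_nonneg h0, Real.rpow_natCast, div_eq_mul_inv, ← Real.rpow_neg hu0.le, mul_comm]
      simp
    have := ((((key 2).div_const (s - 1)).add (((key 1).const_mul 2).div_const ((s - 1) ^ 2))).add
      (((key 0).const_mul 2).div_const ((s - 1) ^ 3))).neg
    simp only [zero_div, mul_zero, add_zero, neg_zero] at this
    refine this.congr fun u => ?_
    simp only [hF]
    ring
  rw [integral_Ioi_of_hasDerivAt_of_tendsto' hderiv hintegr htend]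
  simp [hF]

theorem measureReal_logSqMeasure_Iic {y : ℝ} (hy : 1 ≤ y) :
    logSqMeasure.real (Iic y) = y * Real.log y ^ 2 - 2 * y * Real.log y + 2 * y - 2 := by
  have h1 : logSqMeasure.real (Iic y) = ∫ u in (1 : ℝ)..y, Real.log u ^ 2 := by
    have := integral_indicator_const (μ := logSqMeasure) (1 : ℝ) (measurableSet_Iic (a := y))
    rw [smul_eq_mul, mul_one] at this
    rw [← this, integral_logSqMeasure, intervalIntegral.integral_of_le hy, ← Ioi_inter_Iic,
      ← setIntegral_indicator measurableSet_Iic]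
    refine integral_congr_ae (ae_of_all _ fun u => ?_)
    by_cases hu : u ∈ Iic y <;> simp [hu]
  rw [h1, intervalIntegral.integral_eq_sub_of_hasDerivAt
    (f := fun u => u * Real.log u ^ 2 - 2 * u * Real.log u + 2 * u)]
  · simp
  · intro u hu
    rw [uIcc_of_le hy] at hu
    have hu0 : u ≠ 0 := by linarith [hu.1]
    have hl := Real.hasDerivAt_log hu0
    have := (((hasDerivAt_id u).mul (hl.pow 2)).sub (((hasDerivAt_id u).const_mul 2).mul hl)).add
      ((hasDerivAt_id u).const_mul 2)
    refine this.congr_deriv ?_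
    simp only [id, Pi.pow_apply]
    field_simp
    ring
  · refine ContinuousOn.intervalIntegrable ?_
    rw [uIcc_of_le hy]
    refine ContinuousOn.pow (Real.continuousOn_log.mono fun u hu => ?_) 2
    have := hu.1
    simp
    linarith

namespace HasLogDeriv

variable {a Λ : ℕ → ℝ} {ρ δ C D : ℝ}

/-- The prime number theorem with a weight `(log n)²`. -/
theorem sum_mul_log_sq_isBigO (h : HasLogDeriv a Λ D) (ha : HasPowerSaving a ρ δ C) :
    (fun x : ℝ => ∑ n ∈ Finset.Icc 1 ⌊x⌋₊, Λ n * Real.log n ^ 2 - x * Real.log x ^ 2) =O[atTop]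
      fun x => x * Real.log x := by
  set c : ℕ → ℝ := fun n => Λ n * Real.log n ^ 2 with hcdef
  have hc : ∀ n, 0 ≤ c n := fun n => mul_nonneg (h.nonneg n) (sq_nonneg _)
  have hc0 : c 0 = 0 := by simp [hcdef]
  have hm : ∀ s : ℂ, StronglyMeasurable fun u : ℝ => (u : ℂ) ^ (-s) := fun s =>
    Measurable.stronglyMeasurable (by fun_prop)
  have hterm : ∀ s : ℂ, 1 < s.re → ∀ n : ℕ,
      term (fun n => (c n : ℂ)) s n = c n • ((n : ℝ) : ℂ) ^ (-s) := fun s hs n => by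
    rcases Nat.eq_zero_or_pos n with rfl | hn
    · simp [hc0]
    · rw [term_of_ne_zero hn.ne', Complex.cpow_neg, Complex.real_smul, div_eq_mul_inv]
      simp
  have hsum : ∀ s : ℂ, 1 < s.re → Integrable (fun u : ℝ => (u : ℂ) ^ (-s)) (weightedCount c) := by
    intro s hs
    rw [integrable_weightedCount_iff hc (hm s)]
    have h1 : LSeriesSummable (fun n => (c n : ℂ)) s := by
      have : (fun n => (c n : ℂ)) = logMul (logMul fun n => (Λ n : ℂ)) := by
        ext n
        simp only [logMul, hcdef, ← Complex.natCast_log]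
        push_cast
        ring
      rw [this]
      refine LSeriesSummable_of_abscissaOfAbsConv_lt_re ?_
      rw [abscissaOfAbsConv_logMul, abscissaOfAbsConv_logMul]
      exact h.abscissaOfAbsConv_le.trans_lt (one_lt_ereal_of_re hs)
    exact h1.norm.congr fun n => by rw [hterm s hs]
  have hintegr : ∀ s : ℂ, 1 < s.re →
      ∫ u : ℝ, (u : ℂ) ^ (-s) ∂(weightedCount c) = LSeries (fun n => (c n : ℂ)) s := by
    intro s hs
    rw [integral_weightedCount hc (hm s) (hsum s hs)]
    exact tsum_congr fun n => (hterm s hs n).symm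
  have hpos : ∀ᵐ u ∂(weightedCount c), 0 < u := ae_pos_weightedCount hc0
  have hi : ∀ σ : ℝ, 1 < σ → Integrable (fun u : ℝ => u ^ (-σ)) (weightedCount c) := by
    intro σ hσ
    refine ((hsum σ (by simpa using hσ)).norm).congr ?_
    filter_upwards [hpos] with u hu
    rw [Complex.norm_cpow_eq_rpow_re_of_pos hu]
    simp
  obtain ⟨K, hK0, hK⟩ := h.exists_norm_lseries_mul_log_sq_sub_le ha
  obtain ⟨B, hB0, hB⟩ := exists_measureReal_Iic_le hpos ae_pos_logSqMeasure hi
    (fun σ hσ => integrable_rpow_logSqMeasure hσ) (K := K) (fun σ t hσ hσ2 => by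
      have hs : 1 < ((σ : ℂ) + t * Complex.I).re := by simpa using hσ
      rw [hintegr _ hs, integral_cpow_logSqMeasure hs]
      have := hK _ hs (by simpa using hσ2)
      simp only [Complex.add_im, Complex.ofReal_im, Complex.mul_im, Complex.ofReal_re,
        Complex.I_im, Complex.I_re, mul_one, mul_zero, zero_add, add_zero] at this
      exact mod_cast this)
  refine IsBigO.of_bound (10 + 4 * B) ?_
  filter_upwards [eventually_ge_atTop (Real.exp 2)] with x hx
  have hL : 2 ≤ Real.log x := (Real.le_log_iff_exp_le ((Real.exp_pos 2).trans_le hx)).2 hx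
  have hx3 : 3 ≤ x := by linarith [Real.add_one_le_exp (2 : ℝ)]
  have hx0 : 0 < x := by linarith
  set Lx := Real.log x with hLx
  have hL0 : 0 < Lx := by linarith
  have hr : 1 / Lx ≤ 1 / 2 := one_div_le_one_div_of_le two_pos hL
  have hr0 : 0 < 1 / Lx := by positivity
  set r := 1 / Lx with hrdef
  have hrL : r * Lx = 1 := by rw [hrdef]; field_simp
  have hk : 0 < x * r := by positivity
  rw [← measureReal_weightedCount_Iic hc hc0 x hx0.le, Real.norm_eq_abs, Real.norm_of_nonneg
    (by positivity), abs_le]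
  constructor
  · have h1 := (hB (x - x * r) (x * r) (by nlinarith) hk).2
    have hy1 : 1 ≤ x - x * r := by nlinarith
    rw [sub_add_cancel, measureReal_logSqMeasure_Iic hy1] at h1
    have h2 : B * x ^ 2 / (x * r) = B * (x * Lx) := by
      rw [hrdef]; field_simp
    have h3 : Lx - 2 * r ≤ Real.log (x - x * r) := by
      rw [show x - x * r = x * (1 - r) by ring, Real.log_mul hx0.ne' (by linarith)]
      have := Real.one_sub_inv_le_log_of_pos (show 0 < 1 - r by linarith)
      have h4 : (1 - r)⁻¹ ≤ 1 + 2 * r := by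
        rw [inv_le_iff_one_le_mul₀ (by linarith)]
        nlinarith
      linarith
    have h5 : Real.log (x - x * r) ≤ Lx := Real.log_le_log (by linarith) (by linarith)
    set l := Real.log (x - x * r)
    have h6 : Lx ^ 2 - 4 ≤ l ^ 2 := by nlinarith
    have h7 : (x - x * r) * (Lx ^ 2 - 4) ≤ (x - x * r) * l ^ 2 := by gcongr
    have h8 : (x - x * r) * l ≤ x * Lx := by
      have : 0 ≤ l := by nlinarith
      nlinarith
    have h9 : x * r * Lx ^ 2 = x * Lx := by rw [pow_two, mul_assoc, ← mul_assoc r, hrL, one_mul]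
    have hxL : 2 * x ≤ x * Lx := by nlinarith
    have hBx : 0 ≤ B * (x * Lx) := by positivity
    nlinarith
  · have h1 := (hB x (x * r) hx0 hk).1
    rw [measureReal_logSqMeasure_Iic (by nlinarith)] at h1
    have h2 : B * (x + x * r) ^ 2 / (x * r) ≤ 4 * B * (x * Lx) := by
      rw [div_le_iff₀ hk, show 4 * B * (x * Lx) * (x * r) = B * (2 * x) ^ 2 * (r * Lx) by ring, hrL,
        mul_one]
      gcongr
      nlinarith
    have h3 : Real.log (x + x * r) ≤ Lx + r := by
      rw [show x + x * r = x * (1 + r) by ring, Real.log_mul hx0.ne' (by linarith)]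
      linarith [Real.log_le_sub_one_of_pos (show 0 < 1 + r by linarith)]
    have h5 : Lx ≤ Real.log (x + x * r) := Real.log_le_log hx0 (by linarith)
    set l := Real.log (x + x * r)
    have h6 : l ^ 2 ≤ Lx ^ 2 + 3 := by nlinarith
    have h7 : (x + x * r) * l ^ 2 ≤ (x + x * r) * (Lx ^ 2 + 3) := by gcongr
    have h9 : x * r * Lx ^ 2 = x * Lx := by rw [pow_two, mul_assoc, ← mul_assoc r, hrL, one_mul]
    have hxL : 2 * x ≤ x * Lx := by nlinarith
    have hxr : x * r ≤ x := by nlinarith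
    have h10 : (x + x * r) * 1 ≤ (x + x * r) * l := by
      gcongr
      linarith
    nlinarith

end HasLogDeriv
end SumAsymptotics

section PrimeSums
open MeasureTheory Set Asymptotics Topology Chebyshev

namespace HasLogDeriv

variable {a Λ : ℕ → ℝ} {ρ δ C D : ℝ}

theorem zero_le_constant (h : HasLogDeriv a Λ D) : 0 ≤ D := by
  have h1 := (h.nonneg 2).trans (h.le_vonMangoldt 2)
  rw [ArithmeticFunction.vonMangoldt_apply_prime Nat.prime_two] at h1
  exact nonneg_of_mul_nonneg_left h1 (Real.log_pos (by norm_num))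

theorem sum_subset_mul_log_sq_le (h : HasLogDeriv a Λ D) (P : ℕ → Prop) [DecidablePred P] (x : ℝ) :
    ∑ n ∈ Finset.Ioc 0 ⌊x⌋₊ with P n, Λ n * Real.log n ^ 2 ≤
      D * Real.log x ^ 2 * ∑ n ∈ Finset.Ioc 0 ⌊x⌋₊ with P n, ArithmeticFunction.vonMangoldt n := by
  rw [Finset.mul_sum]
  refine Finset.sum_le_sum fun n hn => ?_
  obtain ⟨hn0, hn1⟩ := Finset.mem_Ioc.1 (Finset.mem_filter.1 hn).1
  have hx : (n : ℝ) ≤ x := (Nat.le_floor_iff' hn0.ne').1 hn1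
  have hn1' : (1 : ℝ) ≤ n := by exact_mod_cast hn0
  have hl : Real.log n ≤ Real.log x := Real.log_le_log (by linarith) hx
  have hl0 : 0 ≤ Real.log n := Real.log_nonneg hn1'
  have hD := h.zero_le_constant
  have hv : 0 ≤ ArithmeticFunction.vonMangoldt n := ArithmeticFunction.vonMangoldt_nonneg
  calc Λ n * Real.log n ^ 2 ≤ (D * ArithmeticFunction.vonMangoldt n) * Real.log x ^ 2 := by
        gcongr
        exact h.le_vonMangoldt n
    _ = _ := by ring

theorem sum_prime_mul_log_sq_isBigO (h : HasLogDeriv a Λ D) (ha : HasPowerSaving a ρ δ C) :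
    (fun x : ℝ => ∑ n ∈ Finset.Ioc 0 ⌊x⌋₊ with n.Prime, Λ n * Real.log n ^ 2 -
      x * Real.log x ^ 2) =O[atTop] fun x => x * Real.log x := by
  obtain ⟨K, hK⟩ := psi_sub_theta_le_mul_sqrt
  have hD := h.zero_le_constant
  have h1 : (fun x : ℝ => ∑ n ∈ Finset.Ioc 0 ⌊x⌋₊ with ¬ n.Prime, Λ n * Real.log n ^ 2)
      =O[atTop] fun x => x * Real.log x := by
    refine IsBigO.of_bound (2 * D * |K|) ?_
    filter_upwards [eventually_ge_atTop 1] with x hx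
    have hx0 : 0 < x := by linarith
    have hl0 : 0 ≤ Real.log x := Real.log_nonneg hx
    rw [Real.norm_of_nonneg (Finset.sum_nonneg fun n _ => mul_nonneg (h.nonneg n) (sq_nonneg _)),
      Real.norm_of_nonneg (by positivity)]
    have h2 := h.sum_subset_mul_log_sq_le (fun n => ¬ n.Prime) x
    rw [← psi_sub_theta_eq_sum_not_prime] at h2
    have h3 : Real.log x ≤ 2 * √x := by
      have := Real.log_le_rpow_div hx0.le (one_half_pos (α := ℝ))
      rw [← Real.sqrt_eq_rpow] at this
      linarith
    calc _ ≤ D * Real.log x ^ 2 * (ψ x - θ x) := h2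
      _ ≤ D * Real.log x ^ 2 * (|K| * √x) := by
        gcongr
        exact (hK x).trans (by gcongr; exact le_abs_self K)
      _ = D * |K| * Real.log x * √x * Real.log x := by ring
      _ ≤ D * |K| * Real.log x * √x * (2 * √x) := by gcongr
      _ = 2 * D * |K| * Real.log x * (√x * √x) := by ring
      _ = _ := by
        rw [Real.mul_self_sqrt hx0.le]
        ring
  refine ((h.sum_mul_log_sq_isBigO ha).sub h1).congr_left fun x => ?_
  rw [show Finset.Icc 1 ⌊x⌋₊ = Finset.Ioc 0 ⌊x⌋₊ from rfl,
    ← Finset.sum_filter_add_sum_filter_not (Finset.Ioc 0 ⌊x⌋₊) Nat.Prime]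
  ring

/-- Landau's prime ideal theorem, with error term `O(x / (log x)²)`, in the form of a statement on
the coefficients at the primes. -/
theorem sum_prime_isBigO (h : HasLogDeriv a Λ D) (ha : HasPowerSaving a ρ δ C)
    (hp : ∀ p : ℕ, p.Prime → Λ p = a p * Real.log p) :
    (fun x : ℝ => ∑ p ∈ Finset.Ioc 0 ⌊x⌋₊ with p.Prime, a p - x / Real.log x) =O[atTop]
      fun x => x / Real.log x ^ 2 := by
  set c : ℕ → ℝ := fun n => if n.Prime then Λ n * Real.log n ^ 2 else 0 with hc
  set T : ℝ → ℝ := fun x => ∑ n ∈ Finset.Icc 0 ⌊x⌋₊, c n with hT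
  have hTeq : ∀ x, T x = ∑ n ∈ Finset.Ioc 0 ⌊x⌋₊ with n.Prime, Λ n * Real.log n ^ 2 := by
    intro x
    rw [Finset.sum_filter]
    simp only [hT, hc]
    rw [← Finset.add_sum_Ioc_eq_sum_Icc (Nat.zero_le _), if_neg Nat.not_prime_zero, zero_add]
  have hD := h.zero_le_constant
  set K : ℝ := D * (Real.log 4 + 4) with hK
  have hK0 : 0 ≤ K := by
    have := Real.log_nonneg (show (1 : ℝ) ≤ 4 by norm_num)
    positivity
  have hT0 : ∀ x, 0 ≤ T x := fun x => by
    rw [hTeq]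
    exact Finset.sum_nonneg fun n _ => mul_nonneg (h.nonneg n) (sq_nonneg _)
  have hTle : ∀ x, 1 ≤ x → T x ≤ K * x * Real.log x ^ 2 := fun x hx => by
    rw [hTeq]
    refine (h.sum_subset_mul_log_sq_le Nat.Prime x).trans ?_
    rw [show K * x * Real.log x ^ 2 = D * Real.log x ^ 2 * ((Real.log 4 + 4) * x) by rw [hK]; ring]
    refine mul_le_mul_of_nonneg_left ?_ (by positivity)
    refine le_trans ?_ (psi_le_const_mul_self (by linarith))
    rw [psi]
    exact Finset.sum_le_sum_of_subset_of_nonneg (Finset.filter_subset _ _)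
      fun n _ _ => ArithmeticFunction.vonMangoldt_nonneg
  set f : ℝ → ℝ := fun t => (Real.log t ^ 3)⁻¹ with hf
  have hlpos : ∀ t : ℝ, 2 ≤ t → 0 < Real.log t := fun t ht => Real.log_pos (by linarith)
  have hfd : ∀ t : ℝ, 2 ≤ t → HasDerivAt f (-3 / (t * Real.log t ^ 4)) t := by
    intro t ht
    have hl := hlpos t ht
    have ht0 : t ≠ 0 := by linarith
    refine (((Real.hasDerivAt_log ht0).pow 3).inv (pow_ne_zero 3 hl.ne')).congr_deriv ?_
    simp only [Pi.pow_apply]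
    field_simp
    push_cast
    ring
  have hcont : ContinuousOn (fun t : ℝ => -3 / (t * Real.log t ^ 4)) (Ici 2) := by
    intro t ht
    have hl := hlpos t ht
    have ht0 : (0 : ℝ) < t := by
      have : (2 : ℝ) ≤ t := ht
      linarith
    refine ContinuousAt.continuousWithinAt ?_
    refine ContinuousAt.div continuousAt_const ?_ (by positivity)
    exact continuousAt_id.mul ((Real.continuousAt_log ht0.ne').pow 4)
  have habel : ∀ x : ℝ, ∑ p ∈ Finset.Ioc 0 ⌊x⌋₊ with p.Prime, a p =
      f x * T x - ∫ t in Ioc 2 x, deriv f t * T t := by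
    intro x
    rw [hT, ← sum_mul_eq_sub_integral_mul₁ c (by simp [hc]) (by simp [hc, Nat.not_prime_one]) x
      (fun t ht => (hfd t ht.1).differentiableAt)]
    · rw [Finset.sum_filter, ← Finset.add_sum_Ioc_eq_sum_Icc (Nat.zero_le _)]
      simp only [hc, hf, if_neg Nat.not_prime_zero, mul_zero, zero_add]
      refine Finset.sum_congr rfl fun n _ => ?_
      split_ifs with hn
      · have := hlpos n (by exact_mod_cast hn.two_le)
        rw [hp n hn]
        field_simp
      · simp
    · refine IntegrableOn.congr_fun (f := fun t : ℝ => -3 / (t * Real.log t ^ 4)) ?_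
        (fun t ht => (hfd t ht.1).deriv.symm) measurableSet_Icc
      exact (hcont.mono Icc_subset_Ici_self).integrableOn_Icc
  have hI : (fun x : ℝ => ∫ t in Ioc 2 x, deriv f t * T t) =O[atTop]
      fun x => x / Real.log x ^ 2 := by
    refine IsBigO.trans ?_ integral_one_div_log_sq_isBigO
    refine IsBigO.of_bound (3 * K) ?_
    filter_upwards [eventually_ge_atTop 2] with x hx
    have hi : IntervalIntegrable (fun t => 1 / Real.log t ^ 2) volume 2 x :=
      intervalIntegrable_one_div_log_sq (by norm_num) (by linarith)
    rw [Real.norm_of_nonneg (intervalIntegral.integral_nonneg hx fun t _ => by positivity),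
      intervalIntegral.integral_of_le hx, ← integral_const_mul]
    rw [intervalIntegrable_iff_integrableOn_Ioc_of_le hx] at hi
    refine norm_integral_le_of_norm_le (hi.const_mul (3 * K)) ?_
    filter_upwards [ae_restrict_mem measurableSet_Ioc] with t ht
    have ht2 : 2 ≤ t := ht.1.le
    have hl := hlpos t ht2
    have ht0 : 0 < t := by linarith
    rw [(hfd t ht2).deriv, norm_mul, Real.norm_of_nonneg (hT0 t), norm_div, norm_neg,
      Real.norm_of_nonneg (by positivity : 0 ≤ t * Real.log t ^ 4), Real.norm_ofNat]
    calc 3 / (t * Real.log t ^ 4) * T t ≤ 3 / (t * Real.log t ^ 4) * (K * t * Real.log t ^ 2) := by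
          gcongr
          exact hTle t (by linarith)
      _ = _ := by field_simp
  have hmain : (fun x : ℝ => f x * T x - x / Real.log x) =O[atTop]
      fun x => x / Real.log x ^ 2 := by
    have h1 := (isBigO_refl f atTop).mul (h.sum_prime_mul_log_sq_isBigO ha)
    refine (h1.congr' ?_ ?_)
    · filter_upwards [eventually_ge_atTop 2] with x hx
      have hl := hlpos x hx
      rw [← hTeq]
      simp only [hf]
      field_simp
    · filter_upwards [eventually_ge_atTop 2] with x hx
      have hl := hlpos x hx
      simp only [hf]
      field_simp
  refine (hmain.sub hI).congr_left fun x => ?_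
  rw [habel]
  ring

end HasLogDeriv
end PrimeSums

section IdealCount
open Ideal

variable (K : Type*) [Field K] [NumberField K]

/-- The finite set of ideals of given norm. -/
noncomputable def idealsOfNorm (n : ℕ) : Finset (Ideal (𝓞 K)) :=
  (finite_setOfPred_absNorm_eq n).toFinset

/-- The number of nonzero ideals of norm `n`. -/
noncomputable def idealCount (n : ℕ) : ℝ :=
  if n = 0 then 0 else (idealsOfNorm K n).card

variable {K}

/-- The von Mangoldt function on ideals. -/
noncomputable def idealVonMangoldt (Q : Ideal (𝓞 K)) : ℝ :=
  open scoped Classical in if IsPrimePow Q then Real.log (absNorm Q.radical) else 0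

variable (K) in
/-- The coefficients of the logarithmic derivative of the Dedekind zeta function. -/
noncomputable def normVonMangoldt (n : ℕ) : ℝ :=
  ∑ Q ∈ idealsOfNorm K n, idealVonMangoldt Q

@[simp]
theorem mem_idealsOfNorm {n : ℕ} {I : Ideal (𝓞 K)} : I ∈ idealsOfNorm K n ↔ absNorm I = n := by
  simp [idealsOfNorm]

theorem idealVonMangoldt_nonneg (Q : Ideal (𝓞 K)) : 0 ≤ idealVonMangoldt Q := by
  unfold idealVonMangoldt
  split_ifs
  · exact Real.log_natCast_nonneg _
  · exact le_rfl

theorem idealVonMangoldt_pow {P : Ideal (𝓞 K)} (hP : Prime P) {k : ℕ} (hk : k ≠ 0) :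
    idealVonMangoldt (P ^ k) = Real.log (absNorm P) := by
  rw [idealVonMangoldt, if_pos ⟨P, k, hP, Nat.pos_of_ne_zero hk, rfl⟩, Ideal.radical_pow _ hk,
    (isPrime_of_prime hP).radical]

theorem finite_setOf_dvd_ideal {I : Ideal (𝓞 K)} (hI : I ≠ 0) : {Q | Q ∣ I}.Finite := by
  refine (finite_setOfPred_absNorm_le (S := 𝓞 K) (absNorm I)).subset fun Q hQ => ?_
  exact Nat.le_of_dvd (Nat.pos_of_ne_zero fun h => hI (absNorm_eq_zero_iff.1 h)) (map_dvd absNorm hQ)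

theorem finsum_idealVonMangoldt_dvd (I : Ideal (𝓞 K)) (hI : I ≠ 0) :
    ∑ Q ∈ (finite_setOf_dvd_ideal hI).toFinset, idealVonMangoldt Q = Real.log (absNorm I) := by
  classical
  induction I using UniqueFactorizationMonoid.induction_on_coprime with
  | h0 => exact absurd rfl hI
  | @h1 I hu =>
    have hI1 : absNorm I = 1 := by rw [Ideal.isUnit_iff.1 hu, absNorm_top]
    rw [hI1, Nat.cast_one, Real.log_one]
    refine Finset.sum_eq_zero fun Q hQ => ?_
    rw [idealVonMangoldt, if_neg]
    intro hpp
    simp only [Set.Finite.mem_toFinset, Set.mem_ofPred_eq] at hQ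
    exact hpp.not_isUnit (isUnit_of_dvd_unit hQ hu)
  | @hpr P i hP =>
    have h1 : (finite_setOf_dvd_ideal hI).toFinset = (Finset.range (i + 1)).image (P ^ ·) := by
      ext Q
      simp only [Set.Finite.mem_toFinset, Set.mem_ofPred_eq, Finset.mem_image, Finset.mem_range]
      rw [dvd_prime_pow hP]
      exact ⟨fun ⟨j, hj, h⟩ => ⟨j, by omega, (associated_iff_eq.1 h).symm⟩,
        fun ⟨j, hj, h⟩ => ⟨j, by omega, associated_iff_eq.2 h.symm⟩⟩
    rw [h1, Finset.sum_image (fun a _ b _ h => pow_injective_of_not_isUnit hP.not_isUnit hP.ne_zero h),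
      Finset.sum_range_succ', Finset.sum_congr rfl fun j _ => idealVonMangoldt_pow hP j.succ_ne_zero,
      idealVonMangoldt, if_neg (fun h => h.not_isUnit (by simp))]
    simp
  | @hcp I J hrel ihI ihJ =>
    have hI0 : I ≠ 0 := left_ne_zero_of_mul hI
    have hJ0 : J ≠ 0 := right_ne_zero_of_mul hI
    rw [map_mul, Nat.cast_mul, Real.log_mul (by simpa [absNorm_eq_zero_iff] using hI0)
      (by simpa [absNorm_eq_zero_iff] using hJ0), ← ihI hI0, ← ihJ hJ0]
    simp only [idealVonMangoldt, ← Finset.sum_filter]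
    rw [← Finset.sum_union]
    · refine Finset.sum_congr ?_ fun _ _ => rfl
      ext Q
      simp only [Finset.mem_filter, Finset.mem_union, Set.Finite.mem_toFinset, Set.mem_ofPred_eq]
      rw [← or_and_right]
      refine and_congr_left fun hQ => ⟨?_, fun h => h.elim (fun h => h.mul_right J)
        (fun h => h.mul_left I)⟩
      obtain ⟨P, k, hP, hk, rfl⟩ := hQ
      intro h
      by_cases hPI : P ∣ I
      · exact Or.inl (hP.pow_dvd_of_dvd_mul_right k
          (fun hPJ => hP.not_isUnit (hrel hPI hPJ)) h)
      · exact Or.inr (hP.pow_dvd_of_dvd_mul_left k hPI h)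
    · rw [Finset.disjoint_left]
      intro Q h1 h2
      simp only [Finset.mem_filter, Set.Finite.mem_toFinset, Set.mem_ofPred_eq] at h1 h2
      exact h1.2.not_isUnit (hrel h1.1 h2.1)

theorem idealCount_mul_log (n : ℕ) : idealCount K n * Real.log n =
    ∑ x ∈ n.divisorsAntidiagonal, normVonMangoldt K x.1 * idealCount K x.2 := by
  classical
  rcases eq_or_ne n 0 with rfl | hn
  · simp
  have hne : ∀ {m : ℕ} {I : Ideal (𝓞 K)}, m ≠ 0 → I ∈ idealsOfNorm K m → I ≠ 0 := by
    rintro m I hm hI rfl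
    rw [mem_idealsOfNorm] at hI
    simp at hI
    exact hm hI.symm
  set N : Finset (Ideal (𝓞 K)) := (finite_setOfPred_absNorm_le n).toFinset with hN
  have hmN : ∀ I : Ideal (𝓞 K), I ∈ N ↔ absNorm I ≤ n := fun I => by simp [hN]
  have hL : idealCount K n * Real.log n =
      ∑ I ∈ idealsOfNorm K n, ∑ Q ∈ N with Q ∣ I, idealVonMangoldt Q := by
    rw [idealCount, if_neg hn, ← nsmul_eq_mul, ← Finset.sum_const]
    refine Finset.sum_congr rfl fun I hI => ?_
    rw [← mem_idealsOfNorm.1 hI, ← finsum_idealVonMangoldt_dvd I (hne hn hI)]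
    refine Finset.sum_congr ?_ fun _ _ => rfl
    ext Q
    simp only [Set.Finite.mem_toFinset, Set.mem_ofPred_eq, Finset.mem_filter, hmN]
    refine ⟨fun h => ⟨?_, h⟩, fun h => h.2⟩
    have := map_dvd absNorm h
    rw [mem_idealsOfNorm.1 hI] at this
    exact Nat.le_of_dvd (Nat.pos_of_ne_zero hn) this
  have hR : ∑ x ∈ n.divisorsAntidiagonal, normVonMangoldt K x.1 * idealCount K x.2 =
      ∑ x ∈ n.divisorsAntidiagonal, ∑ y ∈ idealsOfNorm K x.1 ×ˢ idealsOfNorm K x.2,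
        idealVonMangoldt y.1 := by
    refine Finset.sum_congr rfl fun x hx => ?_
    rw [Finset.sum_product, idealCount, if_neg (Nat.ne_zero_of_mem_divisorsAntidiagonal hx).2,
      normVonMangoldt, Finset.sum_mul]
    refine Finset.sum_congr rfl fun Q _ => ?_
    simp only [Finset.sum_const, nsmul_eq_mul, mul_comm]
  rw [hL, hR, Finset.sum_sigma', Finset.sum_sigma']
  symm
  refine Finset.sum_bij (fun z _ => ⟨z.2.1 * z.2.2, z.2.1⟩) ?_ ?_ ?_ fun _ _ => rfl
  · rintro ⟨⟨d, e⟩, Q, J⟩ h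
    simp only [Finset.mem_sigma, Finset.mem_product, mem_idealsOfNorm,
      Nat.mem_divisorsAntidiagonal] at h
    obtain ⟨⟨hde, -⟩, hQ, hJ⟩ := h
    simp only [Finset.mem_sigma, mem_idealsOfNorm, Finset.mem_filter, hmN, map_mul, hQ, hJ, hde,
      dvd_mul_right, and_true, true_and]
    exact Nat.le_of_dvd (Nat.pos_of_ne_zero hn) ⟨e, hde.symm⟩
  · rintro ⟨⟨d, e⟩, Q, J⟩ h ⟨⟨d', e'⟩, Q', J'⟩ h' heq
    simp only [Finset.mem_sigma, Finset.mem_product, mem_idealsOfNorm,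
      Nat.mem_divisorsAntidiagonal] at h h'
    obtain ⟨⟨hde, -⟩, rfl, rfl⟩ := h
    obtain ⟨⟨hde', -⟩, rfl, rfl⟩ := h'
    simp only [Sigma.mk.injEq, heq_eq_eq] at heq
    obtain ⟨h1, rfl⟩ := heq
    have hQ0 : Q ≠ 0 := by
      rintro rfl
      simp at hde
      exact hn hde.symm
    obtain rfl := mul_left_cancel₀ hQ0 h1
    rfl
  · rintro ⟨I, Q⟩ h
    simp only [Finset.mem_sigma, mem_idealsOfNorm, Finset.mem_filter] at h
    obtain ⟨hI, -, J, rfl⟩ := h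
    refine ⟨⟨(absNorm Q, absNorm J), Q, J⟩, ?_, rfl⟩
    rw [map_mul] at hI
    simp [hI, hn]

theorem normVonMangoldt_le (n : ℕ) : normVonMangoldt K n ≤
    Module.finrank ℤ (𝓞 K) * ArithmeticFunction.vonMangoldt n := by
  classical
  by_cases hex : ∃ Q ∈ idealsOfNorm K n, IsPrimePow Q
  swap
  · push Not at hex
    rw [normVonMangoldt, Finset.sum_eq_zero]
    · have : 0 ≤ ArithmeticFunction.vonMangoldt n := ArithmeticFunction.vonMangoldt_nonneg
      positivity
    · intro Q hQ
      rw [idealVonMangoldt, if_neg (hex Q hQ)]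
  have key : ∀ P : Ideal (𝓞 K), Prime P → ∃ p f : ℕ, 0 < f ∧ (p : 𝓞 K) ∈ P ∧ p.Prime ∧
      absNorm P = p ^ f := fun P hP => by
    have := isPrime_of_prime hP
    have := this.isMaximal hP.ne_zero
    exact exists_prime_and_absNorm_eq_pow P
  obtain ⟨_, hQ, P₀, k, hP₀, hk, rfl⟩ := hex
  obtain ⟨p, f, hf, -, hp, hN⟩ := key P₀ hP₀
  rw [mem_idealsOfNorm, map_pow, hN, ← pow_mul] at hQ
  subst hQ
  have hfk : f * k ≠ 0 := by positivity
  rw [ArithmeticFunction.vonMangoldt_apply_pow hfk, ArithmeticFunction.vonMangoldt_apply_prime hp]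
  have hmem : ∀ Q ∈ idealsOfNorm K (p ^ (f * k)), IsPrimePow Q → ∃ P, Prime P ∧ (p : 𝓞 K) ∈ P ∧
      ∃ j, j ≠ 0 ∧ Q = P ^ j := by
    rintro _ hQ ⟨P, j, hP, hj, rfl⟩
    refine ⟨P, hP, ?_, j, hj.ne', rfl⟩
    obtain ⟨q, g, hg, hqP, hq, hNq⟩ := key P hP
    rw [mem_idealsOfNorm, map_pow, hNq, ← pow_mul] at hQ
    have : q ∣ p ^ (f * k) := hQ ▸ dvd_pow_self q (by positivity)
    rwa [← (Nat.prime_dvd_prime_iff_eq hq hp).1 (hq.dvd_of_dvd_pow this)]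
  set F := {Q ∈ idealsOfNorm K (p ^ (f * k)) | IsPrimePow Q} with hF
  have hmemF : ∀ Q ∈ F, ∃ P, Prime P ∧ (p : 𝓞 K) ∈ P ∧ ∃ j, j ≠ 0 ∧ Q = P ^ j := fun Q hQ =>
    hmem Q (Finset.mem_filter.1 hQ).1 (Finset.mem_filter.1 hQ).2
  have hrad : ∀ {P : Ideal (𝓞 K)} {j : ℕ}, Prime P → j ≠ 0 → (P ^ j).radical = P := fun hP hj => by
    rw [Ideal.radical_pow _ hj, (isPrime_of_prime hP).radical]
  have hinj : Set.InjOn (Ideal.radical : Ideal (𝓞 K) → _) F := by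
    intro Q hQ Q' hQ' h
    obtain ⟨P, hP, -, j, hj, rfl⟩ := hmemF Q hQ
    obtain ⟨P', hP', -, j', hj', rfl⟩ := hmemF Q' hQ'
    rw [hrad hP hj, hrad hP' hj'] at h
    subst h
    have h1 := mem_idealsOfNorm.1 (Finset.mem_filter.1 hQ).1
    have h2 := mem_idealsOfNorm.1 (Finset.mem_filter.1 hQ').1
    rw [map_pow] at h1 h2
    obtain ⟨q, g, hg, hqP, hq, hNq⟩ := key P hP
    have : 1 < absNorm P := hNq ▸ Nat.one_lt_pow hg.ne' hq.one_lt
    rw [Nat.pow_right_injective this (h1.trans h2.symm)]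
  have hprod : ∏ P ∈ F.image Ideal.radical, P ∣ span {(p : 𝓞 K)} := by
    refine Finset.prod_primes_dvd _ ?_ ?_
    · intro P hP
      obtain ⟨Q, hQ, rfl⟩ := Finset.mem_image.1 hP
      obtain ⟨P, hPp, -, j, hj, rfl⟩ := hmemF Q hQ
      rwa [hrad hPp hj]
    · intro P hP
      obtain ⟨Q, hQ, rfl⟩ := Finset.mem_image.1 hP
      obtain ⟨P, hPp, hpP, j, hj, rfl⟩ := hmemF Q hQ
      rwa [hrad hPp hj, dvd_span_singleton]
  have h1 : normVonMangoldt K (p ^ (f * k)) =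
      Real.log (absNorm (∏ P ∈ F.image Ideal.radical, P)) := by
    rw [Finset.prod_image hinj, map_prod, Nat.cast_prod, Real.log_prod, normVonMangoldt, hF,
      Finset.sum_filter]
    · rfl
    · intro Q hQ
      obtain ⟨P, hP, -, j, hj, rfl⟩ := hmemF Q hQ
      rw [hrad hP hj]
      simpa [absNorm_eq_zero_iff] using hP.ne_zero
  have h2 := map_dvd absNorm hprod
  rw [absNorm_span_natCast] at h2
  have hpos : 0 < p ^ Module.finrank ℤ (𝓞 K) := pow_pos hp.pos _
  rw [h1, ← Real.log_pow]
  refine Real.log_le_log ?_ (by exact_mod_cast Nat.le_of_dvd hpos h2)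
  exact_mod_cast Nat.pos_of_dvd_of_pos h2 hpos

variable (K) in
theorem hasLogDeriv_idealCount :
    HasLogDeriv (idealCount K) (normVonMangoldt K) (Module.finrank ℤ (𝓞 K)) where
  map_one := by
    have : idealsOfNorm K 1 = {⊤} := by
      ext I
      simp [absNorm_eq_one_iff]
    simp [idealCount, this]
  nonneg n := Finset.sum_nonneg fun Q _ => idealVonMangoldt_nonneg Q
  le_vonMangoldt := normVonMangoldt_le
  mul_log := idealCount_mul_log

theorem normVonMangoldt_prime {p : ℕ} (hp : p.Prime) :
    normVonMangoldt K p = idealCount K p * Real.log p := by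
  rw [normVonMangoldt, idealCount, if_neg hp.ne_zero, ← nsmul_eq_mul, ← Finset.sum_const]
  refine Finset.sum_congr rfl fun Q hQ => ?_
  rw [mem_idealsOfNorm] at hQ
  have hirr : Irreducible Q := irreducible_of_irreducible_absNorm (hQ ▸ hp)
  have := idealVonMangoldt_pow (UniqueFactorizationMonoid.irreducible_iff_prime.1 hirr) one_ne_zero
  rw [pow_one, hQ] at this
  exact this

end IdealCount

section LatticeCount

open MeasureTheory
open scoped Pointwise

variable {E : Type*} [NormedAddCommGroup E] [NormedSpace ℝ E] [FiniteDimensional ℝ E]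
  [MeasurableSpace E] [BorelSpace E]

/-- The number of lattice points of a set is squeezed between the normalized volumes of sets which
it contains, respectively is contained in, with a margin depending only on the lattice. -/
theorem exists_margin_lattice_count (L : Submodule ℤ E) [DiscreteTopology L] [IsZLattice ℝ L]
    (μ : Measure E) [μ.IsAddHaarMeasure] :
    ∃ r : ℝ, 0 < r ∧ ∀ S S₁ S₂ : Set E, μ S₂ ≠ ⊤ →
      (∀ x ∈ S₁, ∀ y, ‖y - x‖ ≤ r → y ∈ S) → (∀ x ∈ S, ∀ y, ‖y - x‖ ≤ r → y ∈ S₂) →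
      (S ∩ L).Finite ∧ μ.real S₁ ≤ (S ∩ L).ncard * ZLattice.covolume L μ ∧
        (S ∩ L).ncard * ZLattice.covolume L μ ≤ μ.real S₂ := by
  classical
  have : Module.Free ℤ L := ZLattice.module_free ℝ L
  have : Module.Finite ℤ L := ZLattice.module_finite ℝ L
  have : VAddInvariantMeasure L E μ :=
    inferInstanceAs <| VAddInvariantMeasure L.toAddSubgroup E μ
  let b := Module.Free.chooseBasis ℤ L
  set F := ZSpan.fundamentalDomain (b.ofZLatticeBasis ℝ L) with hF
  have hfund : IsAddFundamentalDomain L F μ := ZLattice.isAddFundamentalDomain b μ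
  have hcov : ZLattice.covolume L μ = μ.real F := ZLattice.covolume_eq_measure_fundamentalDomain L μ hfund
  have hcpos : 0 < μ.real F := hcov ▸ ZLattice.covolume_pos L μ
  have hmeas : MeasurableSet F := ZSpan.fundamentalDomain_measurableSet _
  have hFbdd : Bornology.IsBounded F := ZSpan.fundamentalDomain_isBounded _
  have hFfin : μ F ≠ ⊤ := hFbdd.measure_lt_top.ne
  obtain ⟨r, hr0, hr⟩ := hFbdd.exists_pos_norm_le
  have hcell : ∀ T : Finset L, μ.real (⋃ z ∈ T, (z : L) +ᵥ F) = T.card * μ.real F := by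
    intro T
    rw [measureReal_def, measure_biUnion_finset₀ (fun x _ y _ hxy => hfund.aedisjoint hxy)
      (fun z _ => (hmeas.const_vadd z).nullMeasurableSet)]
    simp [measure_vadd, measureReal_def]
  have hexists : ∀ x : E, ∃ z : L, ∃ f ∈ F, x = z + f := by
    intro x
    obtain ⟨v, hv, -⟩ := ZSpan.exist_unique_vadd_mem_fundamentalDomain (b.ofZLatticeBasis ℝ L) x
    have hvL : (v : E) ∈ L := (b.ofZLatticeBasis_span ℝ).le v.2
    refine ⟨-⟨v, hvL⟩, _, hv, ?_⟩
    rw [Submodule.vadd_def, vadd_eq_add]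
    simp
  refine ⟨r, hr0, fun S S₁ S₂ hS₂ h₁ h₂ => ?_⟩
  have hup : ∀ T : Finset L, (∀ z ∈ T, (z : E) ∈ S) → T.card * μ.real F ≤ μ.real S₂ := by
    intro T hT
    rw [← hcell T]
    refine measureReal_mono ?_ hS₂
    refine Set.iUnion₂_subset fun z hz => ?_
    rintro _ ⟨f, hf, rfl⟩
    refine h₂ z (hT z hz) _ ?_
    simpa [Submodule.vadd_def] using hr f hf
  have hfin : (S ∩ L).Finite := by
    have : {z : L | (z : E) ∈ S}.Finite := by
      by_contra hinf
      obtain ⟨n, hn⟩ := exists_nat_gt (μ.real S₂ / μ.real F)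
      obtain ⟨T, hT, hTc⟩ := Set.Infinite.exists_subset_card_eq hinf n
      have := hup T fun z hz => hT hz
      rw [div_lt_iff₀ hcpos] at hn
      rw [hTc] at this
      linarith
    refine (this.image ((↑) : L → E)).subset ?_
    rintro x ⟨hx, hxL⟩
    exact ⟨⟨x, hxL⟩, hx, rfl⟩
  let T : Finset L := (hfin.preimage (Subtype.val_injective.injOn (s := _))).toFinset
  have hT : ∀ z : L, z ∈ T ↔ (z : E) ∈ S := by simp [T]
  have hcard : (S ∩ L).ncard = T.card := by
    rw [← Set.ncard_coe_finset, ← Set.ncard_image_of_injective _ Subtype.val_injective]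
    congr 1
    ext x
    simp [hT, and_comm]
  rw [hcov, hcard]
  refine ⟨hfin, ?_, hup T fun z hz => (hT z).1 hz⟩
  rw [← hcell T]
  refine measureReal_mono ?_ ?_
  · intro x hx
    obtain ⟨z, f, hf, rfl⟩ := hexists x
    refine Set.mem_iUnion₂.2 ⟨z, (hT z).2 (h₁ _ hx _ ?_), ⟨f, hf, rfl⟩⟩
    simpa using hr f hf
  · refine ((measure_biUnion_lt_top T.finite_toSet fun z _ => ?_)).ne
    rw [measure_vadd]
    exact hFfin.lt_top

end LatticeCount

section ConeShell

open MeasureTheory NumberField.InfinitePlace NumberField.mixedEmbedding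
  NumberField.mixedEmbedding.fundamentalCone NumberField.Units
  NumberField.Units.dirichletUnitTheorem Module

variable (K : Type*) [Field K] [NumberField K]

open scoped Classical in
/-- The box of logarithmic coordinates of the elements of the fundamental cone whose norm lies in
`(2⁻ᵈ, 1]`, where `d` is the degree, enlarged by `η` in each direction. -/
def logBox (η : ℝ) : Set (realSpace K) :=
  Set.univ.pi fun w => if w = w₀ then Set.Ioc (-Real.log 2 - η) η else Set.Ico (-η) (1 + η)

/-- The subset of the mixed space described by `logBox`. -/
def coneShell (η : ℝ) : Set (mixedSpace K) :=
  normAtAllPlaces ⁻¹' (expMapBasis '' logBox K η)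

variable {K}

theorem mem_logBox {η : ℝ} {p : realSpace K} :
    p ∈ logBox K η ↔ p w₀ ∈ Set.Ioc (-Real.log 2 - η) η ∧
      ∀ w, w ≠ w₀ → p w ∈ Set.Ico (-η) (1 + η) := by
  classical
  rw [logBox, Set.mem_univ_pi]
  refine ⟨fun h => ⟨by simpa using h w₀, fun w hw => by simpa [hw] using h w⟩, fun h w => ?_⟩
  by_cases hw : w = w₀
  · subst hw
    simpa using h.1
  · simpa [hw] using h.2 w hw

theorem mem_logBox_add {a b : ℝ} {p q : realSpace K} (hp : p ∈ logBox K a)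
    (h : ∀ w, |q w - p w| ≤ b) : q ∈ logBox K (a + b) := by
  rw [mem_logBox] at hp ⊢
  refine ⟨?_, fun w hw => ?_⟩
  · have h1 := abs_le.1 (h w₀)
    have h2 := hp.1
    rw [Set.mem_Ioc] at h2 ⊢
    constructor <;> linarith
  · have h1 := abs_le.1 (h w)
    have h2 := hp.2 w hw
    rw [Set.mem_Ico] at h2 ⊢
    constructor <;> linarith

theorem logBox_mono {a b : ℝ} (h : a ≤ b) : logBox K a ⊆ logBox K b := by
  intro p hp
  have := mem_logBox_add (q := p) (b := b - a) hp fun w => by simpa using h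
  simpa using this

theorem measurableSet_logBox (η : ℝ) : MeasurableSet (logBox K η) := by
  classical
  refine MeasurableSet.univ_pi fun w => ?_
  split_ifs
  · exact measurableSet_Ioc
  · exact measurableSet_Ico

variable (K) in
open scoped Classical in
theorem volume_logBox {η : ℝ} (hη : -(1 / 4) ≤ η) :
    volume (logBox K η) =
      ENNReal.ofReal (∏ w : InfinitePlace K, ((if w = w₀ then Real.log 2 else 1) + 2 * η)) := by
  have hlog := Real.log_two_gt_d9
  rw [logBox, volume_pi_pi, ENNReal.ofReal_prod_of_nonneg]
  · refine Finset.prod_congr rfl fun w _ => ?_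
    split_ifs
    · rw [Real.volume_Ioc]
      congr 1
      ring
    · rw [Real.volume_Ico]
      congr 1
      ring
  · intro w _
    split_ifs <;> linarith

variable (K) in
open scoped Classical in
/-- The factor relating volumes in the mixed space to weighted volumes in logarithmic
coordinates. -/
theorem exists_volume_preimage_expMapBasis_image :
    ∃ A : ENNReal, A ≠ 0 ∧ A ≠ ⊤ ∧ ∀ P : Set (realSpace K), MeasurableSet P →
      volume (normAtAllPlaces ⁻¹' (expMapBasis '' P) : Set (mixedSpace K)) =
        A * ∫⁻ x in P, ENNReal.ofReal (Real.exp (x w₀ * Module.finrank ℚ K)) := by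
  refine ⟨2 ^ nrRealPlaces K * ENNReal.ofReal (2 * Real.pi) ^ nrComplexPlaces K *
    ((2 : ENNReal)⁻¹ ^ nrComplexPlaces K * ENNReal.ofReal (regulator K) *
      (Module.finrank ℚ K : ENNReal)), ?_, ?_, fun P hP => ?_⟩
  · have h1 : ENNReal.ofReal (regulator K) ≠ 0 := by simpa using regulator_pos K
    have h2 : (Module.finrank ℚ K : ENNReal) ≠ 0 := by
      exact_mod_cast (Module.finrank_pos (R := ℚ) (M := K)).ne'
    have h3 : ENNReal.ofReal (2 * Real.pi) ≠ 0 := by simp [Real.pi_pos]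
    have h4 : (2 : ENNReal)⁻¹ ≠ 0 := by simp
    simp [h1, h2, h4, Real.pi_pos]
  · exact ENNReal.mul_ne_top (ENNReal.mul_ne_top (ENNReal.pow_ne_top (by simp))
      (ENNReal.pow_ne_top ENNReal.ofReal_ne_top)) (ENNReal.mul_ne_top (ENNReal.mul_ne_top
        (ENNReal.pow_ne_top (by simp)) (by simp)) (by simp))
  · have hm : MeasurableSet (normAtAllPlaces ⁻¹' (expMapBasis '' P) : Set (mixedSpace K)) :=
      (MeasurableSet.image_of_continuousOn_injOn hP (continuous_expMapBasis K).continuousOn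
        (injective_expMapBasis K).injOn).preimage (continuous_normAtAllPlaces K).measurable
    rw [volume_eq_two_pow_mul_two_pi_pow_mul_integral Set.preimage_image_preimage hm,
      normAtAllPlaces_image_preimage_expMapBasis,
      setLIntegral_expMapBasis_image hP (by fun_prop), ← mul_assoc]
    congr 1
    refine setLIntegral_congr_fun hP fun x _ => ?_
    rw [mul_assoc, ENNReal.inv_mul_cancel, mul_one]
    · exact Finset.prod_ne_zero_iff.mpr fun _ _ => ENNReal.ofReal_ne_zero_iff.mpr (expMapBasis_pos _ _)
    · exact ENNReal.prod_ne_top fun _ _ => ENNReal.ofReal_ne_top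

variable (K) in
open scoped Classical in
theorem exists_volume_coneShell_sub_le :
    ∃ C : ℝ, 0 < C ∧ 0 < volume.real (coneShell K 0) ∧
      (∀ a, a ≤ 1 → volume (coneShell K a) ≠ ⊤) ∧
      ∀ a b, -(1 / 4) ≤ a → a ≤ b → b ≤ 1 →
        volume.real (coneShell K b) ≤ volume.real (coneShell K a) + C * (b - a) := by
  obtain ⟨A, hA0, hA, hvol⟩ := exists_volume_preimage_expMapBasis_image K
  set d := Module.finrank ℚ K
  set g : ℝ → ℝ := fun η => ∏ w : InfinitePlace K, ((if w = w₀ then Real.log 2 else 1) + 2 * η)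
    with hg
  have hlog := Real.log_two_gt_d9
  have hg0 : ∀ η, -(1 / 4) ≤ η → 0 < g η := by
    intro η hη
    refine Finset.prod_pos fun w _ => ?_
    split_ifs <;> linarith
  have hbox : ∀ P : Set (realSpace K), MeasurableSet P → P ⊆ logBox K 1 →
      ∫⁻ x in P, ENNReal.ofReal (Real.exp (x w₀ * d)) ≤ ENNReal.ofReal (Real.exp d) * volume P := by
    intro P hP hP1
    rw [← setLIntegral_const]
    refine setLIntegral_mono' hP fun x hx => ?_
    refine ENNReal.ofReal_le_ofReal (Real.exp_le_exp.2 ?_)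
    have := (mem_logBox.1 (hP1 hx)).1.2
    exact mul_le_of_le_one_left (Nat.cast_nonneg _) this
  have hfin : ∀ P : Set (realSpace K), MeasurableSet P → P ⊆ logBox K 1 →
      volume (normAtAllPlaces ⁻¹' (expMapBasis '' P) : Set (mixedSpace K)) ≤
        A * (ENNReal.ofReal (Real.exp d) * volume P) := by
    intro P hP hP1
    rw [hvol P hP]
    gcongr
    exact hbox P hP hP1
  have hbox1 : volume (logBox K 1) ≠ ⊤ := by
    rw [volume_logBox K (by norm_num)]
    exact ENNReal.ofReal_ne_top
  have hnt : ∀ P : Set (realSpace K), P ⊆ logBox K 1 → volume P ≠ ⊤ := fun P hP =>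
    ne_top_of_le_ne_top hbox1 (measure_mono hP)
  obtain ⟨M, hM⟩ : ∃ M : NNReal, LipschitzOnWith M g (Set.Icc (-(1 / 4)) 1) := by
    have hcd : ContDiff ℝ 1 g := by
      rw [hg]
      refine contDiff_prod fun w _ => ?_
      fun_prop
    exact (hcd.contDiffOn (s := Set.Icc (-(1 / 4)) 1)).exists_lipschitzOnWith one_ne_zero
      (convex_Icc _ _) isCompact_Icc
  have hshellfin : ∀ a, a ≤ 1 → volume (coneShell K a) ≠ ⊤ := fun a ha =>
    ne_top_of_le_ne_top (ENNReal.mul_ne_top hA (ENNReal.mul_ne_top ENNReal.ofReal_ne_top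
      (hnt _ (logBox_mono ha)))) (hfin _ (measurableSet_logBox a) (logBox_mono ha))
  refine ⟨A.toReal * (Real.exp d * M) + 1, by positivity, ?_, hshellfin, fun a b ha hab hb => ?_⟩
  · rw [measureReal_def, ENNReal.toReal_pos_iff]
    refine ⟨?_, (hshellfin 0 zero_le_one).lt_top⟩
    rw [coneShell, hvol _ (measurableSet_logBox 0)]
    refine ENNReal.mul_pos hA0 (ne_of_gt ?_)
    rw [setLIntegral_pos_iff (by fun_prop)]
    have : Function.support (fun x : realSpace K =>
        ENNReal.ofReal (Real.exp (x w₀ * d))) = Set.univ := by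
      ext x
      simp [Real.exp_pos]
    rw [this, Set.univ_inter, volume_logBox K (by norm_num)]
    exact ENNReal.ofReal_pos.2 (hg0 0 (by norm_num))
  · have hsub : coneShell K b ⊆ coneShell K a ∪
        normAtAllPlaces ⁻¹' (expMapBasis '' (logBox K b \ logBox K a)) := by
      rintro x ⟨p, hp, hpx⟩
      by_cases hpa : p ∈ logBox K a
      · exact Or.inl ⟨p, hpa, hpx⟩
      · exact Or.inr ⟨p, ⟨hp, hpa⟩, hpx⟩
    have hd1 : logBox K b \ logBox K a ⊆ logBox K 1 := Set.sdiff_subset.trans (logBox_mono hb)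
    have h1 := hfin _ ((measurableSet_logBox b).diff (measurableSet_logBox a)) hd1
    have h2 : (volume (logBox K b \ logBox K a)).toReal ≤ M * (b - a) := by
      rw [measure_sdiff (logBox_mono hab) (measurableSet_logBox a).nullMeasurableSet
        (hnt _ (logBox_mono (hab.trans hb))), volume_logBox K ha, volume_logBox K (ha.trans hab),
        ← ENNReal.ofReal_sub _ (hg0 a ha).le, ENNReal.toReal_ofReal']
      have h3 := hM.dist_le_mul b ⟨ha.trans hab, hb⟩ a ⟨ha, hab.trans hb⟩
      rw [Real.dist_eq, Real.dist_eq, abs_of_nonneg (sub_nonneg.2 hab)] at h3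
      exact max_le ((le_abs_self _).trans h3) (mul_nonneg M.2 (sub_nonneg.2 hab))
    have h4 : volume.real (normAtAllPlaces ⁻¹' (expMapBasis '' (logBox K b \ logBox K a)) :
        Set (mixedSpace K)) ≤ A.toReal * (Real.exp d * (M * (b - a))) := by
      have := ENNReal.toReal_mono (ENNReal.mul_ne_top hA
        (ENNReal.mul_ne_top ENNReal.ofReal_ne_top (hnt _ hd1))) h1
      rw [ENNReal.toReal_mul, ENNReal.toReal_mul, ENNReal.toReal_ofReal (Real.exp_pos _).le] at this
      refine this.trans ?_
      gcongr
    have h5 := measureReal_union_le (μ := volume) (coneShell K a)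
      (normAtAllPlaces ⁻¹' (expMapBasis '' (logBox K b \ logBox K a)) : Set (mixedSpace K))
    have h6 : volume.real (coneShell K b) ≤ _ := measureReal_mono hsub
      (measure_union_ne_top (hshellfin a (hab.trans hb)) (ne_top_of_le_ne_top
        (ENNReal.mul_ne_top hA (ENNReal.mul_ne_top ENNReal.ofReal_ne_top (hnt _ hd1))) h1))
    have : 0 ≤ b - a := sub_nonneg.2 hab
    nlinarith

end ConeShell

section ConeShellLipschitz

open NumberField.InfinitePlace NumberField.mixedEmbedding
  NumberField.mixedEmbedding.fundamentalCone NumberField.Units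
  NumberField.Units.dirichletUnitTheorem Module

variable {K : Type*} [Field K] [NumberField K]

open scoped Classical in
theorem abs_normAtPlace_sub_le (w : InfinitePlace K) (x y : mixedSpace K) :
    |normAtPlace w y - normAtPlace w x| ≤ ‖y - x‖ := by
  have hle : ∀ z : mixedSpace K, normAtPlace w z ≤ ‖z‖ := fun z => by
    rw [norm_eq_sup'_normAtPlace]
    exact Finset.le_sup' (fun w => normAtPlace w z) (Finset.mem_univ w)
  rw [abs_sub_le_iff]
  constructor
  · have := normAtPlace_add_le w (y - x) x
    rw [sub_add_cancel] at this
    linarith [hle (y - x)]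
  · have := normAtPlace_add_le w (x - y) y
    rw [sub_add_cancel] at this
    linarith [hle (x - y), norm_sub_rev x y]

theorem mem_preimage_expMapBasis_image {P : Set (realSpace K)} {y : mixedSpace K}
    (hy : ∀ w, 0 < normAtPlace w y)
    (h : (completeBasis K).equivFunL (fun w => w.mult * Real.log (normAtPlace w y)) ∈ P) :
    y ∈ (normAtAllPlaces ⁻¹' (expMapBasis '' P) : Set (mixedSpace K)) := by
  refine ⟨_, h, ?_⟩
  change expMap ((completeBasis K).equivFunL.symm _) = _
  rw [ContinuousLinearEquiv.symm_apply_apply]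
  ext w
  rw [expMap_apply, inv_mul_cancel_left₀ mult_coe_ne_zero, Real.exp_log (hy w),
    normAtAllPlaces_apply]

theorem equivFunL_of_expMapBasis_eq {p : realSpace K} {x : mixedSpace K}
    (h : expMapBasis p = normAtAllPlaces x) :
    (completeBasis K).equivFunL (fun w => w.mult * Real.log (normAtPlace w x)) = p := by
  have : (fun w : InfinitePlace K => (w.mult : ℝ) * Real.log (normAtPlace w x)) =
      (completeBasis K).equivFunL.symm p := by
    ext w
    rw [← normAtAllPlaces_apply, ← h]
    change _ * Real.log (expMap ((completeBasis K).equivFunL.symm p) w) = _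
    rw [expMap_apply, Real.log_exp, mul_inv_cancel_left₀ mult_coe_ne_zero]
  rw [this, ContinuousLinearEquiv.apply_symm_apply]

theorem abs_log_sub_log_le {m a b : ℝ} (hm : 0 < m) (ha : m ≤ a) (hb : m ≤ b) :
    |Real.log b - Real.log a| ≤ |b - a| / m := by
  have key : ∀ a b : ℝ, m ≤ a → m ≤ b → Real.log b - Real.log a ≤ |b - a| / m := by
    intro a b ha hb
    have ha0 : 0 < a := hm.trans_le ha
    have hb0 : 0 < b := hm.trans_le hb
    rw [← Real.log_div hb0.ne' ha0.ne']
    calc Real.log (b / a) ≤ b / a - 1 := Real.log_le_sub_one_of_pos (by positivity)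
      _ = (b - a) / a := by field_simp
      _ ≤ |b - a| / a := by gcongr; exact le_abs_self _
      _ ≤ |b - a| / m := by gcongr
  rw [abs_sub_le_iff]
  refine ⟨key a b ha hb, ?_⟩
  rw [abs_sub_comm]
  exact key b a hb ha

variable (K) in
theorem exists_expMapBasis_lower_bound :
    ∃ m : ℝ, 0 < m ∧ ∀ p ∈ logBox K 1, ∀ w, m ≤ expMapBasis p w := by
  have hlog := Real.log_two_lt_d9
  have hQ : IsCompact (Set.univ.pi fun _ : InfinitePlace K => Set.Icc (-2 : ℝ) 2) :=
    isCompact_univ_pi fun _ => isCompact_Icc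
  have hne : (Set.univ.pi fun _ : InfinitePlace K => Set.Icc (-2 : ℝ) 2).Nonempty :=
    Set.univ_pi_nonempty_iff.2 fun _ => ⟨0, by norm_num⟩
  have hsub : ∀ p ∈ logBox K 1, p ∈ Set.univ.pi fun _ : InfinitePlace K => Set.Icc (-2 : ℝ) 2 := by
    intro p hp w _
    rw [mem_logBox] at hp
    by_cases hw : w = w₀
    · have := hp.1
      rw [Set.mem_Ioc] at this
      rw [hw, Set.mem_Icc]
      constructor <;> linarith
    · have := hp.2 w hw
      rw [Set.mem_Ico] at this
      rw [Set.mem_Icc]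
      constructor <;> linarith
  have hw : ∀ w : InfinitePlace K, ∃ m : ℝ, 0 < m ∧ ∀ p ∈ logBox K 1, m ≤ expMapBasis p w := by
    intro w
    obtain ⟨q, -, hq⟩ := hQ.exists_isMinOn hne
      (((continuous_apply w).comp (continuous_expMapBasis K)).continuousOn)
    exact ⟨_, expMapBasis_pos q w, fun p hp => hq (hsub p hp)⟩
  choose m hm0 hm using hw
  refine ⟨Finset.univ.inf' Finset.univ_nonempty m, ?_, fun p hp w => ?_⟩
  · rw [Finset.lt_inf'_iff]
    exact fun w _ => hm0 w
  · exact (Finset.inf'_le _ (Finset.mem_univ w)).trans (hm w p hp)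

variable (K) in
open scoped Classical in
theorem exists_mem_coneShell_of_norm_sub_le :
    ∃ c δ₀ : ℝ, 0 < c ∧ 0 < δ₀ ∧ ∀ δ ≤ δ₀, ∀ a ≤ 1, ∀ x ∈ coneShell K a, ∀ y,
      ‖y - x‖ ≤ δ → y ∈ coneShell K (a + c * δ) := by
  obtain ⟨m, hm0, hm⟩ := exists_expMapBasis_lower_bound K
  set T := ((completeBasis K).equivFunL : realSpace K →L[ℝ] realSpace K) with hT
  have hmult : ∀ w : InfinitePlace K, (w.mult : ℝ) ≤ 2 := by
    intro w
    rw [mult]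
    split_ifs <;> norm_num
  refine ⟨(‖T‖ + 1) * (2 * (2 / m)), m / 2, by positivity, by positivity,
    fun δ hδ a ha x hx y hxy => ?_⟩
  obtain ⟨p, hp, hpx⟩ := hx
  have hxm : ∀ w, m ≤ normAtPlace w x := fun w => by
    rw [← normAtAllPlaces_apply, ← hpx]
    exact hm p (logBox_mono ha hp) w
  have hyx : ∀ w, |normAtPlace w y - normAtPlace w x| ≤ δ := fun w =>
    (abs_normAtPlace_sub_le w x y).trans hxy
  have hym : ∀ w, m / 2 ≤ normAtPlace w y := fun w => by
    have := (abs_le.1 (hyx w)).1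
    linarith [hxm w]
  refine mem_preimage_expMapBasis_image (fun w => (by positivity : 0 < m / 2).trans_le (hym w))
    (mem_logBox_add hp fun w => ?_)
  rw [← equivFunL_of_expMapBasis_eq hpx, ← Pi.sub_apply, ← map_sub]
  have h1 : ∀ z : realSpace K, |(completeBasis K).equivFunL z w| ≤ ‖T‖ * ‖z‖ := fun z =>
    (norm_le_pi_norm (T z) w).trans (T.le_opNorm z)
  refine (h1 _).trans ?_
  rw [mul_assoc]
  have hδ0 : 0 ≤ δ := (norm_nonneg _).trans hxy
  refine mul_le_mul (by linarith) ?_ (norm_nonneg _) (by positivity)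
  rw [pi_norm_le_iff_of_nonneg (by positivity)]
  intro v
  rw [Pi.sub_apply, ← mul_sub, norm_mul, Real.norm_of_nonneg (Nat.cast_nonneg _), Real.norm_eq_abs,
    mul_assoc]
  refine mul_le_mul (hmult v) ?_ (abs_nonneg _) zero_le_two
  refine (abs_log_sub_log_le (by positivity : 0 < m / 2) (by linarith [hxm v]) (hym v)).trans ?_
  rw [div_le_iff₀ (by positivity)]
  have : 2 / m * δ * (m / 2) = δ := by field_simp
  rw [this]
  exact hyx v

theorem mem_coneShell_zero_iff {x : mixedSpace K} :
    x ∈ coneShell K 0 ↔ x ∈ fundamentalCone K ∧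
      (1 / 2 : ℝ) ^ Module.finrank ℚ K < mixedEmbedding.norm x ∧ mixedEmbedding.norm x ≤ 1 := by
  have hnorm : ∀ p : realSpace K, expMapBasis p = normAtAllPlaces x →
      mixedEmbedding.norm x = Real.exp (p w₀) ^ Module.finrank ℚ K := by
    intro p hp
    rw [← norm_expMapBasis, hp, norm_normAtAllPlaces]
  have hexp : ∀ t : ℝ, (1 / 2 : ℝ) ^ Module.finrank ℚ K < Real.exp t ^ Module.finrank ℚ K ↔
      -Real.log 2 < t := by
    intro t
    rw [pow_lt_pow_iff_left₀ (by norm_num) (Real.exp_pos _).le Module.finrank_pos.ne',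
      ← Real.log_lt_iff_lt_exp (by norm_num), one_div, Real.log_inv]
  have hcone : x ∈ fundamentalCone K ∧ mixedEmbedding.norm x ≤ 1 ↔
      x ∈ normAtAllPlaces ⁻¹' (expMapBasis '' paramSet K) := by
    rw [← normLeOne_eq_preimage, mem_normLeOne]
  have hbox : ∀ p : realSpace K, p ∈ logBox K 0 ↔ p ∈ paramSet K ∧ -Real.log 2 < p w₀ := by
    classical
    intro p
    rw [mem_logBox, Set.mem_univ_pi]
    refine ⟨fun h => ⟨fun w => ?_, by simpa using h.1.1⟩, fun h => ⟨⟨by simpa using h.2,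
      by simpa using h.1 w₀⟩, fun w hw => by simpa [hw] using h.1 w⟩⟩
    by_cases hw : w = w₀
    · subst hw
      simpa using h.1.2
    · simpa [hw] using h.2 w hw
  constructor
  · rintro ⟨p, hp, hpx⟩
    have h := hcone.2 ⟨p, ((hbox p).1 hp).1, hpx⟩
    exact ⟨h.1, by rw [hnorm p hpx, hexp]; exact ((hbox p).1 hp).2, h.2⟩
  · rintro ⟨h1, h2, h3⟩
    obtain ⟨p, hp, hpx⟩ := hcone.1 ⟨h1, h3⟩
    rw [hnorm p hpx, hexp] at h2
    exact ⟨p, (hbox p).2 ⟨hp, h2⟩, hpx⟩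

end ConeShellLipschitz

section ShellCount

open MeasureTheory NumberField.InfinitePlace NumberField.mixedEmbedding
  NumberField.mixedEmbedding.fundamentalCone NumberField.Units
  NumberField.Units.dirichletUnitTheorem Module
open scoped Pointwise nonZeroDivisors

variable (K : Type*) [Field K] [NumberField K]

variable {K} in
theorem mem_smul_coneShell_zero_iff {t : ℝ} (ht : 0 < t) {x : mixedSpace K} :
    x ∈ t • coneShell K 0 ↔ x ∈ fundamentalCone K ∧
      (t / 2) ^ Module.finrank ℚ K < mixedEmbedding.norm x ∧
        mixedEmbedding.norm x ≤ t ^ Module.finrank ℚ K := by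
  rw [Set.mem_smul_set_iff_inv_smul_mem₀ ht.ne', mem_coneShell_zero_iff,
    smul_mem_iff_mem (inv_ne_zero ht.ne'), mixedEmbedding.norm_smul, abs_of_pos (inv_pos.2 ht),
    inv_pow, inv_mul_le_iff₀ (by positivity), mul_one, lt_inv_mul_iff₀ (by positivity), ← mul_pow,
    mul_one_div]

theorem finite_idealSet_norm_le (J : (Ideal (𝓞 K))⁰) (s : ℝ) :
    {x | x ∈ idealSet K J ∧ mixedEmbedding.norm x ≤ s}.Finite := by
  classical
  obtain ⟨r, hr0, hr⟩ := exists_margin_lattice_count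
    (mixedEmbedding.idealLattice K (FractionalIdeal.mk0 K J)) (volume : Measure (mixedSpace K))
  set T : ℝ := max s 1 with hT
  have hT1 : 1 ≤ T := le_max_right _ _
  obtain ⟨R, hR0, hR⟩ := (isBounded_normLeOne K).exists_pos_norm_le
  have h := (hr {x | x ∈ fundamentalCone K ∧ mixedEmbedding.norm x ≤ s} ∅
    (Metric.closedBall 0 (T * R + r)) measure_closedBall_lt_top.ne (by simp) ?_).1
  · refine h.subset ?_
    rintro x ⟨⟨hx, hxL⟩, hxs⟩
    exact ⟨⟨hx, hxs⟩, hxL⟩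
  · rintro x ⟨hx, hxs⟩ y hyx
    rw [mem_closedBall_zero_iff]
    have hmem : T⁻¹ • x ∈ normLeOne K := by
      rw [mem_normLeOne, smul_mem_iff_mem (by positivity), mixedEmbedding.norm_smul,
        abs_of_pos (by positivity), inv_pow, inv_mul_le_iff₀ (by positivity), mul_one]
      refine ⟨hx, hxs.trans ((le_max_left s 1).trans ?_)⟩
      exact le_self_pow₀ hT1 Module.finrank_pos.ne'
    have h1 := hR _ hmem
    rw [_root_.norm_smul, norm_inv, Real.norm_of_nonneg (by positivity),
      inv_mul_le_iff₀ (by positivity)] at h1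
    have h2 := norm_add_le x (y - x)
    rw [add_sub_cancel] at h2
    linarith

/-- The number of points of an ideal lattice lying in the fundamental cone, with norm between
`(t / 2)ᵈ` and `tᵈ`. -/
theorem exists_idealSet_shell_count (J : (Ideal (𝓞 K))⁰) :
    ∃ κ C t₀ : ℝ, 0 < κ ∧ 0 < C ∧ 1 ≤ t₀ ∧ ∀ t, t₀ ≤ t →
      |({x | x ∈ idealSet K J ∧ (t / 2) ^ Module.finrank ℚ K < mixedEmbedding.norm x ∧
          mixedEmbedding.norm x ≤ t ^ Module.finrank ℚ K}.ncard : ℝ) -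
        κ * t ^ Module.finrank ℚ K| ≤ C * t ^ (Module.finrank ℚ K - 1) := by
  classical
  set Λ := mixedEmbedding.idealLattice K (FractionalIdeal.mk0 K J) with hΛ
  set d := Module.finrank ℚ K with hd
  have hd0 : 0 < d := Module.finrank_pos
  obtain ⟨r, hr0, hr⟩ := exists_margin_lattice_count Λ (volume : Measure (mixedSpace K))
  obtain ⟨C, hC, hv, hfin, hC2⟩ := exists_volume_coneShell_sub_le K
  obtain ⟨c, δ₀, hc, hδ₀, hlip⟩ := exists_mem_coneShell_of_norm_sub_le K
  set v := volume.real (coneShell K 0) with hvdef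
  set V := ZLattice.covolume Λ (volume : Measure (mixedSpace K)) with hV
  have hV0 : 0 < V := ZLattice.covolume_pos Λ volume
  refine ⟨v / V, C * (c * r) / V, max 1 (max (r / δ₀) (4 * (c * r))), by positivity,
    by positivity, le_max_left _ _, fun t ht => ?_⟩
  have ht1 : 1 ≤ t := (le_max_left _ _).trans ht
  have ht2 : r / δ₀ ≤ t := (le_max_left _ _).trans ((le_max_right _ _).trans ht)
  have ht3 : 4 * (c * r) ≤ t := (le_max_right _ _).trans ((le_max_right _ _).trans ht)
  have ht0 : 0 < t := by linarith
  have hset : {x | x ∈ idealSet K J ∧ (t / 2) ^ d < mixedEmbedding.norm x ∧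
      mixedEmbedding.norm x ≤ t ^ d} = t • coneShell K 0 ∩ (Λ : Set (mixedSpace K)) := by
    ext x
    rw [Set.mem_inter_iff, mem_smul_coneShell_zero_iff ht0, idealSet]
    simp only [Set.mem_ofPred_eq, Set.mem_inter_iff]
    tauto
  rw [hset]
  set η := c * (r / t) with hη
  have hδ : r / t ≤ δ₀ := by
    rw [div_le_iff₀ hδ₀] at ht2
    rw [div_le_iff₀ ht0]
    linarith
  have hη0 : 0 ≤ η := by positivity
  have hη1 : η ≤ 1 / 4 := by
    rw [hη, ← mul_div_assoc, div_le_iff₀ ht0]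
    linarith
  have hmove : ∀ a ≤ 1, ∀ x ∈ t • coneShell K a, ∀ y, ‖y - x‖ ≤ r → y ∈ t • coneShell K (a + η) := by
    intro a ha x hx y hyx
    rw [Set.mem_smul_set_iff_inv_smul_mem₀ ht0.ne'] at hx ⊢
    refine hlip (r / t) hδ a ha _ hx _ ?_
    rw [← smul_sub, _root_.norm_smul, norm_inv, Real.norm_of_nonneg ht0.le, inv_mul_eq_div]
    gcongr
  have hscale : ∀ s : Set (mixedSpace K), volume.real (t • s) = t ^ d * volume.real s := by
    intro s
    rw [measureReal_def, Measure.addHaar_smul, mixedEmbedding.finrank, ENNReal.toReal_mul,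
      ENNReal.toReal_ofReal (abs_nonneg _), abs_of_pos (by positivity), measureReal_def]
  obtain ⟨-, h1, h2⟩ := hr (t • coneShell K 0) (t • coneShell K (-η)) (t • coneShell K η) (by
      rw [Measure.addHaar_smul]
      exact ENNReal.mul_ne_top ENNReal.ofReal_ne_top (hfin _ (by linarith)))
    (by simpa using hmove (-η) (by linarith)) (by simpa using hmove 0 zero_le_one)
  rw [hscale] at h1 h2
  have h3 := hC2 0 η (by norm_num) hη0 (by linarith)
  have h4 := hC2 (-η) 0 (by linarith) (by linarith) (by linarith)
  rw [← hvdef] at h3 h4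
  have hpow : t ^ d * η = (c * r) * t ^ (d - 1) := by
    obtain ⟨e, he⟩ := Nat.exists_eq_succ_of_ne_zero hd0.ne'
    rw [he, Nat.succ_eq_add_one, Nat.add_sub_cancel, hη, pow_succ]
    field_simp
  have htd : 0 < t ^ d := by positivity
  have h5 := mul_le_mul_of_nonneg_left h3 htd.le
  have h6 := mul_le_mul_of_nonneg_left h4 htd.le
  set N : ℝ := ((t • coneShell K 0 ∩ (Λ : Set (mixedSpace K))).ncard : ℝ) with hN
  have hE : C * (c * r) * t ^ (d - 1) = t ^ d * (C * η) := by
    rw [mul_assoc, ← hpow]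
    ring
  have habs : N - v / V * t ^ d = (N * V - v * t ^ d) / V := by
    field_simp
  rw [habs, abs_div, abs_of_pos hV0, div_mul_eq_mul_div, hE]
  gcongr
  rw [abs_le]
  constructor <;> linarith

end ShellCount

section IdealCountPowerSaving

theorem exists_power_saving_of_dyadic {f : ℝ → ℝ} (hf : Monotone f) (hf0 : ∀ s, 0 ≤ f s) {d : ℕ}
    (hd : 0 < d) {κ C t₀ : ℝ} (hκ : 0 ≤ κ) (hC : 0 ≤ C) (ht₀ : 1 ≤ t₀)
    (h : ∀ t, t₀ ≤ t → |f (t ^ d) - f ((t / 2) ^ d) - κ * t ^ d| ≤ C * t ^ (d - 1)) :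
    ∃ C' : ℝ, 0 ≤ C' ∧ ∀ x, 1 ≤ x →
      |f x - κ / (1 - (1 / 2) ^ d) * x| ≤ C' * x ^ (1 - 1 / (2 * (d : ℝ))) := by
  have hd1 : (1 : ℝ) ≤ d := by exact_mod_cast hd
  have hhalf : ((1 : ℝ) / 2) ^ d ≤ 1 / 2 := pow_le_of_le_one (by norm_num) (by norm_num) hd.ne'
  have hden : 0 < 1 - ((1 : ℝ) / 2) ^ d := by linarith
  set ρ := κ / (1 - (1 / 2) ^ d) with hρ
  have hρ0 : 0 ≤ ρ := by positivity
  have hρκ : ρ * (1 - (1 / 2) ^ d) = κ := div_mul_cancel₀ _ hden.ne'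
  set e : ℝ := d - 1 / 2 with he
  have he0 : 0 < e := by linarith
  set M := f (t₀ ^ d) + ρ * t₀ ^ d with hM
  have hM0 : 0 ≤ M := add_nonneg (hf0 _) (by positivity)
  have hsmall : ∀ t, 0 ≤ t → t ≤ t₀ → |f (t ^ d) - ρ * t ^ d| ≤ M := by
    intro t h0 h1
    have h2 : t ^ d ≤ t₀ ^ d := by gcongr
    have h3 := hf h2
    have h4 := hf0 (t ^ d)
    have h5 : ρ * t ^ d ≤ ρ * t₀ ^ d := by gcongr
    have h6 : 0 ≤ ρ * t ^ d := by positivity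
    have h7 := hf0 (t₀ ^ d)
    rw [abs_le]
    constructor <;> linarith
  have htwo : (2 : ℝ) ^ (-e) ≤ 3 / 4 := by
    calc (2 : ℝ) ^ (-e) ≤ 2 ^ (-(1 / 2) : ℝ) :=
          Real.rpow_le_rpow_of_exponent_le one_le_two (by linarith)
      _ = (√2)⁻¹ := by rw [Real.rpow_neg zero_le_two, ← Real.sqrt_eq_rpow]
      _ ≤ 3 / 4 := by
          rw [inv_le_comm₀ (by positivity) (by norm_num)]
          exact Real.le_sqrt_of_sq_le (by norm_num)
  have key : ∀ n : ℕ, ∀ t, 0 ≤ t → t ≤ 2 ^ n * t₀ →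
      |f (t ^ d) - ρ * t ^ d| ≤ M + 4 * C * t ^ e := by
    intro n
    induction n with
    | zero =>
      intro t h0 h1
      have := hsmall t h0 (by simpa using h1)
      have : 0 ≤ 4 * C * t ^ e := by positivity
      linarith
    | succ n ih =>
      intro t h0 h1
      by_cases hle : t ≤ t₀
      · have := hsmall t h0 hle
        have : 0 ≤ 4 * C * t ^ e := by positivity
        linarith
      rw [not_le] at hle
      have ht1 : 1 ≤ t := ht₀.trans hle.le
      have h2 := ih (t / 2) (by positivity) (by rw [pow_succ] at h1; linarith)
      have h3 := h t hle.le
      have h4 : f (t ^ d) - ρ * t ^ d = (f ((t / 2) ^ d) - ρ * (t / 2) ^ d) +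
          (f (t ^ d) - f ((t / 2) ^ d) - κ * t ^ d) := by
        rw [← hρκ, div_pow, div_pow, one_pow]
        ring
      have h5 : (t / 2) ^ e ≤ 3 / 4 * t ^ e := by
        rw [Real.div_rpow h0 zero_le_two, div_eq_mul_inv, ← Real.rpow_neg zero_le_two, mul_comm]
        gcongr
      have h6 : t ^ (d - 1) ≤ t ^ e := by
        rw [← Real.rpow_natCast, Nat.cast_sub hd, Nat.cast_one]
        exact Real.rpow_le_rpow_of_exponent_le ht1 (by linarith)
      have h7 : C * t ^ (d - 1) ≤ C * t ^ e := by gcongr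
      have h8 : C * (t / 2) ^ e ≤ C * (3 / 4 * t ^ e) := by gcongr
      rw [h4]
      refine (abs_add_le _ _).trans ?_
      linarith
  refine ⟨M + 4 * C, by positivity, fun x hx => ?_⟩
  have hx0 : 0 ≤ x := by linarith
  set t := x ^ ((d : ℝ)⁻¹) with ht
  have htd : t ^ d = x := Real.rpow_inv_natCast_pow hx0 hd.ne'
  have hte : t ^ e = x ^ (1 - 1 / (2 * (d : ℝ))) := by
    rw [ht, ← Real.rpow_mul hx0]
    congr 1
    field_simp
    rw [he]
    ring
  obtain ⟨n, hn⟩ := pow_unbounded_of_one_lt t (one_lt_two (α := ℝ))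
  have h1 := key n t (by positivity) (by nlinarith [pow_pos (two_pos (α := ℝ)) n])
  rw [htd, hte] at h1
  have h2 : 1 ≤ x ^ (1 - 1 / (2 * (d : ℝ))) := by
    refine Real.one_le_rpow hx (sub_nonneg.2 ?_)
    rw [div_le_one (by positivity)]
    linarith
  nlinarith

open NumberField.InfinitePlace NumberField.mixedEmbedding Ideal
  NumberField.mixedEmbedding.fundamentalCone NumberField.Units
open scoped nonZeroDivisors

variable (K : Type*) [Field K] [NumberField K]

theorem card_class_mul_torsionOrder {C : ClassGroup (𝓞 K)} {J : (Ideal (𝓞 K))⁰}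
    (hJ : ClassGroup.mk0 J = C⁻¹) (s : ℝ) :
    Nat.card {I : (Ideal (𝓞 K))⁰ // absNorm (I : Ideal (𝓞 K)) ≤ s ∧ ClassGroup.mk0 I = C} *
      torsionOrder K = {x | x ∈ idealSet K J ∧
        mixedEmbedding.norm x ≤ s * absNorm (J : Ideal (𝓞 K))}.ncard := by
  have h : Nat.card {I : (Ideal (𝓞 K))⁰ // absNorm (I : Ideal (𝓞 K)) ≤ s ∧ ClassGroup.mk0 I = C} =
      Nat.card {I : (Ideal (𝓞 K))⁰ // (J : Ideal (𝓞 K)) ∣ I ∧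
        Submodule.IsPrincipal (I : Ideal (𝓞 K)) ∧
        absNorm (I : Ideal (𝓞 K)) ≤ s * absNorm (J : Ideal (𝓞 K))} := by
    simp_rw [← nonZeroDivisors_dvd_iff_dvd_coe]
    refine Nat.card_congr ?_
    refine ((Equiv.dvd J).subtypeEquiv fun I ↦ ?_).trans
      (Equiv.subtypeSubtypeEquivSubtypeInter (fun I : (Ideal (𝓞 K))⁰ ↦ J ∣ I) _)
    rw [← ClassGroup.mk0_eq_one_iff (SetLike.coe_mem _)]
    simp_rw [Equiv.dvd_apply, Submonoid.coe_mul, ← Submonoid.mul_def, _root_.map_mul, hJ,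
      inv_mul_eq_one, Nat.cast_mul, mul_comm s, eq_comm, and_comm, and_congr_left_iff]
    exact fun _ ↦
      (mul_le_mul_iff_of_pos_left (Nat.cast_pos.mpr (absNorm_pos_of_nonZeroDivisors J))).symm
  rw [h, card_isPrincipal_dvd_norm_le, ← Nat.card_coe_set_eq]
  exact Nat.card_congr (Equiv.subtypeSubtypeEquivSubtypeInter (· ∈ idealSet K J)
    fun x => mixedEmbedding.norm x ≤ s * absNorm (J : Ideal (𝓞 K)))

theorem finite_absNorm_le_real (s : ℝ) :
    {I : (Ideal (𝓞 K))⁰ | (absNorm (I : Ideal (𝓞 K)) : ℝ) ≤ s}.Finite := by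
  refine (finite_setOfPred_absNorm_le₀ ⌊s⌋₊).subset fun I hI => ?_
  exact Nat.le_floor hI

theorem exists_class_count_power_saving (C : ClassGroup (𝓞 K)) :
    ∃ ρ B : ℝ, 0 < ρ ∧ 0 ≤ B ∧ ∀ x : ℝ, 1 ≤ x →
      |(Nat.card {I : (Ideal (𝓞 K))⁰ // absNorm (I : Ideal (𝓞 K)) ≤ x ∧ ClassGroup.mk0 I = C} : ℝ) -
        ρ * x| ≤ B * x ^ (1 - 1 / (2 * (Module.finrank ℚ K : ℝ))) := by
  obtain ⟨J, hJ⟩ := ClassGroup.mk0_surjective C⁻¹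
  obtain ⟨κ, B, t₀, hκ, hB, ht₀, h⟩ := exists_idealSet_shell_count K J
  set d := Module.finrank ℚ K with hd
  have hd0 : 0 < d := Module.finrank_pos
  set w : ℝ := ((torsionOrder K : ℕ) : ℝ) with hw
  have hw0 : 0 < w := Nat.cast_pos.2 (Nat.pos_of_ne_zero (torsionOrder_ne_zero K))
  set q : ℝ := ((absNorm (J : Ideal (𝓞 K)) : ℕ) : ℝ) with hq
  have hq1 : 1 ≤ q := Nat.one_le_cast.2 (absNorm_pos_of_nonZeroDivisors J)
  set f : ℝ → ℝ := fun s => (Nat.card {I : (Ideal (𝓞 K))⁰ //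
    absNorm (I : Ideal (𝓞 K)) ≤ s ∧ ClassGroup.mk0 I = C} : ℝ) with hf
  have hmono : Monotone f := by
    intro s₁ s₂ hs
    rw [hf]
    simp only [Nat.cast_le]
    exact Nat.card_mono (s := {I : (Ideal (𝓞 K))⁰ | (absNorm (I : Ideal (𝓞 K)) : ℝ) ≤ s₁ ∧
        ClassGroup.mk0 I = C})
      ((finite_absNorm_le_real K s₂).subset fun I hI => hI.1) fun I hI => ⟨hI.1.trans hs, hI.2⟩
  have hfw : ∀ s, f s * w = ({x | x ∈ idealSet K J ∧ mixedEmbedding.norm x ≤ s * q}.ncard : ℝ) :=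
    fun s => by
      rw [← card_class_mul_torsionOrder K hJ s, Nat.cast_mul]
  set r : ℝ := q ^ ((d : ℝ)⁻¹) with hr
  have hrd : r ^ d = q := Real.rpow_inv_natCast_pow (by linarith) hd0.ne'
  have hr1 : 1 ≤ r := Real.one_le_rpow hq1 (by positivity)
  obtain ⟨B', hB', hB2⟩ := exists_power_saving_of_dyadic (f := f) hmono
    (fun s => Nat.cast_nonneg _) hd0 (κ := κ * q / w) (C := B * r ^ (d - 1) / w) (t₀ := t₀)
    (by positivity) (by positivity) ht₀ (fun t ht => by
      have ht0 : 0 < t := by linarith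
      have h1 := h (t * r) (by nlinarith)
      have h2 : ({x | x ∈ idealSet K J ∧ (t * r / 2) ^ d < mixedEmbedding.norm x ∧
          mixedEmbedding.norm x ≤ (t * r) ^ d}.ncard : ℝ) = f (t ^ d) * w - f ((t / 2) ^ d) * w := by
        rw [hfw, hfw, ← hrd, ← mul_pow, ← mul_pow, div_mul_eq_mul_div, eq_sub_iff_add_eq]
        rw [← Nat.cast_add, ← Set.ncard_union_eq _
          ((finite_idealSet_norm_le K J ((t * r) ^ d)).subset fun x hx => ⟨hx.1, hx.2.2⟩)
          (finite_idealSet_norm_le K J _)]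
        · congr 2
          ext x
          simp only [Set.mem_union, Set.mem_ofPred_eq]
          have h3 : (t * r / 2) ^ d ≤ (t * r) ^ d := by
            gcongr
            linarith [mul_pos ht0 (by linarith : 0 < r)]
          constructor
          · rintro (⟨hx, -, h5⟩ | ⟨hx, h5⟩)
            · exact ⟨hx, h5⟩
            · exact ⟨hx, h5.trans h3⟩
          · rintro ⟨hx, h5⟩
            rcases lt_or_ge ((t * r / 2) ^ d) (mixedEmbedding.norm x) with h6 | h6
            · exact Or.inl ⟨hx, h6, h5⟩
            · exact Or.inr ⟨hx, h6⟩
        · rw [Set.disjoint_left]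
          rintro x ⟨-, h5, -⟩ ⟨-, h6⟩
          exact absurd h6 (not_le.2 h5)
      rw [h2, mul_pow, mul_pow, hrd] at h1
      have h3 : f (t ^ d) - f ((t / 2) ^ d) - κ * q / w * t ^ d =
          (f (t ^ d) * w - f ((t / 2) ^ d) * w - κ * (t ^ d * q)) / w := by
        field_simp
      rw [h3, abs_div, abs_of_pos hw0, div_mul_eq_mul_div]
      gcongr
      linarith)
  have hhalf : ((1 : ℝ) / 2) ^ d ≤ 1 / 2 := pow_le_of_le_one (by norm_num) (by norm_num) hd0.ne'
  have hden : 0 < 1 - ((1 : ℝ) / 2) ^ d := by linarith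
  exact ⟨_, B', by positivity, hB', hB2⟩

theorem sum_idealCount_eq_sum_class (x : ℝ) :
    ∑ n ∈ Finset.Icc 1 ⌊x⌋₊, idealCount K n = ∑ C : ClassGroup (𝓞 K),
      (Nat.card {I : (Ideal (𝓞 K))⁰ // absNorm (I : Ideal (𝓞 K)) ≤ x ∧ ClassGroup.mk0 I = C} :
        ℝ) := by
  classical
  have : Fintype {I : (Ideal (𝓞 K))⁰ // (absNorm (I : Ideal (𝓞 K)) : ℝ) ≤ x} :=
    (finite_absNorm_le_real K x).fintype
  have h1 : ∑ n ∈ Finset.Icc 1 ⌊x⌋₊, idealCount K n =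
      (((Finset.Icc 1 ⌊x⌋₊).biUnion (idealsOfNorm K)).card : ℝ) := by
    rw [Finset.card_biUnion, Nat.cast_sum]
    · refine Finset.sum_congr rfl fun n hn => ?_
      rw [idealCount, if_neg (Nat.one_le_iff_ne_zero.1 (Finset.mem_Icc.1 hn).1)]
    · intro m _ n _ hmn
      rw [Function.onFun, Finset.disjoint_left]
      intro I hI hI'
      exact hmn ((mem_idealsOfNorm.1 hI).symm.trans (mem_idealsOfNorm.1 hI'))
  have h2 : ((Finset.Icc 1 ⌊x⌋₊).biUnion (idealsOfNorm K)).card =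
      Fintype.card {I : (Ideal (𝓞 K))⁰ // (absNorm (I : Ideal (𝓞 K)) : ℝ) ≤ x} := by
    rw [← Finset.card_univ]
    symm
    refine Finset.card_bij (fun I _ => ((I : (Ideal (𝓞 K))⁰) : Ideal (𝓞 K))) ?_ ?_ ?_
    · intro I _
      rw [Finset.mem_biUnion]
      refine ⟨absNorm ((I : (Ideal (𝓞 K))⁰) : Ideal (𝓞 K)), ?_, mem_idealsOfNorm.2 rfl⟩
      exact Finset.mem_Icc.2 ⟨absNorm_pos_of_nonZeroDivisors _, Nat.le_floor I.2⟩
    · intro I _ I' _ h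
      exact Subtype.ext (Subtype.ext h)
    · intro I hI
      rw [Finset.mem_biUnion] at hI
      obtain ⟨n, hn, hI⟩ := hI
      rw [mem_idealsOfNorm] at hI
      rw [Finset.mem_Icc] at hn
      have hne : absNorm I ≠ 0 := by lia
      have hx : (absNorm I : ℝ) ≤ x := (Nat.le_floor_iff' hne).1 (hI ▸ hn.2)
      refine ⟨⟨⟨I, mem_nonZeroDivisors_of_ne_zero fun h0 => hne ?_⟩, hx⟩, Finset.mem_univ _, rfl⟩
      rw [h0, Submodule.zero_eq_bot, absNorm_bot]
  rw [h1, h2]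
  let e := fun C : ClassGroup (𝓞 K) ↦ Equiv.subtypeSubtypeEquivSubtypeInter
      (fun I : (Ideal (𝓞 K))⁰ ↦ (absNorm I.1 : ℝ) ≤ x) (fun I ↦ ClassGroup.mk0 I = C)
  simp_rw [← Nat.card_congr (e _), Nat.card_eq_fintype_card, Fintype.subtype_card]
  rw [Fintype.card, Finset.card_eq_sum_card_fiberwise (f := fun I ↦ ClassGroup.mk0 I.1)
      (t := Finset.univ) (fun _ _ ↦ Finset.mem_univ _), Nat.cast_sum]

/-- Weber's theorem: the number of ideals of bounded norm, with a power saving error term. -/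
theorem exists_hasPowerSaving_idealCount :
    ∃ ρ δ B : ℝ, HasPowerSaving (idealCount K) ρ δ B := by
  choose ρ B hρ hB h using exists_class_count_power_saving K
  have hd1 : (1 : ℝ) ≤ Module.finrank ℚ K := by exact_mod_cast Module.finrank_pos (R := ℚ) (M := K)
  refine ⟨∑ C, ρ C, 1 / (2 * (Module.finrank ℚ K : ℝ)), ∑ C, B C, by simp [idealCount], fun n => ?_,
    Finset.sum_pos (fun C _ => hρ C) Finset.univ_nonempty, by positivity, ?_, fun t ht => ?_⟩
  · rw [idealCount]
    positivity
  · rw [div_le_one (by positivity)]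
    linarith
  · rw [sum_idealCount_eq_sum_class, Finset.sum_mul, ← Finset.sum_sub_distrib, Finset.sum_mul]
    exact (Finset.abs_sum_le_sum_abs _ _).trans (Finset.sum_le_sum fun C _ => h C t ht)

theorem sum_prime_idealCount_isBigO :
    (fun x : ℝ => ∑ p ∈ Finset.Ioc 0 ⌊x⌋₊ with p.Prime, idealCount K p - x / Real.log x) =O[atTop]
      fun x => x / Real.log x ^ 2 := by
  obtain ⟨ρ, δ, B, h⟩ := exists_hasPowerSaving_idealCount K
  exact (hasLogDeriv_idealCount K).sum_prime_isBigO h fun p hp => normVonMangoldt_prime hp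

end IdealCountPowerSaving

section ResidueHoms
open Ideal

variable {K : Type*} [Field K] [NumberField K] {p : ℕ}

theorem absNorm_ker_ringHom (φ : 𝓞 K →+* ZMod p) : absNorm (RingHom.ker φ) = p := by
  rw [absNorm_apply, Submodule.cardQuot_apply,
    Nat.card_congr (RingHom.quotientKerEquivOfSurjective (ZMod.ringHom_surjective φ)).toEquiv,
    Nat.card_zmod]

theorem exists_ringHom_ker_eq (hp : p.Prime) {I : Ideal (𝓞 K)} (hI : absNorm I = p) :
    ∃ φ : 𝓞 K →+* ZMod p, RingHom.ker φ = I := by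
  rw [absNorm_apply, Submodule.cardQuot_apply] at hI
  have : Finite (𝓞 K ⧸ I) := Nat.finite_of_card_ne_zero (hI ▸ hp.ne_zero)
  have := Fintype.ofFinite (𝓞 K ⧸ I)
  rw [Nat.card_eq_fintype_card] at hI
  refine ⟨((ZMod.ringEquivOfPrime (𝓞 K ⧸ I) hp hI).symm : 𝓞 K ⧸ I →+* ZMod p).comp
    (Ideal.Quotient.mk I), ?_⟩
  rw [RingHom.ker_comp_of_injective _ (RingEquiv.injective _), Ideal.mk_ker]

theorem bijective_ker_ringHom (hp : p.Prime) :
    Function.Bijective (fun φ : 𝓞 K →+* ZMod p =>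
      (⟨RingHom.ker φ, mem_idealsOfNorm.2 (absNorm_ker_ringHom φ)⟩ : idealsOfNorm K p)) := by
  refine ⟨fun φ ψ h => ZMod.ringHom_eq_of_ker_eq φ ψ (Subtype.ext_iff.1 h), fun I => ?_⟩
  obtain ⟨φ, hφ⟩ := exists_ringHom_ker_eq hp (mem_idealsOfNorm.1 I.2)
  exact ⟨φ, Subtype.ext hφ⟩

theorem finite_ringHom_zmod (hp : p.Prime) : Finite (𝓞 K →+* ZMod p) :=
  Finite.of_injective _ (bijective_ker_ringHom hp).1

theorem idealCount_prime_eq_card (hp : p.Prime) :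
    idealCount K p = Nat.card (𝓞 K →+* ZMod p) := by
  rw [idealCount, if_neg hp.ne_zero, Nat.card_congr (Equiv.ofBijective _ (bijective_ker_ringHom hp)),
    Nat.card_eq_fintype_card, Fintype.card_coe]

theorem isMaximal_ker_ringHom_zmod (hp : p.Prime) (φ : 𝓞 K →+* ZMod p) :
    (RingHom.ker φ).IsMaximal :=
  have : Fact p.Prime := ⟨hp⟩
  RingHom.ker_isMaximal_of_surjective φ (ZMod.ringHom_surjective φ)

/-- An ideal of norm `p²` is a product of two distinct primes if and only if it is contained in two
distinct ideals of norm `p`. -/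
theorem eq_mul_of_absNorm_eq_sq (hp : p.Prime) {I : Ideal (𝓞 K)} (hI : absNorm I = p ^ 2)
    {φ ψ : 𝓞 K →+* ZMod p} (hne : φ ≠ ψ) (hφ : I ≤ RingHom.ker φ) (hψ : I ≤ RingHom.ker ψ) :
    RingHom.ker φ ≠ RingHom.ker ψ ∧ I = RingHom.ker φ * RingHom.ker ψ := by
  have hker : RingHom.ker φ ≠ RingHom.ker ψ := fun h => hne (ZMod.ringHom_eq_of_ker_eq φ ψ h)
  refine ⟨hker, ?_⟩
  have h1 := isMaximal_ker_ringHom_zmod hp φ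
  have h2 := isMaximal_ker_ringHom_zmod hp ψ
  have hcop : IsCoprime (RingHom.ker φ) (RingHom.ker ψ) :=
    Ideal.isCoprime_iff_sup_eq.2 (h1.coprime_of_ne h2 hker)
  have hdvd : RingHom.ker φ * RingHom.ker ψ ∣ I :=
    hcop.mul_dvd (Ideal.dvd_iff_le.2 hφ) (Ideal.dvd_iff_le.2 hψ)
  obtain ⟨J, hJ⟩ := hdvd
  have hn : absNorm J = 1 := by
    have h := congrArg absNorm hJ
    rw [map_mul, map_mul, absNorm_ker_ringHom, absNorm_ker_ringHom, hI, ← sq] at h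
    exact Nat.eq_of_mul_eq_mul_left (pow_pos hp.pos 2) (by rw [← h, mul_one])
  rw [absNorm_eq_one_iff.1 hn, Ideal.mul_top] at hJ
  exact hJ

theorem exists_ringHom_of_eq_mul (hp : p.Prime) {I P Q : Ideal (𝓞 K)} (hI : absNorm I = p ^ 2)
    (hP : P.IsPrime) (hQ : Q.IsPrime) (h : I = P * Q) :
    ∃ φ ψ : 𝓞 K →+* ZMod p, RingHom.ker φ = P ∧ RingHom.ker ψ = Q := by
  have hn : absNorm P * absNorm Q = p ^ 2 := by rw [← map_mul, ← h, hI]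
  have hP1 : absNorm P ≠ 1 := fun h1 => hP.ne_top (absNorm_eq_one_iff.1 h1)
  have hQ1 : absNorm Q ≠ 1 := fun h1 => hQ.ne_top (absNorm_eq_one_iff.1 h1)
  obtain ⟨h1, h2⟩ := (hp.mul_eq_prime_sq_iff hP1 hQ1).1 hn
  obtain ⟨φ, hφ⟩ := exists_ringHom_ker_eq hp h1
  obtain ⟨ψ, hψ⟩ := exists_ringHom_ker_eq hp h2
  exact ⟨φ, ψ, hφ, hψ⟩

theorem absNorm_span_natCast_of_finrank_eq_two (hK : Module.finrank ℚ K = 2) :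
    absNorm (span {(p : 𝓞 K)}) = p ^ 2 := by
  rw [absNorm_span_natCast, RingOfIntegers.rank, hK]

theorem span_natCast_le_ker (φ : 𝓞 K →+* ZMod p) : span {(p : 𝓞 K)} ≤ RingHom.ker φ := by
  rw [Ideal.span_singleton_le_iff_mem, RingHom.mem_ker, map_natCast, ZMod.natCast_self]

/-- If `p` splits in the quadratic field `K`, every prime above `p` is the kernel of a map to
`ZMod p`. -/
theorem exists_ker_eq_of_mem (hp : p.Prime) (hK : Module.finrank ℚ K = 2) {φ ψ : 𝓞 K →+* ZMod p}
    (hne : φ ≠ ψ) {P : Ideal (𝓞 K)} (hP : P.IsPrime) (hpP : (p : 𝓞 K) ∈ P) :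
    P = RingHom.ker φ ∨ P = RingHom.ker ψ := by
  have h := (eq_mul_of_absNorm_eq_sq hp (absNorm_span_natCast_of_finrank_eq_two hK) hne
    (span_natCast_le_ker φ) (span_natCast_le_ker ψ)).2
  have h1 : RingHom.ker φ * RingHom.ker ψ ≤ P := h ▸ (span_singleton_le_iff_mem _).2 hpP
  rcases hP.mul_le.1 h1 with h2 | h2
  · exact Or.inl ((isMaximal_ker_ringHom_zmod hp φ).eq_of_le hP.ne_top h2).symm
  · exact Or.inr ((isMaximal_ker_ringHom_zmod hp ψ).eq_of_le hP.ne_top h2).symm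

theorem ringHom_eq_or_eq (hp : p.Prime) (hK : Module.finrank ℚ K = 2) {φ ψ : 𝓞 K →+* ZMod p}
    (hne : φ ≠ ψ) (χ : 𝓞 K →+* ZMod p) : χ = φ ∨ χ = ψ :=
  (exists_ker_eq_of_mem hp hK hne (isMaximal_ker_ringHom_zmod hp χ).isPrime
    (span_natCast_le_ker χ (mem_span_singleton_self _))).imp
    (ZMod.ringHom_eq_of_ker_eq _ _) (ZMod.ringHom_eq_of_ker_eq _ _)

end ResidueHoms

section QuadraticExtension

variable {F E : Type*} [Field F] [Field E] [Algebra F E]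

theorem eq_zero_of_add_mul_eq_zero {β : E} (hβ : β ∉ Set.range (algebraMap F E)) {s t : F}
    (h : algebraMap F E s + algebraMap F E t * β = 0) : s = 0 ∧ t = 0 := by
  have ht : t = 0 := by
    by_contra ht
    refine hβ ⟨-(s / t), ?_⟩
    have ht' : algebraMap F E t ≠ 0 := (map_ne_zero _).2 ht
    rw [map_neg, map_div₀]
    field_simp
    linear_combination -h
  rw [ht, map_zero, zero_mul, add_zero] at h
  exact ⟨(map_eq_zero _).1 h, ht⟩

theorem linearIndependent_one_of_notMem_range {β : E} (hβ : β ∉ Set.range (algebraMap F E)) :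
    LinearIndependent F ![1, β] := by
  rw [LinearIndependent.pair_iff]
  intro s t h
  rw [Algebra.smul_def, Algebra.smul_def, mul_one] at h
  exact eq_zero_of_add_mul_eq_zero hβ h

/-- The basis `1, β` of a quadratic extension. -/
noncomputable def quadraticBasis (hE : Module.finrank F E = 2) {β : E}
    (hβ : β ∉ Set.range (algebraMap F E)) : Module.Basis (Fin 2) F E :=
  basisOfLinearIndependentOfCardEqFinrank (linearIndependent_one_of_notMem_range hβ)
    (by rw [Fintype.card_fin, hE])

theorem exists_eq_add_mul_of_finrank_eq_two (hE : Module.finrank F E = 2) {β : E}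
    (hβ : β ∉ Set.range (algebraMap F E)) (x : E) :
    ∃ a b : F, x = algebraMap F E a + algebraMap F E b * β := by
  have h := (quadraticBasis hE hβ).sum_repr x
  rw [Fin.sum_univ_two] at h
  simp only [quadraticBasis, coe_basisOfLinearIndependentOfCardEqFinrank, Matrix.cons_val_zero,
    Matrix.cons_val_one, Algebra.smul_def, mul_one] at h
  exact ⟨_, _, h.symm⟩

theorem trace_eq_zero_of_sq_mem (hE : Module.finrank F E = 2) {β : E}
    (hβ : β ∉ Set.range (algebraMap F E)) {a : F} (ha : β ^ 2 = algebraMap F E a) :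
    Algebra.trace F E β = 0 := by
  set b := quadraticBasis hE hβ with hb
  have h0 : b 0 = 1 := by simp [hb, quadraticBasis]
  have h1 : b 1 = β := by simp [hb, quadraticBasis]
  rw [Algebra.trace_eq_matrix_trace b, Matrix.trace_fin_two, Algebra.leftMulMatrix_eq_repr_mul,
    Algebra.leftMulMatrix_eq_repr_mul, h0, mul_one]
  have h2 : b.repr β 0 = 0 := by
    rw [← h1, b.repr_self]
    simp
  have h3 : β * b 1 = a • b 0 := by rw [h1, h0, ← sq, ha, Algebra.smul_def, mul_one]
  rw [h2, h3, map_smul, b.repr_self]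
  simp

/-- In characteristic zero, a quadratic extension is generated by a square root. -/
theorem exists_sq_mem_range_of_finrank_eq_two [CharZero F] (hE : Module.finrank F E = 2) :
    ∃ (β : E) (a : F), β ∉ Set.range (algebraMap F E) ∧ β ^ 2 = algebraMap F E a := by
  obtain ⟨x, hx⟩ : ∃ x : E, x ∉ Set.range (algebraMap F E) := by
    by_contra! h
    have hs : Function.Surjective (algebraMap F E) := h
    have := (Algebra.linearMap F E).finrank_le_finrank_of_surjective hs
    rw [hE, Module.finrank_self] at this
    lia
  obtain ⟨c, d, h⟩ := exists_eq_add_mul_of_finrank_eq_two hE hx (x ^ 2)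
  have : CharZero E := charZero_of_injective_algebraMap (algebraMap F E).injective
  refine ⟨x - algebraMap F E (d / 2), c + (d / 2) ^ 2, ?_, ?_⟩
  · rintro ⟨y, hy⟩
    exact hx ⟨y + d / 2, by rw [map_add, hy]; ring⟩
  · have hd : algebraMap F E d = 2 * algebraMap F E (d / 2) := by
      rw [← map_ofNat (algebraMap F E) 2, ← map_mul]
      congr 1
      ring
    rw [map_add, map_pow]
    rw [hd] at h
    linear_combination h

end QuadraticExtension

section QuadraticFibre

variable {k M : Type*} [Field k] [NumberField k] [Field M] [NumberField M] [Algebra k M]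

/-- `M` is a quadratic extension of `k` generated by the integral element `β` with `β² = α`. -/
structure IsQuadraticGenerator (α : 𝓞 k) (β : 𝓞 M) : Prop where
  finrank : Module.finrank k M = 2
  notMem : algebraMap (𝓞 M) M β ∉ Set.range (algebraMap k M)
  sq : β ^ 2 = algebraMap (𝓞 k) (𝓞 M) α

theorem algebraMap_algebraMap_ringOfIntegers (a : 𝓞 k) :
    algebraMap (𝓞 M) M (algebraMap (𝓞 k) (𝓞 M) a) = algebraMap k M (algebraMap (𝓞 k) k a) :=
  rfl

namespace IsQuadraticGenerator

variable {α : 𝓞 k} {β : 𝓞 M} (h : IsQuadraticGenerator α β)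
include h

theorem coe_sq : algebraMap (𝓞 M) M β ^ 2 = algebraMap k M (algebraMap (𝓞 k) k α) := by
  rw [← algebraMap_algebraMap_ringOfIntegers, ← h.sq, map_pow]

theorem eq_zero_of_add_eq_zero {a b : 𝓞 k}
    (hab : algebraMap (𝓞 k) (𝓞 M) a + algebraMap (𝓞 k) (𝓞 M) b * β = 0) : a = 0 ∧ b = 0 := by
  have h1 := congrArg (algebraMap (𝓞 M) M) hab
  rw [map_add, map_mul, map_zero, algebraMap_algebraMap_ringOfIntegers,
    algebraMap_algebraMap_ringOfIntegers] at h1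
  have h2 := eq_zero_of_add_mul_eq_zero h.notMem h1
  exact ⟨RingOfIntegers.coe_eq_zero_iff.1 h2.1, RingOfIntegers.coe_eq_zero_iff.1 h2.2⟩

theorem eq_of_add_eq_add {a b c d : 𝓞 k}
    (hab : algebraMap (𝓞 k) (𝓞 M) a + algebraMap (𝓞 k) (𝓞 M) b * β =
      algebraMap (𝓞 k) (𝓞 M) c + algebraMap (𝓞 k) (𝓞 M) d * β) : a = c ∧ b = d := by
  have := h.eq_zero_of_add_eq_zero (a := a - c) (b := b - d)
    (by rw [map_sub, map_sub]; linear_combination hab)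
  exact ⟨sub_eq_zero.1 this.1, sub_eq_zero.1 this.2⟩

theorem exists_two_mul_eq (x : 𝓞 M) : ∃ u t : 𝓞 k, 2 * β * x =
    algebraMap (𝓞 k) (𝓞 M) u + algebraMap (𝓞 k) (𝓞 M) t * β := by
  have tr : ∀ y : 𝓞 M, ∃ t : 𝓞 k,
      algebraMap (𝓞 k) k t = Algebra.trace k M (algebraMap (𝓞 M) M y) := fun y =>
    ⟨⟨_, Algebra.isIntegral_trace (RingOfIntegers.isIntegral_coe y)⟩, rfl⟩
  obtain ⟨a, b, hx⟩ := exists_eq_add_mul_of_finrank_eq_two h.finrank h.notMem (algebraMap (𝓞 M) M x)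
  have hβ0 := trace_eq_zero_of_sq_mem h.finrank h.notMem h.coe_sq
  obtain ⟨t, ht⟩ := tr x
  obtain ⟨u, hu⟩ := tr (x * β)
  have key : ∀ c d : k, Algebra.trace k M (algebraMap k M c + algebraMap k M d *
      algebraMap (𝓞 M) M β) = 2 * c := by
    intro c d
    rw [map_add, Algebra.trace_algebraMap, h.finrank, ← Algebra.smul_def, map_smul, hβ0, smul_zero,
      add_zero, two_nsmul, two_mul]
  have ht' : algebraMap (𝓞 k) k t = 2 * a := by rw [ht, hx, key]
  have hu' : algebraMap (𝓞 k) k u = 2 * (b * algebraMap (𝓞 k) k α) := by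
    rw [hu, ← key _ a]
    congr 1
    rw [map_mul, hx, map_mul, ← h.coe_sq]
    ring
  refine ⟨u, t, RingOfIntegers.coe_injective ?_⟩
  rw [map_mul, map_mul, map_add, map_mul, algebraMap_algebraMap_ringOfIntegers,
    algebraMap_algebraMap_ringOfIntegers, hx, ht', hu', map_mul, map_mul, map_mul, ← h.coe_sq,
    map_ofNat, map_ofNat]
  ring

variable {F : Type*} [Field F] {φ : 𝓞 k →+* F}

theorem ringHom_ext (h2 : (2 : F) ≠ 0) (hα : φ α ≠ 0) {ψ₁ ψ₂ : 𝓞 M →+* F}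
    (h₁ : ψ₁.comp (algebraMap (𝓞 k) (𝓞 M)) = φ) (h₂ : ψ₂.comp (algebraMap (𝓞 k) (𝓞 M)) = φ)
    (hβ : ψ₁ β = ψ₂ β) : ψ₁ = ψ₂ := by
  have hne : ψ₁ β ≠ 0 := by
    intro h0
    apply hα
    rw [← h₁, RingHom.comp_apply, ← h.sq, map_pow, h0, zero_pow two_ne_zero]
  ext x
  obtain ⟨u, t, hx⟩ := h.exists_two_mul_eq x
  have e₁ := congrArg ψ₁ hx
  have e₂ := congrArg ψ₂ hx
  simp only [map_mul, map_add, map_ofNat, ← RingHom.comp_apply, h₁, h₂, ← hβ] at e₁ e₂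
  rw [← e₂] at e₁
  exact mul_left_cancel₀ (mul_ne_zero h2 hne) e₁

theorem exists_ringHom (h2 : (2 : F) ≠ 0) (hα : φ α ≠ 0) {y : F} (hy : y ^ 2 = φ α) :
    ∃ ψ : 𝓞 M →+* F, ψ.comp (algebraMap (𝓞 k) (𝓞 M)) = φ ∧ ψ β = y := by
  have hy0 : y ≠ 0 := by
    rintro rfl
    exact hα (by rw [← hy, zero_pow two_ne_zero])
  choose u t hut using h.exists_two_mul_eq
  have uniq : ∀ {x : 𝓞 M} {a b : 𝓞 k}, 2 * β * x =
      algebraMap (𝓞 k) (𝓞 M) a + algebraMap (𝓞 k) (𝓞 M) b * β → u x = a ∧ t x = b :=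
    fun hx => h.eq_of_add_eq_add ((hut _).symm.trans hx)
  have hcoe : ∀ a : 𝓞 k, u (algebraMap (𝓞 k) (𝓞 M) a) = 0 ∧ t (algebraMap (𝓞 k) (𝓞 M) a) = 2 * a :=
    fun a => uniq (by rw [map_zero, map_mul, map_ofNat]; ring)
  have hadd : ∀ x z, u (x + z) = u x + u z ∧ t (x + z) = t x + t z := fun x z =>
    uniq (by rw [map_add, map_add]; linear_combination hut x + hut z)
  have hmul : ∀ x z, 2 * u (x * z) = t x * u z + t z * u x ∧
      2 * α * t (x * z) = α * t x * t z + u x * u z := by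
    intro x z
    have := h.eq_of_add_eq_add (a := 2 * α * t (x * z)) (b := 2 * u (x * z))
      (c := α * t x * t z + u x * u z) (d := t x * u z + t z * u x) (by
        simp only [map_mul, map_add, map_ofNat, ← h.sq]
        linear_combination (-2 * β) * hut (x * z) +
          (2 * β * z) * hut x + (algebraMap (𝓞 k) (𝓞 M) (u x) +
            algebraMap (𝓞 k) (𝓞 M) (t x) * β) * hut z)
    exact ⟨this.2, this.1⟩
  have hone := hcoe 1
  have hzero := hcoe 0
  have hβ : u β = 2 * α ∧ t β = 0 := uniq (by rw [map_zero, map_mul, map_ofNat, ← h.sq]; ring)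
  rw [map_one] at hone
  rw [map_zero] at hzero
  let ψ : 𝓞 M →+* F :=
    { toFun := fun x => (φ (t x) + φ (u x) / y) / 2
      map_one' := by rw [hone.1, hone.2, map_mul, map_zero, map_one, map_ofNat]; field_simp; ring
      map_zero' := by simp [hzero.1, hzero.2]
      map_add' := fun x z => by
        rw [(hadd x z).1, (hadd x z).2, map_add, map_add]
        ring
      map_mul' := fun x z => by
        have e1 := congrArg φ (hmul x z).1
        have e2 := congrArg φ (hmul x z).2
        simp only [map_mul, map_add, map_ofNat, ← hy] at e1 e2
        field_simp
        linear_combination y * e1 + e2 }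
  refine ⟨ψ, RingHom.ext fun a => ?_, ?_⟩
  · change (φ (t _) + φ (u _) / y) / 2 = φ a
    rw [(hcoe a).1, (hcoe a).2, map_mul, map_zero, map_ofNat]
    field_simp
    ring
  · change (φ (t _) + φ (u _) / y) / 2 = y
    rw [hβ.1, hβ.2, map_mul, map_zero, map_ofNat, ← hy]
    field_simp
    ring

end IsQuadraticGenerator
end QuadraticFibre

namespace IsQuadraticGenerator
open Ideal

variable {k M : Type*} [Field k] [NumberField k] [Field M] [NumberField M] [Algebra k M]
  {α : 𝓞 k} {β : 𝓞 M} (h : IsQuadraticGenerator α β) {p : ℕ} [Fact p.Prime] {φ : 𝓞 k →+* ZMod p}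
include h

/-- The maps to `ZMod p` extending `φ` correspond to the square roots of `φ α`. -/
noncomputable def fibreEquiv (hp2 : (2 : ZMod p) ≠ 0) (hα : φ α ≠ 0) :
    {ψ : 𝓞 M →+* ZMod p // ψ.comp (algebraMap (𝓞 k) (𝓞 M)) = φ} ≃ {y : ZMod p | y ^ 2 = φ α} :=
  Equiv.ofBijective
    (fun ψ => ⟨ψ.1 β, by
      rw [Set.mem_ofPred_eq, ← map_pow, h.sq, ← RingHom.comp_apply, ψ.2]⟩)
    ⟨fun ψ₁ ψ₂ hψ => Subtype.ext
        (h.ringHom_ext hp2 hα ψ₁.2 ψ₂.2 (Subtype.ext_iff.1 hψ)),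
      fun y => by
        obtain ⟨ψ, hψ, hy⟩ := h.exists_ringHom hp2 hα y.2
        exact ⟨⟨ψ, hψ⟩, Subtype.ext hy⟩⟩

theorem card_fibre (hp2 : (2 : ZMod p) ≠ 0) (hα : φ α ≠ 0) :
    (Nat.card {ψ : 𝓞 M →+* ZMod p // ψ.comp (algebraMap (𝓞 k) (𝓞 M)) = φ} : ℤ) =
      quadraticChar (ZMod p) (φ α) + 1 := by
  have hchar : ringChar (ZMod p) ≠ 2 := by
    intro hc
    exact hp2 (by exact_mod_cast (ringChar.spec (ZMod p) 2).2 (by rw [hc]))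
  rw [← quadraticChar_card_sqrts hchar, Nat.card_congr (h.fibreEquiv hp2 hα),
    Nat.card_eq_card_toFinset]

theorem idealCount_eq_sum [Fintype (𝓞 k →+* ZMod p)] (hp2 : (2 : ZMod p) ≠ 0)
    (hα : ∀ φ : 𝓞 k →+* ZMod p, φ α ≠ 0) :
    idealCount M p = ∑ φ : 𝓞 k →+* ZMod p, ((quadraticChar (ZMod p) (φ α) : ℝ) + 1) := by
  have hp : p.Prime := Fact.out
  have := finite_ringHom_zmod (K := M) hp
  rw [idealCount_prime_eq_card hp, ← Nat.card_congr (Equiv.sigmaFiberEquiv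
    fun ψ : 𝓞 M →+* ZMod p => ψ.comp (algebraMap (𝓞 k) (𝓞 M))), Nat.card_sigma, Nat.cast_sum]
  refine Finset.sum_congr rfl fun φ _ => ?_
  exact_mod_cast congrArg (Int.cast (R := ℝ)) (h.card_fibre hp2 (hα φ))

theorem absNorm_map_ker :
    absNorm ((RingHom.ker φ).map (algebraMap (𝓞 k) (𝓞 M))) = p ^ 2 := by
  rw [Ideal.absNorm_algebraMap, absNorm_ker_ringHom,
    ← IsFractionRing.finrank_eq (𝓞 k) k (𝓞 M) M, h.finrank]

theorem map_ker_eq_mul_iff (hp2 : (2 : ZMod p) ≠ 0) (hα : φ α ≠ 0) :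
    (∃ P Q : Ideal (𝓞 M), P ≠ Q ∧ P.IsPrime ∧ Q.IsPrime ∧
      (RingHom.ker φ).map (algebraMap (𝓞 k) (𝓞 M)) = P * Q) ↔
      quadraticChar (ZMod p) (φ α) = 1 := by
  have hp : p.Prime := Fact.out
  rw [quadraticChar_one_iff_isSquare hα]
  constructor
  · rintro ⟨P, Q, -, hP, hQ, h1⟩
    obtain ⟨ψ, -, hψ, -⟩ := exists_ringHom_of_eq_mul hp h.absNorm_map_ker hP hQ h1
    have h2 : RingHom.ker φ ≤ RingHom.ker (ψ.comp (algebraMap (𝓞 k) (𝓞 M))) := by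
      rw [← RingHom.comap_ker, ← Ideal.map_le_iff_le_comap, hψ, h1]
      exact Ideal.mul_le_left
    have h3 := (isMaximal_ker_ringHom_zmod hp φ).eq_of_le (RingHom.ker_ne_top _) h2
    rw [ZMod.ringHom_eq_of_ker_eq _ _ h3, RingHom.comp_apply, ← h.sq, map_pow]
    exact ⟨ψ β, pow_two _⟩
  · rintro ⟨y, hy⟩
    have hy0 : y ≠ 0 := by
      rintro rfl
      exact hα (by rw [hy, zero_mul])
    obtain ⟨ψ₁, h1, h1'⟩ := h.exists_ringHom hp2 hα (y := y) (by rw [pow_two, hy])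
    obtain ⟨ψ₂, h2, h2'⟩ := h.exists_ringHom hp2 hα (y := -y) (by rw [neg_sq, pow_two, hy])
    have hne : ψ₁ ≠ ψ₂ := by
      rintro rfl
      rw [h1'] at h2'
      apply mul_ne_zero hp2 hy0
      linear_combination h2'
    have hle : ∀ ψ : 𝓞 M →+* ZMod p, ψ.comp (algebraMap (𝓞 k) (𝓞 M)) = φ →
        (RingHom.ker φ).map (algebraMap (𝓞 k) (𝓞 M)) ≤ RingHom.ker ψ := by
      intro ψ hψ
      rw [Ideal.map_le_iff_le_comap, RingHom.comap_ker, hψ]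
    have h3 := eq_mul_of_absNorm_eq_sq hp h.absNorm_map_ker hne (hle _ h1) (hle _ h2)
    exact ⟨_, _, h3.1, (isMaximal_ker_ringHom_zmod hp _).isPrime,
      (isMaximal_ker_ringHom_zmod hp _).isPrime, h3.2⟩

end IsQuadraticGenerator

section CharacterSum

variable {k : Type*} [Field k] [NumberField k] {p : ℕ} [Fact p.Prime] [Fintype (𝓞 k →+* ZMod p)]

theorem sum_prod_one_sub_quadraticChar {κ : Type*} [Fintype κ] [DecidableEq κ] (a : κ → 𝓞 k) :
    ∑ φ : 𝓞 k →+* ZMod p, ∏ j, (1 - (quadraticChar (ZMod p) (φ (a j)) : ℝ)) =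
      Fintype.card (𝓞 k →+* ZMod p) + ∑ S ∈ (Finset.univ : Finset (Finset κ)).erase ∅, (-1) ^ S.card *
        (∑ φ : 𝓞 k →+* ZMod p, ((quadraticChar (ZMod p) (φ (∏ j ∈ S, a j)) : ℝ) + 1) -
          Fintype.card (𝓞 k →+* ZMod p)) := by
  have h1 : ∀ φ : 𝓞 k →+* ZMod p, ∏ j, (1 - (quadraticChar (ZMod p) (φ (a j)) : ℝ)) =
      ∑ S : Finset κ, (-1) ^ S.card * (quadraticChar (ZMod p) (φ (∏ j ∈ S, a j)) : ℝ) := by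
    intro φ
    simp_rw [sub_eq_add_neg]
    rw [Finset.prod_one_add, Finset.powerset_univ]
    refine Finset.sum_congr rfl fun S _ => ?_
    rw [Finset.prod_neg, map_prod, map_prod, Int.cast_prod]
  simp_rw [h1]
  rw [Finset.sum_comm, ← Finset.add_sum_erase _ _ (Finset.mem_univ ∅)]
  congr 1
  · simp
  · refine Finset.sum_congr rfl fun S _ => ?_
    rw [← Finset.mul_sum, Finset.sum_add_distrib]
    simp

theorem prod_one_sub_quadraticChar {ι : Type*} [Fintype ι] {z : ι → ZMod p} (hz : ∀ i, z i ≠ 0) :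
    ∏ i, (1 - (quadraticChar (ZMod p) (z i) : ℝ)) =
      open scoped Classical in
      if ∀ i, quadraticChar (ZMod p) (z i) = -1 then 2 ^ Fintype.card ι else 0 := by
  split_ifs with h
  · simp_rw [h]
    norm_num
  · push Not at h
    obtain ⟨i, hi⟩ := h
    refine Finset.prod_eq_zero (Finset.mem_univ i) ?_
    rw [(quadraticChar_dichotomy (hz i)).resolve_right hi]
    norm_num

theorem sum_prod_one_sub_eq {ι : Type*} [Fintype ι] (hk : Module.finrank ℚ k = 2)
    {τ : 𝓞 k →+* 𝓞 k} (hτ : ∀ x, τ (τ x) = x) {γ : 𝓞 k} (hγ : τ γ = -γ) (α : ι → 𝓞 k)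
    (hp2 : (2 : ZMod p) ≠ 0) (hγ0 : ∀ φ : 𝓞 k →+* ZMod p, φ γ ≠ 0)
    (hα : ∀ (φ : 𝓞 k →+* ZMod p) i, φ (α i) ≠ 0) {Q : Prop} [Decidable Q]
    (hQ : Q ↔ (∃ φ ψ : 𝓞 k →+* ZMod p, φ ≠ ψ) ∧
      ∀ (φ : 𝓞 k →+* ZMod p) i, quadraticChar (ZMod p) (φ (α i)) = -1) :
    ∑ φ : 𝓞 k →+* ZMod p,
        ∏ j, (1 - (quadraticChar (ZMod p) (φ (Sum.elim α (τ ∘ α) j)) : ℝ)) =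
      if Q then 2 ^ (2 * Fintype.card ι + 1) else 0 := by
  classical
  have hp : p.Prime := Fact.out
  rcases isEmpty_or_nonempty (𝓞 k →+* ZMod p) with he | ⟨⟨φ⟩⟩
  · rw [if_neg fun h => he.elim (hQ.1 h).1.choose, Finset.sum_eq_zero fun φ _ => he.elim φ]
  have hne : φ ≠ φ.comp τ := by
    intro h
    have h1 := congrArg (fun ψ : 𝓞 k →+* ZMod p => ψ γ) h
    simp only [RingHom.comp_apply, hγ, map_neg] at h1
    exact mul_ne_zero hp2 (hγ0 φ) (by linear_combination h1)
  have hττ : (φ.comp τ).comp τ = φ := RingHom.ext fun x => by simp [hτ]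
  have huniv : (Finset.univ : Finset (𝓞 k →+* ZMod p)) = {φ, φ.comp τ} := by
    ext χ
    simpa using ringHom_eq_or_eq hp hk hne χ
  have hterm : ∀ ψ : 𝓞 k →+* ZMod p,
      ∏ j, (1 - (quadraticChar (ZMod p) (ψ (Sum.elim α (τ ∘ α) j)) : ℝ)) =
        (if ∀ i, quadraticChar (ZMod p) (ψ (α i)) = -1 then 2 ^ Fintype.card ι else 0) *
        (if ∀ i, quadraticChar (ZMod p) (ψ.comp τ (α i)) = -1 then 2 ^ Fintype.card ι else 0) := by
    intro ψ
    rw [Fintype.prod_sum_type, ← prod_one_sub_quadraticChar (hα ψ),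
      ← prod_one_sub_quadraticChar (hα (ψ.comp τ))]
    rfl
  have hall : (∀ (ψ : 𝓞 k →+* ZMod p) i, quadraticChar (ZMod p) (ψ (α i)) = -1) ↔
      (∀ i, quadraticChar (ZMod p) (φ (α i)) = -1) ∧
        ∀ i, quadraticChar (ZMod p) (φ.comp τ (α i)) = -1 := by
    refine ⟨fun h => ⟨h φ, h _⟩, fun h ψ => ?_⟩
    rcases ringHom_eq_or_eq hp hk hne ψ with rfl | rfl
    exacts [h.1, h.2]
  rw [huniv, Finset.sum_pair hne, hterm, hterm, hττ]
  rw [hall] at hQ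
  by_cases h1 : ∀ i, quadraticChar (ZMod p) (φ (α i)) = -1
  · by_cases h2 : ∀ i, quadraticChar (ZMod p) (φ.comp τ (α i)) = -1
    · rw [if_pos h1, if_pos h2, if_pos (hQ.2 ⟨⟨_, _, hne⟩, h1, h2⟩)]
      ring
    · rw [if_neg h2, if_neg fun h => h2 (hQ.1 h).2.2]
      ring
  · rw [if_neg h1, if_neg fun h => h1 (hQ.1 h).2.1]
    ring

end CharacterSum

section PrimeCount
open Asymptotics

theorem natCast_absNorm_span_eq_zero {k : Type*} [Field k] [NumberField k] {p : ℕ}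
    {φ : 𝓞 k →+* ZMod p} {δ : 𝓞 k} (h : φ δ = 0) : p ∣ Ideal.absNorm (Ideal.span {δ}) := by
  have h1 : Ideal.span {δ} ≤ RingHom.ker φ := (Ideal.span_singleton_le_iff_mem _).2 h
  have h2 := h1 (Ideal.absNorm_mem (Ideal.span {δ}))
  rw [RingHom.mem_ker, map_natCast] at h2
  exact (ZMod.natCast_eq_zero_iff _ _).1 h2

theorem isBigO_one_div_log_sq :
    (fun _ : ℝ => (1 : ℝ)) =O[atTop] fun x => x / Real.log x ^ 2 := by
  have h := (Real.isLittleO_pow_log_id_atTop (n := 2)).bound one_pos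
  refine IsBigO.of_bound 1 ?_
  filter_upwards [h, eventually_gt_atTop 1] with x hx hx1
  have hl : 0 < Real.log x := Real.log_pos hx1
  rw [one_mul, id, Real.norm_of_nonneg (by positivity), Real.norm_of_nonneg (by linarith)] at hx
  rw [one_mul, norm_one, Real.norm_of_nonneg (by positivity), one_le_div (by positivity)]
  exact hx

theorem ncard_primes_eq_sum (Q : ℕ → Prop) [DecidablePred Q] (X : ℝ) :
    ({p : ℕ | p.Prime ∧ (p : ℝ) ≤ X ∧ Q p}.ncard : ℝ) =
      ∑ p ∈ Finset.Ioc 0 ⌊X⌋₊ with p.Prime, if Q p then (1 : ℝ) else 0 := by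
  rw [Finset.sum_boole, ← Set.ncard_coe_finset]
  congr 2
  ext p
  simp only [Set.mem_ofPred_eq, Finset.coe_filter, Finset.mem_filter, Finset.mem_Ioc]
  constructor
  · rintro ⟨hp, hX, hQ⟩
    exact ⟨⟨⟨hp.pos, Nat.le_floor hX⟩, hp⟩, hQ⟩
  · rintro ⟨⟨⟨h0, hX⟩, hp⟩, hQ⟩
    exact ⟨hp, (Nat.le_floor_iff' hp.ne_zero).1 hX, hQ⟩

theorem isBigO_sum_primes_of_eq_zero {f : ℕ → ℝ} {N : ℕ} (hN : N ≠ 0)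
    (hf : ∀ p : ℕ, p.Prime → ¬ p ∣ N → f p = 0) :
    (fun x : ℝ => ∑ p ∈ Finset.Ioc 0 ⌊x⌋₊ with p.Prime, f p) =O[atTop]
      fun x => x / Real.log x ^ 2 := by
  refine IsBigO.trans (IsBigO.of_bound (∑ p ∈ N.divisors, |f p|) (.of_forall fun x => ?_))
    isBigO_one_div_log_sq
  rw [norm_one, mul_one, Real.norm_eq_abs]
  refine (Finset.abs_sum_le_sum_abs _ _).trans ?_
  rw [← Finset.sum_filter_add_sum_filter_not _ (· ∣ N)]
  rw [Finset.sum_eq_zero (s := Finset.filter (fun p => ¬ p ∣ N) _), add_zero]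
  · refine Finset.sum_le_sum_of_subset_of_nonneg (fun p hp => ?_) fun _ _ _ => abs_nonneg _
    exact Nat.mem_divisors.2 ⟨(Finset.mem_filter.1 hp).2, hN⟩
  · intro p hp
    rw [Finset.mem_filter, Finset.mem_filter] at hp
    rw [hf p hp.1.2 hp.2, abs_zero]

theorem isBigO_ncard_primes {k : Type*} [Field k] [NumberField k] (hk : Module.finrank ℚ k = 2)
    {τ : 𝓞 k →+* 𝓞 k} (hτ : ∀ x, τ (τ x) = x) {γ : 𝓞 k} (hγ : τ γ = -γ) (hγ0 : γ ≠ 0)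
    {ι : Type*} [Fintype ι] (α : ι → 𝓞 k) (hα0 : ∀ i, α i ≠ 0)
    (hM : ∀ S : Finset (ι ⊕ ι), S.Nonempty → ∃ (M : Type) (_ : Field M) (_ : NumberField M)
      (_ : Algebra k M) (β : 𝓞 M), IsQuadraticGenerator (∏ j ∈ S, Sum.elim α (τ ∘ α) j) β)
    (Q : ℕ → Prop)
    (hQ : ∀ (p : ℕ) [Fact p.Prime], (2 : ZMod p) ≠ 0 →
      (∀ (φ : 𝓞 k →+* ZMod p) i, φ (α i) ≠ 0) →
      (Q p ↔ (∃ φ ψ : 𝓞 k →+* ZMod p, φ ≠ ψ) ∧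
        ∀ (φ : 𝓞 k →+* ZMod p) i, quadraticChar (ZMod p) (φ (α i)) = -1)) :
    (fun X : ℝ => ({p : ℕ | p.Prime ∧ (p : ℝ) ≤ X ∧ Q p}.ncard : ℝ) -
      (1 / 2 ^ (2 * Fintype.card ι + 1)) * X / Real.log X) =O[atTop]
        fun X : ℝ => X / Real.log X ^ 2 := by
  classical
  set a := Sum.elim α (τ ∘ α) with ha
  have hc : ∀ S : Finset (ι ⊕ ι), ∃ c : ℕ → ℝ, S.Nonempty →
      ((fun x : ℝ => ∑ p ∈ Finset.Ioc 0 ⌊x⌋₊ with p.Prime, c p - x / Real.log x) =O[atTop]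
        fun x => x / Real.log x ^ 2) ∧
      ∀ (p : ℕ) [Fact p.Prime] [Fintype (𝓞 k →+* ZMod p)], (2 : ZMod p) ≠ 0 →
        (∀ φ : 𝓞 k →+* ZMod p, φ (∏ j ∈ S, a j) ≠ 0) →
        c p = ∑ φ : 𝓞 k →+* ZMod p, ((quadraticChar (ZMod p) (φ (∏ j ∈ S, a j)) : ℝ) + 1) := by
    intro S
    by_cases hS : S.Nonempty
    · obtain ⟨M, _, _, _, β, hβ⟩ := hM S hS
      exact ⟨idealCount M, fun _ => ⟨sum_prime_idealCount_isBigO M, fun p _ _ h2 h =>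
        hβ.idealCount_eq_sum h2 h⟩⟩
    · exact ⟨0, fun h => absurd h hS⟩
  choose c hc using hc
  set g : ℕ → ℝ := fun p => idealCount k p + ∑ S ∈ (Finset.univ : Finset (Finset (ι ⊕ ι))).erase ∅,
    (-1) ^ S.card * (c S p - idealCount k p) with hg
  set m := 2 * Fintype.card ι + 1 with hm
  set N := 2 * Ideal.absNorm (Ideal.span {γ * ∏ i, α i}) with hN
  have hN0 : N ≠ 0 := by
    rw [hN]
    refine mul_ne_zero two_ne_zero fun h => ?_
    rw [Ideal.absNorm_eq_zero_iff, Ideal.span_singleton_eq_bot] at h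
    exact mul_ne_zero hγ0 (Finset.prod_ne_zero_iff.2 fun i _ => hα0 i) h
  have hgood : ∀ p : ℕ, p.Prime → ¬ p ∣ N → (2 ^ m * if Q p then (1 : ℝ) else 0) - g p = 0 := by
    intro p hp hpN
    have : Fact p.Prime := ⟨hp⟩
    have := finite_ringHom_zmod (K := k) hp
    have := Fintype.ofFinite (𝓞 k →+* ZMod p)
    have h2 : (2 : ZMod p) ≠ 0 := by
      intro h
      have h' : ((2 : ℕ) : ZMod p) = 0 := by exact_mod_cast h
      exact hpN (((ZMod.natCast_eq_zero_iff _ _).1 h').mul_right _)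
    have hδ : ∀ φ : 𝓞 k →+* ZMod p, φ γ * ∏ i, φ (α i) ≠ 0 := by
      intro φ h
      rw [← map_prod, ← map_mul] at h
      exact hpN ((natCast_absNorm_span_eq_zero h).mul_left _)
    have hγp : ∀ φ : 𝓞 k →+* ZMod p, φ γ ≠ 0 := fun φ => left_ne_zero_of_mul (hδ φ)
    have hαp : ∀ (φ : 𝓞 k →+* ZMod p) i, φ (α i) ≠ 0 := fun φ i =>
      Finset.prod_ne_zero_iff.1 (right_ne_zero_of_mul (hδ φ)) i (Finset.mem_univ i)
    have hap : ∀ (φ : 𝓞 k →+* ZMod p) j, φ (a j) ≠ 0 := by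
      rintro φ (i | i)
      exacts [hαp φ i, hαp (φ.comp τ) i]
    have h3 := sum_prod_one_sub_eq hk hτ hγ α h2 hγp hαp (hQ p h2 hαp)
    rw [← ha, sum_prod_one_sub_quadraticChar] at h3
    have h4 : idealCount k p = Fintype.card (𝓞 k →+* ZMod p) := by
      rw [idealCount_prime_eq_card hp, Nat.card_eq_fintype_card]
    rw [mul_ite, mul_one, mul_zero, ← h3, hg, sub_eq_zero, ← h4]
    congr 1
    refine Finset.sum_congr rfl fun S hS => ?_
    rw [(hc S (Finset.nonempty_iff_ne_empty.2 (Finset.ne_of_mem_erase hS))).2 p h2 fun φ => by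
      rw [map_prod]
      exact Finset.prod_ne_zero_iff.2 fun j _ => hap φ j]
  have hk1 := sum_prime_idealCount_isBigO k
  have hO1 := isBigO_sum_primes_of_eq_zero hN0 hgood
  have hO2 : (fun x : ℝ => ∑ S ∈ (Finset.univ : Finset (Finset (ι ⊕ ι))).erase ∅,
      (-1) ^ S.card * ((∑ p ∈ Finset.Ioc 0 ⌊x⌋₊ with p.Prime, c S p - x / Real.log x) -
        (∑ p ∈ Finset.Ioc 0 ⌊x⌋₊ with p.Prime, idealCount k p - x / Real.log x))) =O[atTop]
        fun x => x / Real.log x ^ 2 := by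
    refine IsBigO.fun_sum fun S hS => IsBigO.const_mul_left (IsBigO.sub ?_ hk1) _
    exact (hc S (Finset.nonempty_iff_ne_empty.2 (Finset.ne_of_mem_erase hS))).1
  refine (((hO1.add hk1).add hO2).const_mul_left (1 / 2 ^ m)).congr_left fun x => ?_
  rw [ncard_primes_eq_sum]
  simp only [sub_sub_sub_cancel_right, hg, ← Finset.sum_sub_distrib, Finset.mul_sum]
  rw [Finset.sum_sub_distrib, Finset.sum_add_distrib, Finset.sum_comm, ← Finset.mul_sum]
  field_simp
  ring

end PrimeCount

section SquareRoots
open IntermediateField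

variable {F E : Type*} [Field F] [Field E] [Algebra F E]

theorem finrank_adjoin_simple_le_two {b : E} {a : F} (hb : b ^ 2 = algebraMap F E a) :
    FiniteDimensional F F⟮b⟯ ∧ Module.finrank F F⟮b⟯ ≤ 2 := by
  have h0 : (Polynomial.X ^ 2 - Polynomial.C a : Polynomial F).Monic :=
    Polynomial.monic_X_pow_sub_C a two_ne_zero
  have h1 : Polynomial.aeval b (Polynomial.X ^ 2 - Polynomial.C a) = 0 := by simp [hb]
  have h2 : IsIntegral F b := ⟨_, h0, h1⟩
  refine ⟨adjoin.finiteDimensional h2, ?_⟩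
  rw [adjoin.finrank h2, ← Polynomial.natDegree_X_pow_sub_C (n := 2) (r := a)]
  exact Polynomial.natDegree_le_natDegree (minpoly.min F b h0 h1)

theorem finrank_adjoin_simple_eq_two {b : E} {a : F} (hb : b ^ 2 = algebraMap F E a)
    (hb' : b ∉ Set.range (algebraMap F E)) : Module.finrank F F⟮b⟯ = 2 := by
  obtain ⟨h1, h2⟩ := finrank_adjoin_simple_le_two hb
  have h3 : 0 < Module.finrank F F⟮b⟯ := Module.finrank_pos
  have h4 : Module.finrank F F⟮b⟯ ≠ 1 := by
    rw [Ne, finrank_adjoin_simple_eq_one_iff, IntermediateField.mem_bot]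
    exact hb'
  omega

theorem finrank_adjoin_image_le {ι : Type*} [DecidableEq ι] {b : ι → E} {a : ι → F}
    (hb : ∀ i, b i ^ 2 = algebraMap F E (a i)) (T : Finset ι) :
    FiniteDimensional F (adjoin F (b '' T)) ∧ Module.finrank F (adjoin F (b '' T)) ≤ 2 ^ T.card := by
  induction T using Finset.induction_on with
  | empty =>
    rw [Finset.coe_empty, Set.image_empty, adjoin_empty]
    exact ⟨inferInstance, by rw [IntermediateField.finrank_bot, Finset.card_empty, pow_zero]⟩
  | insert i T hi ih =>
    obtain ⟨h1, h2⟩ := ih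
    obtain ⟨h3, h4⟩ := finrank_adjoin_simple_le_two (hb i)
    rw [Finset.coe_insert, Set.image_insert_eq, Set.insert_eq, adjoin_union]
    refine ⟨finiteDimensional_sup _ _, (finrank_sup_le _ _).trans ?_⟩
    rw [Finset.card_insert_of_notMem hi, pow_succ']
    exact Nat.mul_le_mul h4 h2

theorem prod_notMem_range_of_le_finrank_adjoin {ι : Type*} [Fintype ι] {b : ι → E} {a : ι → F}
    (hb : ∀ i, b i ^ 2 = algebraMap F E (a i)) (hb0 : ∀ i, b i ≠ 0)
    (hfin : 2 ^ Fintype.card ι ≤ Module.finrank F (adjoin F (Set.range b)))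
    {S : Finset ι} (hS : S.Nonempty) : ∏ j ∈ S, b j ∉ Set.range (algebraMap F E) := by
  classical
  rintro ⟨c, hc⟩
  obtain ⟨i, hi⟩ := hS
  set T := Finset.univ.erase i with hT
  have hmem : ∀ j ∈ T, b j ∈ adjoin F (b '' T) := fun j hj =>
    subset_adjoin F _ ⟨j, hj, rfl⟩
  have hle : adjoin F (Set.range b) ≤ adjoin F (b '' T) := by
    rw [adjoin_le_iff]
    rintro _ ⟨j, rfl⟩
    by_cases hj : j = i
    · have h0 : ∏ l ∈ S.erase i, b l ≠ 0 := Finset.prod_ne_zero_iff.2 fun l _ => hb0 l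
      have h1 : b i = algebraMap F E c / ∏ l ∈ S.erase i, b l := by
        rw [hc, ← Finset.mul_prod_erase S b hi, mul_div_assoc, div_self h0, mul_one]
      rw [hj, h1]
      exact div_mem (IntermediateField.algebraMap_mem _ c) (prod_mem fun l hl =>
        hmem l (Finset.mem_erase.2 ⟨Finset.ne_of_mem_erase hl, Finset.mem_univ l⟩))
    · exact hmem j (Finset.mem_erase.2 ⟨hj, Finset.mem_univ j⟩)
  obtain ⟨h1, h2⟩ := finrank_adjoin_image_le hb T
  have h3 : Module.finrank F (adjoin F (Set.range b)) ≤ Module.finrank F (adjoin F (b '' T)) :=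
    LinearMap.finrank_le_finrank_of_injective (f := (inclusion hle).toLinearMap)
      (inclusion_injective hle)
  have h4 : T.card < Fintype.card ι := Finset.card_erase_lt_of_mem (Finset.mem_univ i)
  exact absurd (hfin.trans (h3.trans h2)) (not_le.2 (Nat.pow_lt_pow_right one_lt_two h4))

end SquareRoots

section Generators

theorem exists_ringOfIntegers_eq {K : Type*} [Field K] {x : K} (hx : IsIntegral ℤ x) :
    ∃ y : 𝓞 K, algebraMap (𝓞 K) K y = x :=
  ⟨⟨x, hx⟩, rfl⟩

theorem exists_isQuadraticGenerator {k M : Type*} [Field k] [NumberField k] [Field M]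
    [NumberField M] [Algebra k M] (h : Module.finrank k M = 2) :
    ∃ (α : 𝓞 k) (β : 𝓞 M), IsQuadraticGenerator α β := by
  obtain ⟨x, a, hx, hxa⟩ := exists_sq_mem_range_of_finrank_eq_two h
  have hz : IsAlgebraic ℤ x := (IsFractionRing.isAlgebraic_iff ℤ ℚ M).2
    (Algebra.IsAlgebraic.isAlgebraic x)
  obtain ⟨y, hy0, hy⟩ := hz.exists_integral_multiple
  obtain ⟨β, hβ⟩ := exists_ringOfIntegers_eq hy
  have hy0' : (y : k) ≠ 0 := Int.cast_ne_zero.2 hy0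
  have hsq : (y • x) ^ 2 = algebraMap k M ((y : k) ^ 2 * a) := by
    rw [zsmul_eq_mul, mul_pow, hxa, map_mul, map_pow, map_intCast]
  have hintegr : IsIntegral ℤ ((y : k) ^ 2 * a) := by
    rw [← isIntegral_algebraMap_iff (algebraMap k M).injective, ← hsq]
    exact hy.pow 2
  obtain ⟨α, hα⟩ := exists_ringOfIntegers_eq hintegr
  refine ⟨α, β, h, ?_, ?_⟩
  · rintro ⟨c, hc⟩
    refine hx ⟨(y : k)⁻¹ * c, ?_⟩
    rw [map_mul, hc, hβ, zsmul_eq_mul, map_inv₀, map_intCast,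
      inv_mul_cancel_left₀ (by rw [← map_intCast (algebraMap k M)]; exact (map_ne_zero _).2 hy0')]
  · apply FaithfulSMul.algebraMap_injective (𝓞 M) M
    rw [map_pow, hβ, hsq, ← hα]
    rfl

theorem IsQuadraticGenerator.ne_zero {k M : Type*} [Field k] [NumberField k] [Field M]
    [NumberField M] [Algebra k M] {α : 𝓞 k} {β : 𝓞 M} (h : IsQuadraticGenerator α β) :
    α ≠ 0 := by
  rintro rfl
  have h1 := h.sq
  rw [map_zero, pow_eq_zero_iff two_ne_zero] at h1
  exact h.notMem ⟨0, by rw [h1, map_zero, map_zero]⟩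

open IntermediateField in
theorem exists_isQuadraticGenerator_of_sq_eq {k E : Type} [Field k] [NumberField k] [Field E]
    [CharZero E] [Algebra k E] {α : 𝓞 k} {b : E}
    (hb : b ^ 2 = algebraMap k E (algebraMap (𝓞 k) k α)) (hb' : b ∉ Set.range (algebraMap k E)) :
    ∃ (M : Type) (_ : Field M) (_ : NumberField M) (_ : Algebra k M) (β : 𝓞 M),
      IsQuadraticGenerator α β := by
  have : FiniteDimensional k k⟮b⟯ := (finrank_adjoin_simple_le_two hb).1
  have : NumberField k⟮b⟯ := NumberField.of_module_finite k k⟮b⟯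
  have hsq : AdjoinSimple.gen k b ^ 2 = algebraMap k k⟮b⟯ (algebraMap (𝓞 k) k α) :=
    Subtype.ext hb
  have hintegr : IsIntegral ℤ (AdjoinSimple.gen k b) := by
    refine IsIntegral.of_pow two_pos ?_
    rw [hsq]
    exact (RingOfIntegers.isIntegral_coe α).algebraMap
  obtain ⟨β, hβ⟩ := exists_ringOfIntegers_eq hintegr
  refine ⟨k⟮b⟯, inferInstance, inferInstance, inferInstance, β,
    finrank_adjoin_simple_eq_two hb hb', ?_, ?_⟩
  · rintro ⟨c, hc⟩
    refine hb' ⟨c, ?_⟩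
    rw [hβ] at hc
    exact congrArg Subtype.val hc
  · apply FaithfulSMul.algebraMap_injective (𝓞 k⟮b⟯) k⟮b⟯
    rw [map_pow, hβ, hsq]
    rfl

end Generators

section ComplexFields
open IntermediateField

theorem exists_sqrt_of_le {k L : IntermediateField ℚ ℂ} [NumberField k] (h : k ≤ L)
    (hL : Module.finrank ℚ L = 2 * Module.finrank ℚ k) :
    ∃ (α : 𝓞 k) (b : ℂ), α ≠ 0 ∧ b ^ 2 = algebraMap (𝓞 k) k α ∧
      (∀ x ∈ L, ∃ c ∈ k, ∃ d ∈ k, x = c + d * b) ∧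
      ∀ (p : ℕ) [Fact p.Prime] (φ : 𝓞 k →+* ZMod p), (2 : ZMod p) ≠ 0 → φ α ≠ 0 →
        (SplitsIn k L h (RingHom.ker φ) ↔ quadraticChar (ZMod p) (φ α) = 1) := by
  let _ : Algebra k L := (inclusion h).toRingHom.toAlgebra
  have hk0 : 0 < Module.finrank ℚ k := Module.finrank_pos
  have : FiniteDimensional ℚ L := FiniteDimensional.of_finrank_pos (by omega)
  have : NumberField L := { }
  have hfin : Module.finrank k L = 2 := by
    have h1 := Module.finrank_mul_finrank ℚ k L
    rw [hL, mul_comm] at h1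
    exact Nat.eq_of_mul_eq_mul_right hk0 h1
  obtain ⟨α, β, hβ⟩ := exists_isQuadraticGenerator hfin
  refine ⟨α, algebraMap (𝓞 L) L β, hβ.ne_zero, ?_, fun x hx => ?_, fun p _ φ h2 hφ => ?_⟩
  · exact congrArg Subtype.val hβ.coe_sq
  · obtain ⟨c, d, hcd⟩ := exists_eq_add_mul_of_finrank_eq_two hfin hβ.notMem ⟨x, hx⟩
    exact ⟨c, c.2, d, d.2, congrArg Subtype.val hcd⟩
  · exact hβ.map_ker_eq_mul_iff h2 hφ

theorem exists_ringHom_conj {k : IntermediateField ℚ ℂ} [NumberField k]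
    (hquad : Module.finrank ℚ k = 2) (himag : ¬ (k : Set ℂ) ⊆ Set.range Complex.ofReal) :
    ∃ (τ : 𝓞 k →+* 𝓞 k) (γ : 𝓞 k), (∀ x : 𝓞 k, (algebraMap (𝓞 k) k (τ x) : ℂ) =
      starRingEnd ℂ (algebraMap (𝓞 k) k x)) ∧ τ γ = -γ ∧ γ ≠ 0 ∧
      ∀ x ∈ k, starRingEnd ℂ x ∈ k := by
  obtain ⟨α, γ, hγ⟩ := exists_isQuadraticGenerator hquad
  set r : ℚ := algebraMap (𝓞 ℚ) ℚ α with hr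
  set g : ℂ := ((algebraMap (𝓞 k) k γ : k) : ℂ) with hg
  have hgk : g ∈ k := (algebraMap (𝓞 k) k γ).2
  have hsq : g ^ 2 = (r : ℂ) := congrArg Subtype.val hγ.coe_sq
  have hdec : ∀ x ∈ k, ∃ a b : ℚ, x = a + b * g := by
    intro x hx
    obtain ⟨c, d, hcd⟩ := exists_eq_add_mul_of_finrank_eq_two hquad hγ.notMem ⟨x, hx⟩
    exact ⟨c, d, congrArg Subtype.val hcd⟩
  have him : g.im ≠ 0 := by
    intro h0
    refine himag fun x hx => ?_
    obtain ⟨a, b, rfl⟩ := hdec x hx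
    refine ⟨a + b * g.re, ?_⟩
    apply Complex.ext <;> simp [h0]
  have hre : g.re = 0 := by
    have h1 := congrArg Complex.im hsq
    rw [pow_two, Complex.mul_im, Complex.ratCast_im] at h1
    have h2 : g.re * g.im = 0 := by linarith
    exact (mul_eq_zero.1 h2).resolve_right him
  have hconj : starRingEnd ℂ g = -g := by
    apply Complex.ext <;> simp [hre]
  have hstable : ∀ x ∈ k, starRingEnd ℂ x ∈ k := by
    intro x hx
    obtain ⟨a, b, rfl⟩ := hdec x hx
    rw [map_add, map_mul, hconj, map_ratCast, map_ratCast]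
    exact add_mem (SubfieldClass.ratCast_mem k a)
      (mul_mem (SubfieldClass.ratCast_mem k b) (neg_mem hgk))
  let σ : k →+* k := RingHom.codRestrict ((starRingEnd ℂ).comp (algebraMap k ℂ)) k
    fun x => hstable x x.2
  refine ⟨RingOfIntegers.mapRingHom σ, γ, fun x => rfl, ?_, ?_, hstable⟩
  · apply RingOfIntegers.ext
    apply Subtype.ext
    exact hconj
  · rintro rfl
    exact him (by rw [hg, map_zero]; simp)

theorem ratPrimeSplitsIn_iff {k : IntermediateField ℚ ℂ} [NumberField k]
    (hquad : Module.finrank ℚ k = 2) {p : ℕ} (hp : p.Prime) :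
    RatPrimeSplitsIn k p ↔ ∃ φ ψ : 𝓞 k →+* ZMod p, φ ≠ ψ := by
  have hI := absNorm_span_natCast_of_finrank_eq_two (p := p) hquad
  constructor
  · rintro ⟨P, Q, hPQ, hP, hQ, h⟩
    obtain ⟨φ, ψ, rfl, rfl⟩ := exists_ringHom_of_eq_mul hp hI hP hQ h
    exact ⟨φ, ψ, fun h => hPQ (by rw [h])⟩
  · rintro ⟨φ, ψ, hne⟩
    have : Fact p.Prime := ⟨hp⟩
    obtain ⟨h1, h2⟩ := eq_mul_of_absNorm_eq_sq hp hI hne (span_natCast_le_ker φ)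
      (span_natCast_le_ker ψ)
    exact ⟨_, _, h1, RingHom.ker_isPrime φ, RingHom.ker_isPrime ψ, h2⟩

theorem pow_le_finrank_adjoin {k : IntermediateField ℚ ℂ} [NumberField k] {n : ℕ}
    {L : Fin n → IntermediateField ℚ ℂ} {b : Fin n → ℂ}
    (hsq : ∀ j, ∃ a : k, (Sum.elim b (starRingEnd ℂ ∘ b) j) ^ 2 = algebraMap k ℂ a)
    (hstable : ∀ x ∈ k, starRingEnd ℂ x ∈ k)
    (hL : ∀ i, ∀ x ∈ L i, ∃ c ∈ k, ∃ d ∈ k, x = c + d * b i)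
    (hcompositum : Module.finrank ℚ ↥(⨆ i, L i ⊔ conjField (L i)) =
        2 ^ (2 * n) * Module.finrank ℚ k) :
    2 ^ Fintype.card (Fin n ⊕ Fin n) ≤
      Module.finrank k (adjoin k (Set.range (Sum.elim b (starRingEnd ℂ ∘ b)))) := by
  set E := adjoin k (Set.range (Sum.elim b (starRingEnd ℂ ∘ b))) with hE
  have hbE : ∀ j, Sum.elim b (starRingEnd ℂ ∘ b) j ∈ E := fun j => subset_adjoin k _ ⟨j, rfl⟩
  have hkE : ∀ x ∈ k, x ∈ E := fun x hx => E.algebraMap_mem ⟨x, hx⟩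
  have hle : (⨆ i, L i ⊔ conjField (L i)) ≤ E.restrictScalars ℚ := by
    refine iSup_le fun i => sup_le (fun x hx => ?_) fun x hx => ?_
    · obtain ⟨c, hc, d, hd, rfl⟩ := hL i x hx
      exact add_mem (hkE c hc) (mul_mem (hkE d hd) (hbE (Sum.inl i)))
    · obtain ⟨y, hy, rfl⟩ := hx
      obtain ⟨c, hc, d, hd, rfl⟩ := hL i y hy
      have h1 : starRingEnd ℂ (c + d * b i) ∈ E := by
        rw [map_add, map_mul]
        exact add_mem (hkE _ (hstable c hc)) (mul_mem (hkE _ (hstable d hd)) (hbE (Sum.inr i)))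
      exact h1
  choose a ha using hsq
  have : FiniteDimensional k E := by
    have h1 := (finrank_adjoin_image_le ha Finset.univ).1
    rwa [Finset.coe_univ, Set.image_univ] at h1
  have : FiniteDimensional ℚ E := FiniteDimensional.trans ℚ k E
  have : FiniteDimensional ℚ (E.restrictScalars ℚ) := this
  have h2 : Module.finrank ℚ ↥(⨆ i, L i ⊔ conjField (L i)) ≤
      Module.finrank ℚ (E.restrictScalars ℚ) :=
    LinearMap.finrank_le_finrank_of_injective (f := (inclusion hle).toLinearMap)
      (inclusion_injective hle)
  have h3 : Module.finrank ℚ (E.restrictScalars ℚ) = Module.finrank k E * Module.finrank ℚ k := by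
    rw [mul_comm]
    exact (Module.finrank_mul_finrank ℚ k E).symm
  rw [hcompositum, h3] at h2
  rw [Fintype.card_sum, Fintype.card_fin, ← two_mul]
  exact Nat.le_of_mul_le_mul_right h2 Module.finrank_pos

end ComplexFields

/-- Let `k ⊂ ℂ` be an imaginary quadratic field, `L₁, …, Lₙ` quadratic extensions of `k`
in `ℂ`, with conjugate fields `L₁', …, Lₙ'`, such that the compositum of all of them has
degree `2^(2n)` over `k`.  Then the number of rational primes `p ≤ X` which split in `k`
and such that every prime of `O_k` above `p` is nonsplit in every `L_i/k` equals
`(1/2^(2n+1))·X/log X + O(X/(log X)²)`. -/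
theorem count_rational_primes_split_in_k_nonsplit_in_extensions
    (k : IntermediateField ℚ ℂ) [NumberField ↥k]
    (hquad : Module.finrank ℚ ↥k = 2)
    (himag : ¬ (k : Set ℂ) ⊆ Set.range (Complex.ofReal))
    (n : ℕ) (hn : 1 ≤ n)
    (L : Fin n → IntermediateField ℚ ℂ)
    (hkL : ∀ i, k ≤ L i)
    (hLquad : ∀ i, Module.finrank ℚ ↥(L i) = 2 * Module.finrank ℚ ↥k)
    (hkL' : ∀ i, k ≤ conjField (L i))
    (hcompositum :
      Module.finrank ℚ ↥(⨆ i, L i ⊔ conjField (L i)) =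
        2 ^ (2 * n) * Module.finrank ℚ ↥k) :
    (fun X : ℝ =>
        (({p : ℕ | p.Prime ∧ (p : ℝ) ≤ X ∧ RatPrimeSplitsIn k p ∧
            ∀ 𝔭 : Ideal (𝓞 ↥k), 𝔭.IsPrime → (p : 𝓞 ↥k) ∈ 𝔭 →
              ∀ i, ¬ SplitsIn k (L i) (hkL i) 𝔭}.ncard : ℝ)) -
          (1 / 2 ^ (2 * n + 1)) * X / Real.log X)
      =O[atTop] (fun X : ℝ => X / Real.log X ^ 2) := by
  obtain ⟨τ, γ, hτ, hγ, hγ0, hstable⟩ := exists_ringHom_conj hquad himag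
  choose α b hα0 hb hdec hsplit using fun i => exists_sqrt_of_le (hkL i) (hLquad i)
  have hττ : ∀ x, τ (τ x) = x := fun x => by
    apply RingOfIntegers.ext
    apply Subtype.ext
    exact (hτ (τ x)).trans (by rw [hτ x, Complex.conj_conj])
  set B := Sum.elim b (starRingEnd ℂ ∘ b) with hB
  have hBsq : ∀ j, B j ^ 2 =
      algebraMap k ℂ (algebraMap (𝓞 k) k (Sum.elim α (τ ∘ α) j)) := by
    rintro (i | i)
    · exact hb i
    · exact ((map_pow (starRingEnd ℂ) (b i) 2).symm.trans (congrArg _ (hb i))).trans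
        (hτ (α i)).symm
  have hinj : Function.Injective τ := Function.LeftInverse.injective hττ
  have hB0 : ∀ j, B j ≠ 0 := by
    intro j hj
    have h1 := hBsq j
    rw [hj, zero_pow two_ne_zero, eq_comm, map_eq_zero,
      FaithfulSMul.algebraMap_eq_zero_iff] at h1
    rcases j with i | i
    · exact hα0 i h1
    · exact hα0 i (hinj (h1.trans (map_zero τ).symm))
  have hrank := pow_le_finrank_adjoin (fun j => ⟨_, hBsq j⟩) hstable hdec hcompositum
  have hmain := isBigO_ncard_primes hquad hττ hγ hγ0 α hα0 (fun S hS => by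
    refine exists_isQuadraticGenerator_of_sq_eq (E := ℂ) (b := ∏ j ∈ S, B j) ?_
      (prod_notMem_range_of_le_finrank_adjoin hBsq hB0 hrank hS)
    rw [← Finset.prod_pow, map_prod, map_prod]
    exact Finset.prod_congr rfl fun j _ => hBsq j)
    (fun p => RatPrimeSplitsIn k p ∧ ∀ 𝔭 : Ideal (𝓞 ↥k), 𝔭.IsPrime → (p : 𝓞 ↥k) ∈ 𝔭 →
      ∀ i, ¬ SplitsIn k (L i) (hkL i) 𝔭) ?_
  · rwa [Fintype.card_fin] at hmain
  intro p hp h2 hα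
  rw [ratPrimeSplitsIn_iff hquad hp.out]
  refine and_congr_right fun ⟨φ, ψ, hne⟩ => ⟨fun h χ i => ?_, fun h 𝔭 h𝔭 hp𝔭 i => ?_⟩
  · have h3 := h (RingHom.ker χ) (RingHom.ker_isPrime χ)
      (span_natCast_le_ker χ (Ideal.mem_span_singleton_self _)) i
    rw [hsplit i p χ h2 (hα χ i)] at h3
    exact (quadraticChar_dichotomy (hα χ i)).resolve_left h3
  · rcases exists_ker_eq_of_mem hp.out hquad hne h𝔭 hp𝔭 with rfl | rfl
    all_goals
      rw [hsplit i p _ h2 (hα _ i), h _ i]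
      decide
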